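/- arXiv:1302.2662 — 5 statements merged into one kernel-verified Lean document; each statement's English description precedes it below -/
import Mathlib

section
/- Let p ≥ 1 be an integer, let U be a nonempty open subset of the open unit disc in ℂ, and let f : U → ℂ be analytic and nowhere vanishing on U. For x = (x_1, …, x_p) ∈ U^p with pairwise distinct coordinates, set R(x) = Σ_{i=1}^p x_i^{p−1} / ( (1 − x_i²) ∏_{j ≠ i} (1 − x_i x_j)(x_i − x_j) · f(x_i) ). Then there exists an analytic function Ψ on U^p such that Ψ(x) = R(x) whenever the coordinates of x are pairwise distinct; that is, the apparent singularities of R along the diagonals x_i = x_j are removable. -/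
open Filter Topology Finset

lemma paramIntegral {E G : Type*} [NormedAddCommGroup E] [NormedSpace ℂ E]
    [NormedAddCommGroup G] [NormedSpace ℂ G] (L : ℝ → E →L[ℂ] G) (hL : Continuous L)
    (hL1 : ∀ t ∈ Set.Icc (0:ℝ) 1, ‖L t‖ ≤ 1) (x0 : E) (y0 : G)
    (h0 : ∀ t ∈ Set.Icc (0:ℝ) 1, L t x0 = y0) (g : G → ℂ)
    (hg : AnalyticAt ℂ g y0) :
    AnalyticAt ℂ (fun x => ∫ t in (0:ℝ)..1, g (L t x)) x0 := by
  obtain ⟨p, r, hp⟩ := hg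
  have hI : Set.uIoc (0:ℝ) 1 ⊆ Set.Icc 0 1 := by
    rw [Set.uIoc_of_le zero_le_one]; exact Set.Ioc_subset_Icc_self
  have hc : ∀ n, Continuous fun t => (p n).compContinuousLinearMap (fun _ => L t) := fun n =>
    ((ContinuousMultilinearMap.compContinuousLinearMapContinuousMultilinear ℂ
      (fun _ : Fin n => E) (fun _ : Fin n => G) ℂ).cont.comp
      (continuous_pi fun _ => hL)).clm_apply continuous_const
  have hb : ∀ n, ∀ t ∈ Set.Icc (0:ℝ) 1,
      ‖(p n).compContinuousLinearMap (fun _ => L t)‖ ≤ ‖p n‖ := by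
    intro n t ht
    refine (ContinuousMultilinearMap.norm_compContinuousLinearMap_le _ _).trans ?_
    refine mul_le_of_le_one_right (norm_nonneg _) ?_
    exact Finset.prod_le_one (fun _ _ => norm_nonneg _) (fun _ _ => hL1 t ht)
  refine ⟨fun n => ∫ t in (0:ℝ)..1, (p n).compContinuousLinearMap (fun _ => L t), r, ?_, hp.r_pos, ?_⟩
  · refine hp.r_le.trans ?_
    refine FormalMultilinearSeries.radius_le_of_le fun {n} => ?_
    have := intervalIntegral.norm_integral_le_of_norm_le_const (fun t ht => hb n t (hI ht))
    simpa using this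
  · intro y hy
    have hy' : ‖y‖ₑ < r := by simpa using hy
    have hs : ∀ t ∈ Set.Icc (0:ℝ) 1, HasSum (fun n => p n (fun _ => L t y)) (g (L t (x0 + y))) := by
      intro t ht
      rw [map_add, h0 t ht]
      refine hp.hasSum ?_
      have h1 : ‖L t y‖ ≤ ‖y‖ := by
        simpa using (L t).le_of_opNorm_le (hL1 t ht) y
      simp only [Metric.mem_eball, edist_zero_right]
      exact lt_of_le_of_lt (enorm_le_iff_norm_le.2 h1) hy'
    have key := intervalIntegral.hasSum_integral_of_dominated_convergence
      (μ := MeasureTheory.volume) (a := 0) (b := 1)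
      (F := fun n t => p n (fun _ => L t y)) (f := fun t => g (L t (x0 + y)))
      (fun n _ => ‖p n‖ * ‖y‖ ^ n) ?_ ?_ ?_ ?_ ?_
    · convert key using 2 with n
      have := ((ContinuousMultilinearMap.apply ℂ (fun _ : Fin n => E) ℂ (fun _ => y)).intervalIntegral_comp_comm
        ((hc n).intervalIntegrable (μ := MeasureTheory.volume) 0 1))
      exact this.symm
    · intro n
      refine Continuous.aestronglyMeasurable ?_
      exact (p n).cont.comp (continuous_pi fun _ => hL.clm_apply continuous_const)
    · intro n
      refine Eventually.of_forall fun t ht => ?_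
      refine ((p n).le_opNorm _).trans ?_
      have h1 : ‖L t y‖ ≤ ‖y‖ := by
        simpa using (L t).le_of_opNorm_le (hL1 t (hI ht)) y
      simp only [Finset.prod_const, Finset.card_univ, Fintype.card_fin]
      gcongr
    · refine Eventually.of_forall fun t _ => ?_
      have : (‖y‖₊ : ENNReal) < p.radius := lt_of_lt_of_le hy' hp.r_le
      simpa using p.summable_norm_mul_pow this
    · simp
    · exact Eventually.of_forall fun t ht => hs t (hI ht)

lemma dslope_analytic {E : Type*} [NormedAddCommGroup E] [NormedSpace ℂ E]
    (h : ℂ × E → ℂ) (z0 u0 : ℂ) (w0 : E) (h1 : AnalyticAt ℂ h (z0, w0))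
    (h2 : AnalyticAt ℂ h (u0, w0)) :
    AnalyticAt ℂ (fun v : ℂ × ℂ × E => dslope (fun ζ => h (ζ, v.2.2)) v.2.1 v.1) (z0, u0, w0) := by
  by_cases hne : z0 = u0
  · subst hne
    let A : ℂ × ℂ × E →L[ℂ] ℂ × E :=
      ((ContinuousLinearMap.fst ℂ ℂ E).comp (ContinuousLinearMap.snd ℂ ℂ (ℂ × E))).prod
        ((ContinuousLinearMap.snd ℂ ℂ E).comp (ContinuousLinearMap.snd ℂ ℂ (ℂ × E)))
    let B : ℂ × ℂ × E →L[ℂ] ℂ × E :=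
      (ContinuousLinearMap.fst ℂ ℂ (ℂ × E) -
        (ContinuousLinearMap.fst ℂ ℂ E).comp (ContinuousLinearMap.snd ℂ ℂ (ℂ × E))).prod 0
    let L : ℝ → ℂ × ℂ × E →L[ℂ] ℂ × E := fun t => A + (t : ℂ) • B
    have hLa : ∀ t v, L t v = (v.2.1 + t * (v.1 - v.2.1), v.2.2) := by
      intro t v; ext <;> simp [L, A, B]
    have hLc : Continuous L := by fun_prop
    have hconv : ∀ t ∈ Set.Icc (0:ℝ) 1, ∀ z u : ℂ, ∀ c, ‖z‖ ≤ c → ‖u‖ ≤ c →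
        ‖u + t * (z - u)‖ ≤ c := by
      intro t ht z u c hz hu
      have : u + t * (z - u) = ((1 - t : ℝ) : ℂ) * u + (t : ℂ) * z := by push_cast; ring
      rw [this]
      refine (norm_add_le _ _).trans ?_
      rw [norm_mul, norm_mul, Complex.norm_real, Complex.norm_real, Real.norm_of_nonneg ht.1,
        Real.norm_of_nonneg (by linarith [ht.2])]
      nlinarith [ht.1, ht.2]
    have hL1 : ∀ t ∈ Set.Icc (0:ℝ) 1, ‖L t‖ ≤ 1 := by
      intro t ht
      refine ContinuousLinearMap.opNorm_le_bound _ zero_le_one fun v => ?_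
      rw [hLa, one_mul, Prod.norm_mk]
      refine max_le (hconv t ht _ _ _ (norm_fst_le v) ?_) ?_
      · exact (norm_fst_le v.2).trans (norm_snd_le v)
      · exact (norm_snd_le v.2).trans (norm_snd_le v)
    have hg : AnalyticAt ℂ (fun v => fderiv ℂ h v (1, 0)) (z0, w0) :=
      ((ContinuousLinearMap.apply ℂ ℂ ((1:ℂ), (0:E))).analyticAt _).fun_comp h1.fderiv
    have main := paramIntegral L hLc hL1 (z0, z0, w0) (z0, w0)
      (fun t _ => by rw [hLa]; simp) _ hg
    refine main.congr ?_
    obtain ⟨ε, hε, hball⟩ := Metric.eventually_nhds_iff_ball.1 h1.eventually_analyticAt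
    filter_upwards [Metric.ball_mem_nhds (z0, z0, w0) hε] with v hv
    have hmem : ∀ t ∈ Set.Icc (0:ℝ) 1, AnalyticAt ℂ h (L t v) := by
      intro t ht
      apply hball
      rw [mem_ball_iff_norm] at hv ⊢
      have e : (z0, w0) = L t (z0, z0, w0) := by rw [hLa]; simp
      rw [e, ← map_sub]
      refine lt_of_le_of_lt ?_ hv
      simpa using (L t).le_of_opNorm_le (hL1 t ht) (v - (z0, z0, w0))
    obtain ⟨z, u, w⟩ := v
    simp only [hLa] at hmem ⊢
    by_cases hzu : z = u
    · subst hzu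
      have h3 : AnalyticAt ℂ h (z, w) := by simpa using hmem 0 (by simp)
      have h4 : HasDerivAt (fun ζ => h (ζ, w)) (fderiv ℂ h (z, w) (1, 0)) z :=
        h3.differentiableAt.hasFDerivAt.comp_hasDerivAt z
          ((hasDerivAt_id z).prodMk (hasDerivAt_const z w))
      simp [dslope_same, h4.deriv]
    · rw [dslope_of_ne _ hzu, slope_def_field, eq_div_iff (sub_ne_zero.2 hzu),
        ← intervalIntegral.integral_mul_const]
      have hcurve : Continuous fun t : ℝ => (u + t * (z - u), w) := by fun_prop
      rw [intervalIntegral.integral_eq_sub_of_hasDerivAt (f := fun t : ℝ => h (u + t * (z - u), w))]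
      · simp
      · intro t ht
        rw [Set.uIcc_of_le zero_le_one] at ht
        have d1 : HasDerivAt (fun t : ℝ => (u + t * (z - u), w)) (z - u, (0:E)) t := by
          refine HasDerivAt.prodMk ?_ (hasDerivAt_const t w)
          simpa using ((Complex.ofRealCLM.hasDerivAt (x := t)).mul_const (z - u)).const_add u
        have d2 := ((hmem t ht).differentiableAt.hasFDerivAt.restrictScalars ℝ).comp_hasDerivAt t d1
        refine HasDerivAt.congr_deriv (f := fun t : ℝ => h (u + t * (z - u), w)) d2 ?_
        have : ((z - u, (0:E)) : ℂ × E) = (z - u) • ((1:ℂ), (0:E)) := by simp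
        rw [this, ContinuousLinearMap.coe_restrictScalars', map_smul, smul_eq_mul, mul_comm]
      · refine ContinuousOn.intervalIntegrable ?_
        rw [Set.uIcc_of_le zero_le_one]
        intro t ht
        refine ContinuousAt.continuousWithinAt ?_
        have c1 : ContinuousAt (fun v => fderiv ℂ h v (1, 0)) (u + t * (z - u), w) :=
          (((ContinuousLinearMap.apply ℂ ℂ ((1:ℂ), (0:E))).analyticAt _).fun_comp (hmem t ht).fderiv).continuousAt
        exact (ContinuousAt.comp (f := fun t : ℝ => (u + t * (z - u), w)) c1
          hcurve.continuousAt).mul continuousAt_const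
  · have b1 : AnalyticAt ℂ (fun v : ℂ × ℂ × E => v.1) (z0, u0, w0) := analyticAt_fst
    have b2 : AnalyticAt ℂ (fun v : ℂ × ℂ × E => v.2.1) (z0, u0, w0) :=
      analyticAt_fst.fun_comp analyticAt_snd
    have b3 : AnalyticAt ℂ (fun v : ℂ × ℂ × E => v.2.2) (z0, u0, w0) :=
      analyticAt_snd.fun_comp analyticAt_snd
    have a1 : AnalyticAt ℂ (fun v : ℂ × ℂ × E => h (v.1, v.2.2)) (z0, u0, w0) :=
      AnalyticAt.fun_comp (g := h) (f := fun v : ℂ × ℂ × E => (v.1, v.2.2)) (x := (z0, u0, w0)) h1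
        (b1.prod b3)
    have a2 : AnalyticAt ℂ (fun v : ℂ × ℂ × E => h (v.2.1, v.2.2)) (z0, u0, w0) :=
      AnalyticAt.fun_comp (g := h) (f := fun v : ℂ × ℂ × E => (v.2.1, v.2.2)) (x := (z0, u0, w0)) h2
        (b2.prod b3)
    have a3 : AnalyticAt ℂ (fun v : ℂ × ℂ × E => v.1 - v.2.1) (z0, u0, w0) := b1.sub b2
    refine ((a1.sub a2).div a3 (sub_ne_zero.2 hne)).congr ?_
    filter_upwards [a3.continuousAt.eventually_ne (sub_ne_zero.2 hne)] with v hv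
    rw [dslope_of_ne _ (sub_ne_zero.1 hv), slope_def_field]
    rfl

lemma divided {p : ℕ} (U : Set ℂ) (h : ℂ × (Fin p → ℂ) → ℂ)
    (hh : ∀ z x, z ∈ U → (∀ i, x i ∈ U) → AnalyticAt ℂ h (z, x)) (S : Finset (Fin p)) :
    ∃ H : ℂ × (Fin p → ℂ) → ℂ,
      (∀ z x, z ∈ U → (∀ i, x i ∈ U) → AnalyticAt ℂ H (z, x)) ∧
      ∀ z x, Function.Injective x → (∀ i ∈ S, z ≠ x i) →
        H (z, x) = h (z, x) / ∏ j ∈ S, (z - x j) +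
          ∑ i ∈ S, h (x i, x) / ((x i - z) * ∏ j ∈ S.erase i, (x i - x j)) := by
  induction S using Finset.induction_on with
  | empty => exact ⟨h, hh, by simp⟩
  | insert a S ha ih =>
    obtain ⟨H, hH, hf⟩ := ih
    refine ⟨fun v => dslope (fun ζ => H (ζ, v.2)) (v.2 a) v.1, ?_, ?_⟩
    · intro z x hz hx
      exact AnalyticAt.fun_comp (f := fun v : ℂ × (Fin p → ℂ) => (v.1, v.2 a, v.2)) (x := (z, x))
        (dslope_analytic H z (x a) x (hH z x hz hx) (hH _ x (hx a) hx))
        (by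
          refine analyticAt_fst.prod (AnalyticAt.prod ?_ analyticAt_snd)
          exact ((ContinuousLinearMap.proj (R := ℂ) (φ := fun _ : Fin p => ℂ) a).analyticAt _).fun_comp
            analyticAt_snd)
    · intro z x hx hzS
      have hza : z ≠ x a := hzS a (by simp)
      have hz' : ∀ i ∈ S, z ≠ x i := fun i hi => hzS i (by simp [hi])
      have haS : ∀ i ∈ S, x a ≠ x i := fun i hi e => ha (hx e ▸ hi)
      have n1 : z - x a ≠ 0 := sub_ne_zero.2 hza
      simp only
      rw [dslope_of_ne _ hza, slope_def_field, hf z x hx hz', hf (x a) x hx haS,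
        Finset.prod_insert ha, Finset.sum_insert ha, Finset.erase_insert ha]
      have e : ∑ i ∈ S, h (x i, x) / ((x i - z) * ∏ j ∈ (insert a S).erase i, (x i - x j)) =
          (∑ i ∈ S, h (x i, x) / ((x i - z) * ∏ j ∈ S.erase i, (x i - x j)) -
           ∑ i ∈ S, h (x i, x) / ((x i - x a) * ∏ j ∈ S.erase i, (x i - x j))) / (z - x a) := by
        rw [← Finset.sum_sub_distrib, Finset.sum_div]
        refine Finset.sum_congr rfl fun i hi => ?_
        have hai : a ≠ i := fun e => ha (e ▸ hi)
        rw [Finset.erase_insert_of_ne hai, Finset.prod_insert (by simp [ha])]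
        have n2 : x i - z ≠ 0 := sub_ne_zero.2 (hz' i hi).symm
        have n3 : x i - x a ≠ 0 := sub_ne_zero.2 (haS i hi).symm
        have n4 : ∏ j ∈ S.erase i, (x i - x j) ≠ 0 := Finset.prod_ne_zero_iff.2 fun j hj =>
          sub_ne_zero.2 fun e => (Finset.mem_erase.1 hj).1 (hx e).symm
        field_simp
        ring
      rw [e]
      have n5 : ∏ j ∈ S, (z - x j) ≠ 0 := Finset.prod_ne_zero_iff.2 fun j hj =>
          sub_ne_zero.2 (hz' j hj)
      have n6 : ∏ j ∈ S, (x a - x j) ≠ 0 := Finset.prod_ne_zero_iff.2 fun j hj =>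
          sub_ne_zero.2 (haS j hj)
      have n7 : x a - z ≠ 0 := sub_ne_zero.2 hza.symm
      have e2 : x a - z = -(z - x a) := by ring
      rw [e2]
      field_simp
      ring

/-- removable singularity lemma: let `U` be a nonempty open subset of the
open unit disc, `f` analytic and nowhere vanishing on `U`.  The sum of residues
`R(x) = Σ_i x_i^{p-1} / ((1 - x_i²) ∏_{j≠i} (1 - x_i x_j)(x_i - x_j) · f(x_i))`,
defined for `x ∈ U^p` with pairwise distinct coordinates, extends to an analytic
function `Ψ` on all of `U^p`. -/
theorem residue_sum_removable_singularities (p : ℕ) (hp : 1 ≤ p)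
    (U : Set ℂ) (hUne : U.Nonempty) (hUopen : IsOpen U)
    (hUsub : U ⊆ Metric.ball (0 : ℂ) 1)
    (f : ℂ → ℂ) (hf : AnalyticOnNhd ℂ f U) (hfne : ∀ z ∈ U, f z ≠ 0) :
    ∃ Ψ : (Fin p → ℂ) → ℂ,
      AnalyticOnNhd ℂ Ψ {x : Fin p → ℂ | ∀ i, x i ∈ U} ∧
      ∀ x : Fin p → ℂ, (∀ i, x i ∈ U) → Function.Injective x →
        Ψ x = ∑ i, x i ^ (p - 1) /
          ((1 - x i ^ 2) *
            (∏ j ∈ Finset.univ.erase i, ((1 - x i * x j) * (x i - x j))) *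
            f (x i)) := by
  have hlt : ∀ z ∈ U, ‖z‖ < 1 := fun z hz => by simpa using hUsub hz
  have hne : ∀ z ∈ U, ∀ w ∈ U, 1 - z * w ≠ 0 := by
    intro z hz w hw e
    have h1 : z * w = 1 := (sub_eq_zero.1 e).symm
    have h2 : ‖z‖ * ‖w‖ = 1 := by rw [← norm_mul, h1, norm_one]
    nlinarith [hlt z hz, hlt w hw, norm_nonneg z, norm_nonneg w]
  let h : ℂ × (Fin p → ℂ) → ℂ := fun v => v.1 ^ (p - 1) / ((∏ j, (1 - v.1 * v.2 j)) * f v.1)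
  have hproj : ∀ (j : Fin p) (x : Fin p → ℂ), AnalyticAt ℂ (fun x : Fin p → ℂ => x j) x := fun j x =>
    (ContinuousLinearMap.proj (R := ℂ) (φ := fun _ : Fin p => ℂ) j).analyticAt x
  have hh : ∀ z x, z ∈ U → (∀ i, x i ∈ U) → AnalyticAt ℂ h (z, x) := by
    intro z x hz hx
    refine (analyticAt_fst.pow _).div (AnalyticAt.mul ?_ ?_) ?_
    · refine Finset.analyticAt_fun_prod _ fun j _ => ?_
      exact analyticAt_const.sub (analyticAt_fst.mul (AnalyticAt.fun_comp (g := fun x : Fin p → ℂ => x j)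
        (f := fun v : ℂ × (Fin p → ℂ) => v.2) (x := (z, x)) (hproj j x) analyticAt_snd))
    · exact AnalyticAt.fun_comp (hf z hz) analyticAt_fst
    · exact mul_ne_zero (Finset.prod_ne_zero_iff.2 fun j _ => hne z hz _ (hx j)) (hfne z hz)
  let i0 : Fin p := ⟨0, hp⟩
  obtain ⟨H, hH, hform⟩ := divided U h hh (Finset.univ.erase i0)
  refine ⟨fun x => H (x i0, x), ?_, ?_⟩
  · intro x hx
    exact AnalyticAt.fun_comp (f := fun x : Fin p → ℂ => (x i0, x)) (hH (x i0) x (hx i0) hx)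
      ((hproj i0 x).prod analyticAt_id)
  · intro x hx hinj
    simp only
    rw [hform (x i0) x hinj fun i hi e => (Finset.mem_erase.1 hi).1 (hinj e).symm]
    have key : ∀ i, x i ^ (p - 1) / ((1 - x i ^ 2) *
            (∏ j ∈ Finset.univ.erase i, ((1 - x i * x j) * (x i - x j))) * f (x i)) =
        h (x i, x) / ∏ j ∈ Finset.univ.erase i, (x i - x j) := by
      intro i
      simp only [h]
      rw [← Finset.mul_prod_erase Finset.univ _ (Finset.mem_univ i), Finset.prod_mul_distrib,
        div_div]
      congr 1
      ring
    simp only [key]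
    rw [← Finset.add_sum_erase Finset.univ _ (Finset.mem_univ i0)]
    congr 1
    refine Finset.sum_congr rfl fun i hi => ?_
    have hi' : i0 ∈ Finset.univ.erase i :=
      Finset.mem_erase.2 ⟨(Finset.mem_erase.1 hi).1.symm, Finset.mem_univ _⟩
    rw [← Finset.mul_prod_erase _ _ hi', Finset.erase_right_comm]
end

section
/- Let n ≥ 2 and let a_1, …, a_n be pairwise distinct positive integers with gcd(a_1, …, a_n) = 1. Then there exists a function H, analytic on a neighborhood N of 1 in ℂ, such that H(x) = (1 − x)^{2n−2}·Φ_A(x) for all x ∈ N with |x| < 1, and moreover H(1) = Σ_{i=1}^n a_i^{2n−3} / ∏_{j ≠ i} (a_i² − a_j²) and H′(1) = 0. (Equivalently: the on-shell Hilbert series Φ_A has a pole of order at most 2n−2 at x = 1, its leading Laurent coefficient γ_0 equals Σ_{i=1}^n a_i^{2n−3}/∏_{j≠i}(a_i² − a_j²), and the next coefficient γ_1 vanishes.) -/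
open Filter Topology Finset

/-- analytic extension of `(1-x)/(1-c x^p)` -/
noncomputable def osK (p c x : ℂ) : ℂ :=
  if c = 1 then (dslope (fun y : ℂ => y ^ p) 1 x)⁻¹ else (1 - x) / (1 - c * x ^ p)

lemma osK_of_ne (p c : ℂ) {x : ℂ} (hx : x ≠ 1) : osK p c x = (1 - x) / (1 - c * x ^ p) := by
  unfold osK
  split_ifs with h
  · subst h
    rw [dslope_of_ne _ hx, slope_def_field, inv_div, Complex.one_cpow, one_mul,
      ← neg_sub 1 x, ← neg_sub 1 (x ^ p), neg_div_neg_eq]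
  · rfl

lemma os_cpow_analytic (p : ℂ) : AnalyticAt ℂ (fun y : ℂ => y ^ p) 1 :=
  AnalyticAt.cpow analyticAt_id analyticAt_const (by simp)

lemma os_dslope_one (p : ℂ) : dslope (fun y : ℂ => y ^ p) 1 1 = p := by
  rw [dslope_same]
  have h := (hasDerivAt_id (1 : ℂ)).cpow_const (c := p) (by simp)
  have h2 := h.deriv
  simpa using h2

lemma osK_one (p : ℂ) : osK p 1 1 = p⁻¹ := by
  unfold osK
  rw [if_pos rfl, os_dslope_one]

lemma osK_one_of_ne (p : ℂ) {c : ℂ} (hc : c ≠ 1) : osK p c 1 = 0 := by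
  simp [osK, hc]

lemma osK_analytic {p : ℂ} (hp : p ≠ 0) (c : ℂ) : AnalyticAt ℂ (osK p c) 1 := by
  by_cases h : c = 1
  · subst h
    have e : osK p 1 = fun x => (dslope (fun y : ℂ => y ^ p) 1 x)⁻¹ := by
      funext x; simp [osK]
    rw [e]
    refine AnalyticAt.fun_inv ?_ (by rw [os_dslope_one]; exact hp)
    obtain ⟨q, hq⟩ := os_cpow_analytic p
    exact ⟨_, hq.has_fpower_series_dslope_fslope⟩
  · have e : osK p c = fun x => (1 - x) / (1 - c * x ^ p) := by
      funext x; simp [osK, h]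
    rw [e]
    refine AnalyticAt.fun_div (analyticAt_const.sub analyticAt_id)
      (analyticAt_const.sub (analyticAt_const.mul (os_cpow_analytic p))) ?_
    simp only [Complex.one_cpow, mul_one]
    exact sub_ne_zero.mpr (Ne.symm h)

/-- symmetry under inversion -/
lemma osK_symm (q : ℂ) {c x : ℂ} (hc : c ≠ 0) (hx : x ≠ 1) (hs : x ∈ Complex.slitPlane) :
    osK (1 + q) c x⁻¹ * osK (1 - q) c⁻¹ x⁻¹ = osK (1 + q) c⁻¹ x * osK (1 - q) c x := by
  have hx0 : x ≠ 0 := Complex.slitPlane_ne_zero hs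
  have hxi : x⁻¹ ≠ 1 := by simpa using hx
  have harg : x.arg ≠ Real.pi := (Complex.mem_slitPlane_iff_arg.mp hs).1
  rw [osK_of_ne _ _ hx, osK_of_ne _ _ hx, osK_of_ne _ _ hxi, osK_of_ne _ _ hxi,
    Complex.inv_cpow _ _ harg, Complex.inv_cpow _ _ harg, Complex.cpow_add _ _ hx0,
    Complex.cpow_sub _ _ hx0, Complex.cpow_one]
  have hy : x ^ q ≠ 0 := by simp [Complex.cpow_eq_zero_iff, hx0]
  generalize x ^ q = y at *
  rw [div_mul_div_comm, div_mul_div_comm]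
  have e1 : (1 - x⁻¹) * (1 - x⁻¹) = (x⁻¹) ^ 2 * ((1 - x) * (1 - x)) := by
    field_simp
    ring
  have e2 : (1 - c * (x * y)⁻¹) * (1 - c⁻¹ * (x / y)⁻¹)
      = (x⁻¹) ^ 2 * ((1 - c⁻¹ * (x * y)) * (1 - c * (x / y))) := by
    field_simp
    ring
  rw [e1, e2, mul_div_mul_left _ _ (pow_ne_zero 2 (inv_ne_zero hx0))]

/-- the term attached to index `i` and root of unity `z` -/
noncomputable def osT {n : ℕ} (a : Fin n → ℕ) (i : Fin n) (z x : ℂ) : ℂ :=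
  (a i : ℂ)⁻¹ * ∏ j ∈ Finset.univ.erase i,
    (osK (1 + a j / a i) (z ^ a j) x * osK (1 - a j / a i) (z ^ a j)⁻¹ x)

noncomputable def osH {n : ℕ} (a : Fin n → ℕ) (x : ℂ) : ℂ :=
  ∑ i, ∑ z ∈ Polynomial.nthRootsFinset (a i) (1 : ℂ), osT a i z x

section
variable {n : ℕ} {a : Fin n → ℕ}

lemma os_p1 (hpos : ∀ i, 0 < a i) (i j : Fin n) : (1 + a j / a i : ℂ) ≠ 0 := by
  have h : (a i : ℂ) ≠ 0 := by exact_mod_cast (hpos i).ne'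
  intro h2
  field_simp at h2
  have h3 : a i + a j = 0 := by exact_mod_cast h2
  have := hpos i
  omega

lemma os_p2 (hpos : ∀ i, 0 < a i) (hdist : Function.Injective a) {i j : Fin n} (hij : j ≠ i) :
    (1 - a j / a i : ℂ) ≠ 0 := by
  have h : (a i : ℂ) ≠ 0 := by exact_mod_cast (hpos i).ne'
  intro h2
  rw [sub_eq_zero, eq_div_iff h, one_mul] at h2
  exact hij (hdist (by exact_mod_cast h2.symm))

lemma osH_analytic (hpos : ∀ i, 0 < a i) (hdist : Function.Injective a) :
    AnalyticAt ℂ (osH a) 1 := by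
  unfold osH
  refine Finset.analyticAt_fun_sum _ fun i _ => Finset.analyticAt_fun_sum _ fun z _ => ?_
  unfold osT
  refine analyticAt_const.mul (Finset.analyticAt_fun_prod _ fun j hj => ?_)
  exact (osK_analytic (os_p1 hpos i j) _).mul
    (osK_analytic (os_p2 hpos hdist (Finset.ne_of_mem_erase hj)) _)

lemma os_mem (hpos : ∀ i, 0 < a i) (i : Fin n) (z : ℂ) :
    z ∈ Polynomial.nthRootsFinset (a i) (1 : ℂ) ↔ z ^ a i = 1 :=
  Polynomial.mem_nthRootsFinset (hpos i) 1

lemma osT_symm (i : Fin n) {z x : ℂ} (hz : z ≠ 0) (hx : x ≠ 1)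
    (hs : x ∈ Complex.slitPlane) : osT a i z x⁻¹ = osT a i z⁻¹ x := by
  unfold osT
  congr 1
  refine Finset.prod_congr rfl fun j _ => ?_
  rw [osK_symm _ (pow_ne_zero _ hz) hx hs, inv_pow, inv_inv]

lemma osH_symm (hpos : ∀ i, 0 < a i) {x : ℂ} (hs : x ∈ Complex.slitPlane) :
    osH a x⁻¹ = osH a x := by
  by_cases hx : x = 1
  · simp [hx]
  unfold osH
  refine Finset.sum_congr rfl fun i _ => ?_
  refine Finset.sum_bij' (fun z _ => z⁻¹) (fun z _ => z⁻¹) ?_ ?_ ?_ ?_ ?_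
  · intro z hz
    rw [os_mem hpos] at *
    rw [inv_pow, hz, inv_one]
  · intro z hz
    rw [os_mem hpos] at *
    rw [inv_pow, hz, inv_one]
  · intro z _; simp
  · intro z _; simp
  · intro z hz
    rw [os_mem hpos] at hz
    refine osT_symm i ?_ hx hs
    rintro rfl
    rw [zero_pow (hpos i).ne'] at hz
    exact zero_ne_one hz

lemma osH_deriv (hpos : ∀ i, 0 < a i) (hdist : Function.Injective a) :
    deriv (osH a) 1 = 0 := by
  have hd : HasDerivAt (osH a) (deriv (osH a) 1) 1 :=
    (osH_analytic hpos hdist).differentiableAt.hasDerivAt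
  have hi : HasDerivAt (fun x : ℂ => x⁻¹) (-1) 1 := by
    simpa using hasDerivAt_inv (one_ne_zero : (1 : ℂ) ≠ 0)
  have hd' : HasDerivAt (osH a) (deriv (osH a) 1) ((1 : ℂ)⁻¹) := by simpa using hd
  have hc := HasDerivAt.comp (1 : ℂ) hd' hi
  have he : (osH a ∘ fun x : ℂ => x⁻¹) =ᶠ[𝓝 1] osH a := by
    filter_upwards [Complex.isOpen_slitPlane.mem_nhds Complex.one_mem_slitPlane] with x hx
    exact osH_symm hpos hx
  have hu := (hc.congr_of_eventuallyEq he.symm).unique hd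
  have h2 : (2 : ℂ) * deriv (osH a) 1 = 0 := by linear_combination -hu
  simpa using h2

lemma os_exists_ne (hgcd : Finset.univ.gcd a = 1) (i : Fin n) {z : ℂ} (hz : z ^ a i = 1)
    (hz1 : z ≠ 1) : ∃ j ∈ Finset.univ.erase i, z ^ a j ≠ 1 := by
  by_contra! h
  apply hz1
  have : orderOf z ∣ Finset.univ.gcd a := by
    refine Finset.dvd_gcd fun j _ => orderOf_dvd_of_pow_eq_one ?_
    by_cases hj : j = i
    · rw [hj, hz]
    · exact h j (Finset.mem_erase.mpr ⟨hj, Finset.mem_univ _⟩)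
  rw [hgcd, Nat.dvd_one] at this
  exact orderOf_eq_one_iff.mp this

lemma osT_one_of_ne (hgcd : Finset.univ.gcd a = 1) (i : Fin n) {z : ℂ} (hz : z ^ a i = 1)
    (hz1 : z ≠ 1) : osT a i z 1 = 0 := by
  obtain ⟨j, hj, hne⟩ := os_exists_ne hgcd i hz hz1
  unfold osT
  rw [Finset.prod_eq_zero hj, mul_zero]
  rw [osK_one_of_ne _ hne, zero_mul]

lemma osT_one_one (hn : 2 ≤ n) (hpos : ∀ i, 0 < a i) (i : Fin n) :
    osT a i 1 1 = (a i : ℂ) ^ (2 * n - 3) /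
        ∏ j ∈ Finset.univ.erase i, ((a i : ℂ) ^ 2 - (a j : ℂ) ^ 2) := by
  have h : (a i : ℂ) ≠ 0 := by exact_mod_cast (hpos i).ne'
  unfold osT
  have e : ∀ j ∈ Finset.univ.erase i,
      (osK (1 + a j / a i) ((1 : ℂ) ^ a j) 1 * osK (1 - a j / a i) ((1 : ℂ) ^ a j)⁻¹ 1)
      = (a i : ℂ) ^ 2 / ((a i : ℂ) ^ 2 - (a j : ℂ) ^ 2) := by
    intro j _
    rw [one_pow, inv_one, osK_one, osK_one, ← mul_inv]
    have : (1 + a j / a i : ℂ) * (1 - a j / a i)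
        = ((a i : ℂ) ^ 2 - (a j : ℂ) ^ 2) / (a i : ℂ) ^ 2 := by
      field_simp
      try ring
    rw [this, inv_div]
  rw [Finset.prod_congr rfl e, Finset.prod_div_distrib, Finset.prod_const,
    Finset.card_erase_of_mem (Finset.mem_univ _), Finset.card_univ, Fintype.card_fin,
    ← mul_div_assoc, ← pow_mul]
  congr 1
  have : 2 * (n - 1) = (2 * n - 3) + 1 := by omega
  rw [this, pow_succ]
  field_simp

lemma osH_one (hn : 2 ≤ n) (hpos : ∀ i, 0 < a i) (hgcd : Finset.univ.gcd a = 1) :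
    osH a 1 = ∑ i, (a i : ℂ) ^ (2 * n - 3) /
        ∏ j ∈ Finset.univ.erase i, ((a i : ℂ) ^ 2 - (a j : ℂ) ^ 2) := by
  unfold osH
  refine Finset.sum_congr rfl fun i _ => ?_
  rw [Finset.sum_eq_single (1 : ℂ), osT_one_one hn hpos]
  · intro z hz hz1
    exact osT_one_of_ne hgcd i ((os_mem hpos i z).mp hz) hz1
  · intro h
    exact absurd ((os_mem hpos i 1).mpr (one_pow _)) h

lemma os_finsum (hpos : ∀ i, 0 < a i) (i : Fin n) {x : ℂ} (hx0 : x ≠ 0) (f : ℂ → ℂ) :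
    (∑ᶠ (w : ℂ) (_ : w ^ a i = x), f w)
      = ∑ z ∈ Polynomial.nthRootsFinset (a i) (1 : ℂ), f (z * x ^ (1 / a i : ℂ)) := by
  classical
  have hr : (x ^ (1 / a i : ℂ)) ^ a i = x := by
    rw [one_div]; exact Complex.cpow_nat_inv_pow x (hpos i).ne'
  have hr0 : x ^ (1 / a i : ℂ) ≠ 0 := by simp [Complex.cpow_eq_zero_iff, hx0]
  generalize x ^ (1 / a i : ℂ) = r at *
  rw [← Finset.sum_image (f := f) (g := fun z => z * r)
    (fun u _ v _ h => mul_right_cancel₀ hr0 h), ← finsum_mem_coe_finset]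
  refine finsum_congr fun w => ?_
  have : (w ^ a i = x) ↔ w ∈ ((Polynomial.nthRootsFinset (a i) (1 : ℂ)).image
      (fun z => z * r) : Set ℂ) := by
    simp only [Finset.mem_coe, Finset.mem_image, os_mem hpos]
    constructor
    · intro h
      refine ⟨w / r, ?_, div_mul_cancel₀ _ hr0⟩
      rw [div_pow, h, hr, div_self hx0]
    · rintro ⟨z, hz, rfl⟩
      rw [mul_pow, hz, hr, one_mul]
  simp only [this]

lemma osT_eq (i : Fin n) {z x : ℂ} (hx0 : x ≠ 0) (hx1 : x ≠ 1) :
    osT a i z x = (1 - x) ^ (2 * n - 2) * (1 / ((a i : ℂ) *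
      ∏ j ∈ Finset.univ.erase i,
        ((1 - x * (z * x ^ (1 / a i : ℂ)) ^ a j) *
          (1 - x * ((z * x ^ (1 / a i : ℂ)) ^ a j)⁻¹)))) := by
  unfold osT
  have e : ∀ j ∈ Finset.univ.erase i,
      (osK (1 + a j / a i) (z ^ a j) x * osK (1 - a j / a i) (z ^ a j)⁻¹ x)
      = (1 - x) ^ 2 / ((1 - x * (z * x ^ (1 / a i : ℂ)) ^ a j) *
          (1 - x * ((z * x ^ (1 / a i : ℂ)) ^ a j)⁻¹)) := by
    intro j _
    have hq : (x ^ (1 / a i : ℂ)) ^ a j = x ^ (a j / a i : ℂ) := by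
      rw [← Complex.cpow_nat_mul, mul_one_div]
    rw [osK_of_ne _ _ hx1, osK_of_ne _ _ hx1, Complex.cpow_add _ _ hx0,
      Complex.cpow_sub _ _ hx0, Complex.cpow_one, mul_pow, hq, div_mul_div_comm, mul_inv, sq]
    congr 2 <;> ring
  rw [Finset.prod_congr rfl e, Finset.prod_div_distrib, Finset.prod_const,
    Finset.card_erase_of_mem (Finset.mem_univ _), Finset.card_univ, Fintype.card_fin,
    ← pow_mul, Nat.mul_sub, mul_one]
  generalize (∏ j ∈ Finset.univ.erase i, _ : ℂ) = P
  rw [one_div, mul_inv, div_eq_mul_inv]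
  ring

lemma osH_eq (hpos : ∀ i, 0 < a i) {x : ℂ} (hx0 : x ≠ 0) (hx1 : x ≠ 1) :
    osH a x = (1 - x) ^ (2 * n - 2) *
          ∑ i, ∑ᶠ (w : ℂ) (_ : w ^ a i = x),
            1 / ((a i : ℂ) *
              ∏ j ∈ Finset.univ.erase i,
                ((1 - x * w ^ a j) * (1 - x * (w ^ a j)⁻¹))) := by
  unfold osH
  rw [Finset.mul_sum]
  refine Finset.sum_congr rfl fun i _ => ?_
  rw [os_finsum hpos i hx0, Finset.mul_sum]
  exact Finset.sum_congr rfl fun z _ => osT_eq i hx0 hx1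

end

/-- for pairwise distinct positive weights with gcd 1, the on-shell Hilbert
series `Φ_A` admits an analytic extension `H` of `(1-x)^{2n-2} Φ_A(x)` near `x = 1` with
`H(1) = Σ_i a_i^{2n-3}/∏_{j≠i}(a_i² - a_j²)` (the leading Laurent coefficient `γ₀`) and
`H′(1) = 0` (i.e. `γ₁ = 0`). -/
theorem on_shell_hilbert_series_leading_laurent_coefficients (n : ℕ) (hn : 2 ≤ n)
    (a : Fin n → ℕ) (hpos : ∀ i, 0 < a i) (hdist : Function.Injective a)
    (hgcd : Finset.univ.gcd a = 1) :
    ∃ (H : ℂ → ℂ) (N : Set ℂ), N ∈ 𝓝 (1 : ℂ) ∧ AnalyticOnNhd ℂ H N ∧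
      (∀ x ∈ N, ‖x‖ < 1 →
        H x = (1 - x) ^ (2 * n - 2) *
          ∑ i, ∑ᶠ (w : ℂ) (_ : w ^ a i = x),
            1 / ((a i : ℂ) *
              ∏ j ∈ Finset.univ.erase i,
                ((1 - x * w ^ a j) * (1 - x * (w ^ a j)⁻¹)))) ∧
      H 1 = (∑ i, (a i : ℂ) ^ (2 * n - 3) /
        ∏ j ∈ Finset.univ.erase i, ((a i : ℂ) ^ 2 - (a j : ℂ) ^ 2)) ∧
      deriv H 1 = 0 := by
  refine ⟨osH a, {x | AnalyticAt ℂ (osH a) x} ∩ {x | x ≠ 0}, ?_, ?_, ?_,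
    osH_one hn hpos hgcd, osH_deriv hpos hdist⟩
  · exact Filter.inter_mem (osH_analytic hpos hdist).eventually_analyticAt
      (isOpen_ne.mem_nhds one_ne_zero)
  · exact fun x hx => hx.1
  · intro x hx hlt
    refine osH_eq hpos hx.2 ?_
    rintro rfl
    simp at hlt
end

section
/- Let n ≥ 2 and let a_1, …, a_n be pairwise distinct positive integers with gcd(a_1, …, a_n) = 1, and for each j set g_j = gcd{a_k : k ≠ j}. Let H be a function analytic on a neighborhood N of 1 in ℂ with H(x) = (1 − x)^{2n−2}·Φ_A(x) for all x ∈ N with |x| < 1. Then H″(1)/2 = −H‴(1)/6 = −(1/12) Σ_{i=1}^n ( a_i^{2n−5} / ∏_{j ≠ i} (a_i² − a_j²) ) · ( Σ_{j ≠ i} a_j² ) + (1/12) Σ_{j=1}^n Σ_{i ≠ j} a_i^{2n−5} (g_j² − 1) / ∏_{k ≠ i, j} (a_i² − a_k²). (Equivalently: the Laurent coefficients γ_2 and γ_3 of Φ_A at x = 1 are equal and are given by this expression; here a_i^{2n−5} is the integer power of a_i as a rational number, equal to 1/a_i when n = 2.) -/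
open Filter Topology Finset Asymptotics
open Polynomial (nthRootsFinset)

noncomputable def ffac (z b t : ℂ) : ℂ :=
  (Complex.exp t + Complex.exp (-t) - 2) /
    (Complex.exp t + Complex.exp (-t) - z * Complex.exp (-(b * t)) - z⁻¹ * Complex.exp (b * t))

lemma exp_exp6 (c : ℂ) : (fun t : ℂ => Complex.exp (c * t) - (1 + c * t + c^2 * t^2/2 + c^3*t^3/6
    + c^4*t^4/24 + c^5*t^5/120)) =O[𝓝 0] (fun t => t^6) := by
  have h := Complex.exp_sub_sum_range_isBigO_pow 6
  have ht : Tendsto (fun t : ℂ => c * t) (𝓝 0) (𝓝 0) := by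
    have : Continuous (fun t : ℂ => c * t) := by fun_prop
    simpa using this.tendsto 0
  have h2 := h.comp_tendsto ht
  have h3 : ((fun x : ℂ => x^6) ∘ fun t => c * t) =O[𝓝 0] (fun t : ℂ => t^6) := by
    have : ((fun x : ℂ => x^6) ∘ fun t => c * t) = fun t => c^6 * t^6 := by
      funext t; simp; ring
    rw [this]
    exact isBigO_const_mul_self _ _ _
  refine (h2.trans h3).congr_left ?_
  intro t
  simp [Finset.sum_range_succ, Nat.factorial]
  ring

lemma pow_bigO {m k : ℕ} (h : k ≤ m) : (fun t : ℂ => t^m) =O[𝓝 0] (fun t : ℂ => t^k) := by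
  obtain ⟨r, rfl⟩ := Nat.exists_eq_add_of_le h
  have : (fun t : ℂ => t^r) =O[𝓝 0] (fun _ => (1:ℂ)) := by
    have : Continuous (fun t : ℂ => t^r) := by fun_prop
    exact (this.tendsto 0).isBigO_one ℂ
  have := (isBigO_refl (fun t : ℂ => t^k) (𝓝 0)).mul this
  simpa [pow_add] using this

lemma cont_bigO {f : ℂ → ℂ} (hf : Continuous f) (l : Filter ℂ) (hl : l ≤ 𝓝 0) :
    f =O[l] (fun _ => (1:ℂ)) := 
  ((hf.tendsto 0).isBigO_one ℂ).mono hl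

/-- division lemma -/
lemma div_bigO {N D q : ℂ → ℂ} {k m : ℕ} {d : ℂ} (hd : d ≠ 0)
    (hD : Tendsto (fun t => D t / t^k) (𝓝[≠] 0) (𝓝 d))
    (h : (fun t => N t - D t * q t) =O[𝓝[≠] 0] (fun t => t^(m+k))) :
    (fun t => N t / D t - q t) =O[𝓝[≠] 0] (fun t => t^m) := by
  have h1 : (fun t => (D t / t^k)⁻¹) =O[𝓝[≠] 0] (fun _ => (1:ℂ)) :=
    (hD.inv₀ hd).isBigO_one ℂ
  have h2 := h.mul h1
  have h3 : (fun t : ℂ => ((t^k)⁻¹)) =O[𝓝[≠] 0] (fun t : ℂ => ((t^k)⁻¹)) := isBigO_refl _ _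
  have h4 := h2.mul h3
  refine (h4.congr' ?_ ?_)
  · filter_upwards [hD.eventually_ne hd, self_mem_nhdsWithin] with t h5 h6
    have h6 : t ≠ 0 := h6
    have h7 : D t ≠ 0 := by
      intro h; simp [h] at h5
    field_simp
  · filter_upwards [self_mem_nhdsWithin] with t h6
    have h6 : t ≠ 0 := h6
    field_simp
    ring

lemma tendsto_of_bigO {D : ℂ → ℂ} {k : ℕ} {d : ℂ}
    (h : (fun t => D t - d * t^k) =O[𝓝[≠] 0] (fun t => t^(k+1))) :
    Tendsto (fun t => D t / t^k) (𝓝[≠] 0) (𝓝 d) := by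
  have h3 : (fun t : ℂ => ((t^k)⁻¹)) =O[𝓝[≠] 0] (fun t : ℂ => ((t^k)⁻¹)) := isBigO_refl _ _
  have h4 := h.mul h3
  have h5 : (fun t => D t / t^k - d) =O[𝓝[≠] 0] (fun t : ℂ => t) := by
    refine h4.congr' ?_ ?_
    · filter_upwards [self_mem_nhdsWithin] with t h6
      have h6 : t ≠ 0 := h6
      field_simp
    · filter_upwards [self_mem_nhdsWithin] with t h6
      have h6 : t ≠ 0 := h6
      field_simp
      ring
  have h6 : Tendsto (fun t : ℂ => t) (𝓝[≠] 0) (𝓝 0) := tendsto_id.mono_left nhdsWithin_le_nhds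
  have := h5.trans_tendsto h6
  simpa using this.add_const d

lemma num_exp : (fun t : ℂ => (Complex.exp t + Complex.exp (-t) - 2) - (t^2 + t^4/12)) =O[𝓝[≠] 0]
    (fun t => t^6) := by
  have h := ((exp_exp6 1).add (exp_exp6 (-1))).mono (nhdsWithin_le_nhds (s := {0}ᶜ))
  refine h.congr_left ?_
  intro t
  simp only [one_mul, neg_mul]
  ring

lemma den_exp (z b : ℂ) : (fun t : ℂ => (Complex.exp t + Complex.exp (-t)
      - z * Complex.exp (-(b * t)) - z⁻¹ * Complex.exp (b * t)) -
      ((2 - z - z⁻¹) + b * (z - z⁻¹) * t + (1 - (z + z⁻¹)/2 * b^2) * t^2 + (z - z⁻¹)/6 * b^3 * t^3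
       + (1 - (z + z⁻¹)/2 * b^4)/12 * t^4 + (z - z⁻¹)/120 * b^5 * t^5)) =O[𝓝[≠] 0]
    (fun t => t^6) := by
  have h := ((((exp_exp6 1).add (exp_exp6 (-1))).sub ((exp_exp6 (-b)).const_mul_left z)).sub
    ((exp_exp6 b).const_mul_left z⁻¹)).mono (nhdsWithin_le_nhds (s := {0}ᶜ))
  refine h.congr_left ?_
  intro t
  simp only [one_mul, neg_mul]
  ring

lemma mul_cont {f g : ℂ → ℂ} {m : ℕ} (hf : f =O[𝓝[≠] 0] (fun t => t^m)) (hg : Continuous g) :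
    (fun t => f t * g t) =O[𝓝[≠] 0] (fun t => t^m) := by
  simpa using hf.mul (cont_bigO hg _ nhdsWithin_le_nhds)

lemma pow_cont {g : ℂ → ℂ} (m : ℕ) (hg : Continuous g) :
    (fun t => t^m * g t) =O[𝓝[≠] 0] (fun t => t^m) :=
  mul_cont (isBigO_refl _ _) hg

lemma pow_bigO' {m k : ℕ} (h : k ≤ m) : (fun t : ℂ => t^m) =O[𝓝[≠] 0] (fun t : ℂ => t^k) :=
  (pow_bigO h).mono nhdsWithin_le_nhds

lemma ffac_good (b : ℂ) (hb : 1 - b^2 ≠ 0) :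
    (fun t => ffac 1 b t - (1 - b^2)⁻¹ * (1 - b^2/12 * t^2)) =O[𝓝[≠] 0] (fun t => t^4) := by
  have hD := den_exp 1 b
  unfold ffac
  apply div_bigO (k := 2) (d := 1 - b^2) hb
  · apply tendsto_of_bigO
    have h2 := (hD.trans (pow_bigO' (show 3 ≤ 6 by norm_num))).add
      (pow_cont (g := fun t => (1 - b^4)/12 * t) 3 (by fun_prop))
    refine h2.congr_left ?_
    intro t
    simp only [inv_one]
    ring
  · have h2 := (num_exp.sub (mul_cont hD (g := fun t => (1 - b^2)⁻¹ * (1 - b^2/12 * t^2)) (by fun_prop))).add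
      (pow_cont (g := fun t => (1 + b^2)*b^2/144) 6 (by fun_prop))
    refine h2.congr_left ?_
    intro t
    simp only [inv_one]
    field_simp
    ring

lemma ffac_bad (z b : ℂ) (hz : 2 - z - z⁻¹ ≠ 0) :
    (fun t => ffac z b t - (t^2 * (2 - z - z⁻¹)⁻¹ - b * (z - z⁻¹) / (2 - z - z⁻¹)^2 * t^3))
     =O[𝓝[≠] 0] (fun t => t^4) := by
  have hD := den_exp z b
  generalize hv : z⁻¹ = v at *
  unfold ffac
  simp only [hv]
  apply div_bigO (k := 0) (d := 2 - z - v) hz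
  · apply tendsto_of_bigO
    have h2 := (hD.trans (pow_bigO' (show 1 ≤ 6 by norm_num))).add
      (pow_cont (g := fun t => b * (z - v) + (1 - (z + v)/2 * b^2) * t + (z - v)/6 * b^3 * t^2
       + (1 - (z + v)/2 * b^4)/12 * t^3 + (z - v)/120 * b^5 * t^4) 1 (by fun_prop))
    refine h2.congr_left ?_
    intro t
    ring
  · have h2 := ((num_exp.sub (mul_cont hD (g := fun t => (t^2 * (2 - z - v)⁻¹ - b * (z - v) / (2 - z - v)^2 * t^3)) (by fun_prop))).trans
       (pow_bigO' (show 4 ≤ 6 by norm_num))).add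
      (pow_cont (g := fun t => 1/12 + b^2 * (z - v)^2 / (2 - z - v)^2 - ((1 - (z + v)/2 * b^2) + (z - v)/6 * b^3 * t
       + (1 - (z + v)/2 * b^4)/12 * t^2 + (z - v)/120 * b^5 * t^3) * ((2 - z - v)⁻¹ - b * (z - v) / (2 - z - v)^2 * t)) 4 (by fun_prop))
    refine h2.congr_left ?_
    intro t
    field_simp
    ring

lemma one_bigO_of {f : ℂ → ℂ} {g : ℂ → ℂ} {m : ℕ} (hg : Continuous g)
    (h : (fun t => f t - g t) =O[𝓝[≠] 0] (fun t => t^m)) : f =O[𝓝[≠] 0] (fun _ => (1:ℂ)) := by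
  have h1 := h.trans (pow_bigO' (Nat.zero_le m))
  simp only [pow_zero] at h1
  have h2 := h1.add (cont_bigO hg _ nhdsWithin_le_nhds)
  simpa using h2

lemma prod_good {ι : Type*} [DecidableEq ι] (s : Finset ι) (b : ι → ℂ)
    (hb : ∀ j ∈ s, 1 - b j ^ 2 ≠ 0) :
    (fun t => ∏ j ∈ s, ffac 1 (b j) t -
      (∏ j ∈ s, (1 - b j ^2)⁻¹) * (1 - (∑ j ∈ s, b j ^ 2)/12 * t^2)) =O[𝓝[≠] 0] (fun t => t^4) := by
  induction s using Finset.induction_on with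
  | empty => simp [isBigO_zero]
  | insert k s hk ih =>
    have ih := ih (fun j hj => hb j (mem_insert_of_mem hj))
    have h1 := ffac_good (b k) (hb k (mem_insert_self _ _))
    have hbd := one_bigO_of (by fun_prop) h1
    have h2 := (hbd.mul ih).congr_right (g₂ := fun t => t^4) (by simp)
    have h3 := mul_cont h1 (g := fun t => (∏ j ∈ s, (1 - b j ^2)⁻¹) * (1 - (∑ j ∈ s, b j ^ 2)/12 * t^2))
      (by fun_prop)
    have h4 := pow_cont (g := fun _ => (1 - b k ^ 2)⁻¹ * (∏ j ∈ s, (1 - b j ^2)⁻¹) *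
      (b k ^ 2/12 * ((∑ j ∈ s, b j ^ 2)/12))) 4 (by fun_prop)
    refine ((h2.add h3).add h4).congr_left ?_
    intro t
    rw [prod_insert hk, prod_insert hk, sum_insert hk]
    ring

lemma prod_bad {ι : Type*} [DecidableEq ι] (s : Finset ι) (b : ι → ℂ)
    (hb : ∀ j ∈ s, 1 - b j ^ 2 ≠ 0) (z c : ℂ) (hz : 2 - z - z⁻¹ ≠ 0) :
    (fun t => ffac z c t * ∏ j ∈ s, ffac 1 (b j) t -
      (∏ j ∈ s, (1 - b j ^2)⁻¹) * (t^2 * (2 - z - z⁻¹)⁻¹ - c * (z - z⁻¹) / (2 - z - z⁻¹)^2 * t^3))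
      =O[𝓝[≠] 0] (fun t => t^4) := by
  have h1 := ffac_bad z c hz
  have h2 := prod_good s b hb
  have hbd := one_bigO_of (by fun_prop) h2
  have h3 := (h1.mul hbd).congr_right (g₂ := fun t => t^4) (by simp)
  have h4 := mul_cont h2 (g := fun t => (t^2 * (2 - z - z⁻¹)⁻¹ - c * (z - z⁻¹) / (2 - z - z⁻¹)^2 * t^3))
    (by fun_prop)
  have h5 := pow_cont (g := fun t => (∏ j ∈ s, (1 - b j ^2)⁻¹) * (- (∑ j ∈ s, b j ^ 2)/12) *
    ((2 - z - z⁻¹)⁻¹ - c * (z - z⁻¹) / (2 - z - z⁻¹)^2 * t)) 4 (by fun_prop)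
  refine ((h3.add h4).add h5).congr_left ?_
  intro t
  ring

lemma ffac_bad2 (z b : ℂ) (hz : 2 - z - z⁻¹ ≠ 0) :
    (fun t => ffac z b t) =O[𝓝[≠] 0] (fun t => t^2) := by
  have h1 := (ffac_bad z b hz).trans (pow_bigO' (show 2 ≤ 4 by norm_num))
  have h2 := pow_cont (g := fun t => (2 - z - z⁻¹)⁻¹ - b * (z - z⁻¹) / (2 - z - z⁻¹)^2 * t) 2
    (by fun_prop)
  refine (h1.add h2).congr_left ?_
  intro t
  ring

lemma two_sub_ne {z : ℂ} (hz0 : z ≠ 0) (hz : z ≠ 1) : 2 - z - z⁻¹ ≠ 0 := by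
  intro h
  have : (z - 1)^2 = 0 := by
    field_simp at h
    linear_combination -h
  exact hz (sub_eq_zero.mp (pow_eq_zero_iff (two_ne_zero) |>.mp this))

lemma ffac_bdd (z b : ℂ) (hz0 : z ≠ 0) (hb : 1 - b^2 ≠ 0) :
    (fun t => ffac z b t) =O[𝓝[≠] 0] (fun _ => (1:ℂ)) := by
  by_cases hz : z = 1
  · subst hz
    exact one_bigO_of (by fun_prop) (ffac_good b hb)
  · exact one_bigO_of (by fun_prop) (ffac_bad z b (two_sub_ne hz0 hz))

lemma prod_bad2 {ι : Type*} [DecidableEq ι] (s : Finset ι) (b z : ι → ℂ)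
    (hb : ∀ j ∈ s, 1 - b j ^ 2 ≠ 0) (hz0 : ∀ j, z j ≠ 0) (i j : ι) (hi : i ∈ s) (hj : j ∈ s)
    (hij : i ≠ j) (hzi : z i ≠ 1) (hzj : z j ≠ 1) :
    (fun t => ∏ j ∈ s, ffac (z j) (b j) t) =O[𝓝[≠] 0] (fun t => t^4) := by
  have h3 : (fun t => ∏ k ∈ (s.erase i).erase j, ffac (z k) (b k) t) =O[𝓝[≠] 0]
      (fun _ => (1:ℂ)) := by
    have := IsBigO.finsetProd (s := (s.erase i).erase j) (l := 𝓝[≠] (0:ℂ))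
      (f := fun k t => ffac (z k) (b k) t) (g := fun _ _ => (1:ℂ))
      (fun k hk => ffac_bdd _ _ (hz0 k) (hb k (mem_of_mem_erase (mem_of_mem_erase hk))))
    simpa using this
  have h := ((ffac_bad2 (z i) (b i) (two_sub_ne (hz0 i) hzi)).mul
    (ffac_bad2 (z j) (b j) (two_sub_ne (hz0 j) hzj))).mul h3
  refine h.congr ?_ ?_
  · intro t
    rw [mul_assoc, mul_prod_erase (s.erase i) (fun k => ffac (z k) (b k) t)
      (mem_erase.mpr ⟨hij.symm, hj⟩), mul_prod_erase s (fun k => ffac (z k) (b k) t) hi]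
  · intro t; ring

lemma peel {l : Filter ℂ} [NeBot l] (hl : l ≤ 𝓝[≠] 0) {c : ℂ} {g : ℂ → ℂ} (hg : Continuous g) {k : ℕ}
    (h : (fun t => c + t * g t) =O[l] (fun t => t^(k+1))) : c = 0 ∧ g =O[l] (fun t => t^k) := by
  have hl' : l ≤ 𝓝 0 := hl.trans nhdsWithin_le_nhds
  have h1 : Tendsto (fun t => c + t * g t) l (𝓝 c) := by
    have : Continuous (fun t => c + t * g t) := by fun_prop
    simpa using (this.tendsto 0).mono_left hl'
  have h2 : Tendsto (fun t : ℂ => t^(k+1)) l (𝓝 0) := by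
    have : Continuous (fun t : ℂ => t^(k+1)) := by fun_prop
    simpa using (this.tendsto 0).mono_left hl'
  have hc : c = 0 := tendsto_nhds_unique h1 (h.trans_tendsto h2)
  refine ⟨hc, ?_⟩
  subst hc
  have h3 := h.mul (isBigO_refl (fun t : ℂ => t⁻¹) l)
  have hne : ∀ᶠ t in l, t ≠ 0 := hl self_mem_nhdsWithin
  refine h3.congr' ?_ ?_
  · filter_upwards [hne] with t ht
    field_simp; ring
  · filter_upwards [hne] with t ht
    field_simp; ring

lemma peel4 {l : Filter ℂ} [NeBot l] (hl : l ≤ 𝓝[≠] 0) {c0 c1 c2 c3 : ℂ}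
    (h : (fun t => c0 + c1 * t + c2 * t^2 + c3 * t^3) =O[l] (fun t => t^4)) :
    c0 = 0 ∧ c1 = 0 ∧ c2 = 0 ∧ c3 = 0 := by
  obtain ⟨h0, h⟩ := peel hl (c := c0) (g := fun t => c1 + t * (c2 + t * (c3 + t * 0))) (by fun_prop) (k := 3)
    (h.congr_left (fun t => by ring))
  obtain ⟨h1, h⟩ := peel hl (by fun_prop) (k := 2) h
  obtain ⟨h2, h⟩ := peel hl (by fun_prop) (k := 1) h
  obtain ⟨h3, h⟩ := peel hl (by fun_prop) (k := 0) h
  exact ⟨h0, h1, h2, h3⟩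

lemma H_expand {H : ℂ → ℂ} (hH : AnalyticAt ℂ H 1) :
    (fun t : ℂ => H (Complex.exp (-t)) - (H 1 + (-(iteratedDeriv 1 H 1)) * t
      + (iteratedDeriv 1 H 1 / 2 + iteratedDeriv 2 H 1 / 2) * t^2
      + (- iteratedDeriv 1 H 1 / 6 - iteratedDeriv 2 H 1 / 2 - iteratedDeriv 3 H 1 / 6) * t^3))
      =O[𝓝[≠] 0] (fun t => t^4) := by
  have h := hH.hasFPowerSeriesAt.isBigO_sub_partialSum_pow 4
  have hy : Tendsto (fun t : ℂ => Complex.exp (-t) - 1) (𝓝[≠] 0) (𝓝 0) := by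
    have : Continuous (fun t : ℂ => Complex.exp (-t) - 1) := by fun_prop
    simpa using (this.tendsto 0).mono_left (nhdsWithin_le_nhds (s := {0}ᶜ))
  have h1 := h.comp_tendsto hy
  have hE : (fun t : ℂ => Complex.exp (-t) - (1 - t + t^2/2 - t^3/6)) =O[𝓝[≠] 0] (fun t => t^4) := by
    have h2 := (((exp_exp6 (-1)).mono (nhdsWithin_le_nhds (s := {0}ᶜ))).trans
      (pow_bigO' (show 4 ≤ 6 by norm_num))).add
      (pow_cont (g := fun t => 1/24 - t/120) 4 (by fun_prop))
    refine h2.congr_left ?_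
    intro t
    simp only [neg_mul, one_mul]
    ring
  have hy1 : (fun t : ℂ => Complex.exp (-t) - 1) =O[𝓝[≠] 0] (fun t => t) := by
    have h2 := (hE.trans (pow_bigO' (show 1 ≤ 4 by norm_num))).add
      (pow_cont (g := fun t => -1 + t/2 - t^2/6) 1 (by fun_prop))
    refine h2.congr ?_ ?_
    · intro t; ring
    · intro t; ring
  have h2 : (fun t : ℂ => H (Complex.exp (-t)) - (H 1 + iteratedDeriv 1 H 1 * (Complex.exp (-t) - 1)
      + iteratedDeriv 2 H 1 / 2 * (Complex.exp (-t) - 1)^2 +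
        iteratedDeriv 3 H 1 / 6 * (Complex.exp (-t) - 1)^3)) =O[𝓝[≠] 0] (fun t => t^4) := by
    have h3 := h1.trans ((hy1.norm_left).pow 4)
    refine h3.congr_left ?_
    intro t
    simp [FormalMultilinearSeries.partialSum, Finset.sum_range_succ, Nat.factorial]
    ring
  generalize iteratedDeriv 1 H 1 = d1 at *
  generalize iteratedDeriv 2 H 1 = d2 at *
  generalize iteratedDeriv 3 H 1 = d3 at *
  have h4 := mul_cont hE (g := fun t => d1 + d2/2 * ((Complex.exp (-t) - 1) + (- t + t^2/2 - t^3/6))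
    + d3/6 * ((Complex.exp (-t) - 1)^2 + (Complex.exp (-t) - 1) * (- t + t^2/2 - t^3/6) +
      (- t + t^2/2 - t^3/6)^2)) (by fun_prop)
  have h5 := pow_cont (g := fun t => d2/2 * ((-1/6 * t + 1/36 * t^2) + 1/4 + 1/3)
    + d3/6 * (3/2 + t * (-(3/4) - 1/2 ) + t^2 * (1/8 + 1/2) - t^3 * (1/12+1/8) + t^4 * (1/24) - t^5/216)) 4
    (by fun_prop)
  refine ((h2.add h4).add h5).congr_left ?_
  intro t
  ring

lemma roots_eq_image {g : ℕ} (hg : 0 < g) {ω : ℂ} (hω : IsPrimitiveRoot ω g) :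
    nthRootsFinset g (1:ℂ) = (range g).image (fun k => ω^k) := by
  symm
  apply eq_of_subset_of_card_le
  · intro z hz
    obtain ⟨k, -, rfl⟩ := mem_image.mp hz
    rw [Polynomial.mem_nthRootsFinset hg, ← pow_mul, mul_comm, pow_mul, hω.pow_eq_one, one_pow]
  · rw [hω.card_nthRootsFinset, card_image_of_injOn]
    · simp
    · intro x hx y hy h
      exact hω.pow_inj (by simpa using hx) (by simpa using hy) h

lemma sum_roots {g : ℕ} (hg : 0 < g) {ω : ℂ} (hω : IsPrimitiveRoot ω g) (F : ℂ → ℂ) :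
    ∑ z ∈ nthRootsFinset g (1:ℂ), F z = ∑ k ∈ range g, F (ω^k) := by
  rw [roots_eq_image hg hω, sum_image]
  intro x hx y hy h
  exact hω.pow_inj (by simpa using hx) (by simpa using hy) h

lemma orth {g : ℕ} (hg : 0 < g) (k l : ℕ) (hk : k < g) (hl : l < g) :
    ∑ z ∈ nthRootsFinset g (1:ℂ), z^k * (z⁻¹)^l = if k = l then (g:ℂ) else 0 := by
  have hω := Complex.isPrimitiveRoot_exp g hg.ne'
  set ω := Complex.exp (2 * Real.pi * Complex.I / g)
  have hω0 : ω ≠ 0 := hω.ne_zero hg.ne'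
  rw [sum_roots hg hω]
  have : ∀ i ∈ range g, (ω^i)^k * ((ω^i)⁻¹)^l = (ω^k * (ω⁻¹)^l)^i := by
    intro i _
    rw [mul_pow, ← pow_mul, ← pow_mul, ← inv_pow, ← pow_mul, ← pow_mul, mul_comm i k, mul_comm i l]
  rw [sum_congr rfl this]
  split_ifs with h
  · subst h
    rw [← mul_pow, mul_inv_cancel₀ hω0]; simp
  · have hne : ω^k * (ω⁻¹)^l ≠ 1 := by
      intro h1
      apply h
      apply hω.pow_inj hk hl
      rw [inv_pow] at h1
      exact (mul_inv_eq_one₀ (pow_ne_zero _ hω0)).mp h1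
    rw [geom_sum_eq hne]
    have : (ω^k * (ω⁻¹)^l)^g = 1 := by
      rw [mul_pow, ← pow_mul, ← pow_mul, mul_comm k, mul_comm l, pow_mul, pow_mul, inv_pow,
        hω.pow_eq_one]
      simp
    rw [this]; simp

lemma arith_geom (g : ℕ) (z : ℂ) : (z - 1) * ∑ k ∈ range g, (k:ℂ) * z^k + z * ∑ k ∈ range g, z^k = g * z^g := by
  induction g with
  | zero => simp
  | succ m ih =>
    rw [sum_range_succ, sum_range_succ]
    push_cast
    linear_combination ih 

lemma sum_k (g : ℕ) : ∑ k ∈ range g, (k:ℂ) = g * (g-1)/2 := by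
  induction g with
  | zero => simp
  | succ m ih => rw [sum_range_succ, ih]; push_cast; ring

lemma sum_k2 (g : ℕ) : ∑ k ∈ range g, (k:ℂ)*k = g * (g-1)*(2*g-1)/6 := by
  induction g with
  | zero => simp
  | succ m ih => rw [sum_range_succ, ih]; push_cast; ring

lemma sum_csc {g : ℕ} (hg : 0 < g) :
    ∑ z ∈ (nthRootsFinset g (1:ℂ)).erase 1, (2 - z - z⁻¹)⁻¹ = ((g:ℂ)^2 - 1)/12 := by
  have hg0 : (g:ℂ) ≠ 0 := by exact_mod_cast hg.ne'
  let S : ℂ → ℂ := fun z => ∑ k ∈ range g, (k:ℂ) * z^k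
  have hS : ∀ z : ℂ, z^g = 1 → z ≠ 1 → S z = g / (z - 1) := by
    intro z hz h1
    have h2 := arith_geom g z
    rw [geom_sum_eq h1, hz] at h2
    have : z - 1 ≠ 0 := sub_ne_zero.mpr h1
    rw [eq_div_iff this]
    simp at h2
    simp only [S]; linear_combination h2
  have h1mem : (1:ℂ) ∈ nthRootsFinset g (1:ℂ) := by
    rw [Polynomial.mem_nthRootsFinset hg]; simp
  have hP : ∑ z ∈ nthRootsFinset g (1:ℂ), S z * S z⁻¹ = g * (g * (g-1)*(2*g-1)/6) := by
    have : ∀ z ∈ nthRootsFinset g (1:ℂ), S z * S z⁻¹ =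
        ∑ k ∈ range g, ∑ l ∈ range g, (k:ℂ) * l * (z^k * (z⁻¹)^l) := by
      intro z _
      simp only [S]
      rw [sum_mul_sum]
      refine sum_congr rfl fun k _ => sum_congr rfl fun l _ => by ring
    rw [sum_congr rfl this, sum_comm]
    have h2 : ∀ k ∈ range g, ∑ z ∈ nthRootsFinset g (1:ℂ), ∑ l ∈ range g, (k:ℂ) * l * (z^k * (z⁻¹)^l)
        = g * ((k:ℂ) * k) := by
      intro k hk
      rw [sum_comm]
      have : ∀ l ∈ range g, ∑ z ∈ nthRootsFinset g (1:ℂ), (k:ℂ) * l * (z^k * (z⁻¹)^l) =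
          if k = l then (g:ℂ) * ((k:ℂ) * k) else 0 := by
        intro l hl
        rw [← mul_sum, orth hg k l (by simpa using hk) (by simpa using hl)]
        split_ifs with h
        · subst h; ring
        · simp
      rw [sum_congr rfl this, sum_ite_eq]
      simp [mem_range.mp hk]
    rw [sum_congr rfl h2, ← mul_sum, sum_k2]
  rw [← add_sum_erase _ _ h1mem] at hP
  have h3 : ∀ z ∈ (nthRootsFinset g (1:ℂ)).erase 1, S z * S z⁻¹ = g^2 * (2 - z - z⁻¹)⁻¹ := by
    intro z hz
    obtain ⟨hz1, hz⟩ := mem_erase.mp hz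
    rw [Polynomial.mem_nthRootsFinset hg] at hz
    have hz0 : z ≠ 0 := by
      rintro rfl; rw [zero_pow hg.ne'] at hz; exact zero_ne_one hz
    rw [hS z hz hz1, hS z⁻¹ (by rw [inv_pow, hz, inv_one]) (by simpa using hz1)]
    rw [div_mul_div_comm, ← sq, div_eq_mul_inv]
    congr 2
    field_simp
    ring
  rw [sum_congr rfl h3, ← mul_sum] at hP
  have h4 : S 1 = g * (g-1)/2 := by simp [S, sum_k]
  rw [inv_one, h4] at hP
  have : (g:ℂ)^2 ≠ 0 := pow_ne_zero _ hg0
  apply mul_left_cancel₀ this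
  linear_combination hP

lemma sum_odd {g : ℕ} (hg : 0 < g) (F : ℂ → ℂ) (hF : ∀ z, F z⁻¹ = - F z) :
    ∑ z ∈ (nthRootsFinset g (1:ℂ)).erase 1, F z = 0 := by
  have : ∑ z ∈ (nthRootsFinset g (1:ℂ)).erase 1, F z = ∑ z ∈ (nthRootsFinset g (1:ℂ)).erase 1, F z⁻¹ := by
    refine sum_nbij' (fun z => z⁻¹) (fun z => z⁻¹) ?_ ?_ ?_ ?_ ?_
    · intro z hz
      simp only [mem_erase, Polynomial.mem_nthRootsFinset hg] at hz ⊢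
      exact ⟨by simpa using hz.1, by rw [inv_pow, hz.2, inv_one]⟩
    · intro z hz
      simp only [mem_erase, Polynomial.mem_nthRootsFinset hg] at hz ⊢
      exact ⟨by simpa using hz.1, by rw [inv_pow, hz.2, inv_one]⟩
    · simp
    · simp
    · simp
  simp only [hF, sum_neg_distrib] at this
  linear_combination this / 2

lemma pow_gcd_one {z : ℂ} {m k : ℕ} (h1 : z^m = 1) (h2 : z^k = 1) : z^(Nat.gcd m k) = 1 := by
  rw [← orderOf_dvd_iff_pow_eq_one] at *
  exact Nat.dvd_gcd h1 h2

lemma sum_coprime {g m : ℕ} (hg : 0 < g) (h : Nat.gcd g m = 1) (F : ℂ → ℂ) :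
    ∑ z ∈ (nthRootsFinset g (1:ℂ)).erase 1, F (z^m) = ∑ z ∈ (nthRootsFinset g (1:ℂ)).erase 1, F z := by
  have hmaps : Set.MapsTo (fun z : ℂ => z^m) ((nthRootsFinset g (1:ℂ)).erase 1)
      ((nthRootsFinset g (1:ℂ)).erase 1) := by
    intro z hz
    simp only [mem_coe, mem_erase, Polynomial.mem_nthRootsFinset hg] at hz ⊢
    refine ⟨fun h1 => hz.1 ?_, by rw [← pow_mul, mul_comm, pow_mul, hz.2, one_pow]⟩
    simpa [h] using pow_gcd_one hz.2 h1
  have hinj : Set.InjOn (fun z : ℂ => z^m) ((nthRootsFinset g (1:ℂ)).erase 1) := by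
    intro z hz y hy hzy
    simp only [mem_coe, mem_erase, Polynomial.mem_nthRootsFinset hg] at hz hy hzy
    have hy0 : y ≠ 0 := by
      rintro rfl; rw [zero_pow hg.ne'] at hy; exact zero_ne_one hy.2
    have h1 : (z/y)^g = 1 := by rw [div_pow, hz.2, hy.2, div_one]
    have h2 : (z/y)^m = 1 := by rw [div_pow, hzy, div_self (pow_ne_zero _ hy0)]
    have := pow_gcd_one h1 h2
    rw [h, pow_one] at this
    exact (div_eq_one_iff_eq hy0).mp this
  exact sum_nbij _ hmaps hinj (surjOn_of_injOn_of_card_le _ hmaps hinj le_rfl) (fun _ _ => rfl)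

/-- The ratio of the two relevant weights. -/
noncomputable def bb {n : ℕ} (a : Fin n → ℕ) (i j : Fin n) : ℂ := (a j : ℂ) / (a i : ℂ)

/-- The gcd of all weights but one. -/
def gg {n : ℕ} (a : Fin n → ℕ) (j : Fin n) : ℕ := (Finset.univ.erase j).gcd a

lemma bb_ne {n : ℕ} (a : Fin n → ℕ) (hpos : ∀ i, 0 < a i) (hdist : Function.Injective a)
    {i j : Fin n} (h : j ≠ i) : 1 - bb a i j ^ 2 ≠ 0 := by
  intro h1
  have hi : (a i : ℂ) ≠ 0 := by exact_mod_cast (hpos i).ne'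
  unfold bb at h1
  field_simp at h1
  have h2 : (a i : ℂ)^2 = (a j : ℂ)^2 := by linear_combination h1
  have h3 : a i ^ 2 = a j ^ 2 := by exact_mod_cast h2
  exact h (hdist (Nat.pow_left_injective (n := 2) (by norm_num) h3)).symm

lemma pow_finset_gcd {ι : Type*} (s : Finset ι) (a : ι → ℕ) (z : ℂ) :
    z ^ (s.gcd a) = 1 ↔ ∀ j ∈ s, z ^ a j = 1 := by
  simp only [← orderOf_dvd_iff_pow_eq_one, Finset.dvd_gcd_iff]

lemma local_expand {n : ℕ} (a : Fin n → ℕ) (hpos : ∀ i, 0 < a i) (hdist : Function.Injective a)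
    (hgcd : Finset.univ.gcd a = 1) (i : Fin n) (z : ℂ) (hz : z ^ a i = 1) :
    (fun t => ∏ j ∈ univ.erase i, ffac (z ^ a j) (bb a i j) t -
      ((if z = 1 then ∏ j ∈ univ.erase i, (1 - bb a i j ^ 2)⁻¹ else 0)
       + ((if z = 1 then (∏ j ∈ univ.erase i, (1 - bb a i j ^ 2)⁻¹) *
              (-(∑ j ∈ univ.erase i, bb a i j ^ 2) / 12) else 0)
          + ∑ j ∈ univ.erase i, if z ≠ 1 ∧ z ^ gg a j = 1 then
              (∏ k ∈ (univ.erase i).erase j, (1 - bb a i k ^ 2)⁻¹) *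
                (2 - z ^ a j - (z ^ a j)⁻¹)⁻¹ else 0) * t ^ 2
       + (∑ j ∈ univ.erase i, if z ≠ 1 ∧ z ^ gg a j = 1 then
              (∏ k ∈ (univ.erase i).erase j, (1 - bb a i k ^ 2)⁻¹) * -bb a i j *
                ((z ^ a j - (z ^ a j)⁻¹) / (2 - z ^ a j - (z ^ a j)⁻¹) ^ 2) else 0) * t ^ 3))
      =O[𝓝[≠] 0] (fun t => t ^ 4) := by
  have hz0 : z ≠ 0 := by
    rintro rfl; rw [zero_pow (hpos i).ne'] at hz; exact zero_ne_one hz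
  by_cases h1 : z = 1
  · subst h1
    refine (prod_good (univ.erase i) (bb a i)
      (fun j hj => bb_ne a hpos hdist (ne_of_mem_erase hj))).congr_left ?_
    intro t
    simp
    ring
  have huniq : ∀ j, z ^ gg a j = 1 → z ^ a j ≠ 1 := by
    intro j hj hj2
    apply h1
    have : z ^ (univ.gcd a) = 1 := by
      rw [pow_finset_gcd]
      intro k _
      by_cases hk : k = j
      · rw [hk]; exact hj2
      · exact (pow_finset_gcd _ a z).mp hj k (by simp [hk])
    simpa [hgcd] using this
  by_cases h2 : ∃ j, z ^ gg a j = 1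
  · obtain ⟨j, hj⟩ := h2
    have hji : j ≠ i := by
      rintro rfl; exact huniq _ hj hz
    have hjm : j ∈ univ.erase i := by simp [hji]
    have hone : ∀ k, k ≠ j → z ^ a k = 1 := fun k hk =>
      (pow_finset_gcd _ a z).mp hj k (by simp [hk])
    have hiff : ∀ k, (z ≠ 1 ∧ z ^ gg a k = 1) ↔ k = j := by
      intro k
      constructor
      · rintro ⟨-, hk⟩
        by_contra hne
        exact huniq k hk (hone k hne)
      · rintro rfl; exact ⟨h1, hj⟩
    have hb := prod_bad ((univ.erase i).erase j) (bb a i)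
      (fun k hk => bb_ne a hpos hdist (ne_of_mem_erase (mem_of_mem_erase hk)))
      (z ^ a j) (bb a i j) (two_sub_ne (pow_ne_zero _ hz0) (huniq j hj))
    refine hb.congr_left ?_
    intro t
    simp only [hiff, h1, if_false, sum_ite_eq', hjm, if_true]
    rw [← mul_prod_erase (univ.erase i) _ hjm]
    have : ∏ k ∈ (univ.erase i).erase j, ffac (z ^ a k) (bb a i k) t =
        ∏ k ∈ (univ.erase i).erase j, ffac 1 (bb a i k) t :=
      prod_congr rfl fun k hk => by rw [hone k (ne_of_mem_erase hk)]
    rw [this]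
    ring
  · push Not at h2
    obtain ⟨j, hjm, hj⟩ : ∃ j ∈ univ.erase i, z ^ a j ≠ 1 := by
      by_contra! hcon
      exact h2 i ((pow_finset_gcd _ a z).mpr hcon)
    obtain ⟨k, hkm, hk⟩ : ∃ k ∈ univ.erase j, z ^ a k ≠ 1 := by
      by_contra! hcon
      exact h2 j ((pow_finset_gcd _ a z).mpr hcon)
    have hki : k ∈ univ.erase i := by
      simp only [mem_erase, mem_univ, and_true]
      rintro rfl; exact hk hz
    have := prod_bad2 (univ.erase i) (bb a i) (fun j => z ^ a j)
      (fun j hj => bb_ne a hpos hdist (ne_of_mem_erase hj)) (fun j => pow_ne_zero _ hz0)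
      k j hki hjm (ne_of_mem_erase hkm) hk hj
    refine this.congr_left ?_
    intro t
    simp [h1, h2]

lemma sum_filter_roots {g m : ℕ} (hg : 0 < g) (hm : 0 < m) (hd : g ∣ m) (F : ℂ → ℂ) :
    (∑ z ∈ nthRootsFinset m (1:ℂ), if z ≠ 1 ∧ z ^ g = 1 then F z else 0) =
      ∑ z ∈ (nthRootsFinset g (1:ℂ)).erase 1, F z := by
  rw [← sum_filter]
  congr 1
  ext z
  simp only [mem_filter, mem_erase, Polynomial.mem_nthRootsFinset hg,
    Polynomial.mem_nthRootsFinset hm]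
  constructor
  · rintro ⟨-, h⟩; exact h
  · rintro ⟨h1, h2⟩
    obtain ⟨c, rfl⟩ := hd
    exact ⟨by rw [pow_mul, h2, one_pow], h1, h2⟩

lemma summand_eq (X Y z : ℂ) (hX : X ≠ 0) (hz0 : z ≠ 0) (hY0 : Y ≠ 0) :
    (1 - X) ^ 2 / ((1 - X * (z * Y)) * (1 - X * (z * Y)⁻¹)) =
      (X⁻¹ + X - 2) / (X⁻¹ + X - z * Y - z⁻¹ * Y⁻¹) := by
  rw [← mul_div_mul_left (X⁻¹ + X - 2) _ hX]
  congr 1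
  · field_simp; ring
  · field_simp; ring

lemma finsum_roots {m : ℕ} (hm : 0 < m) (t : ℂ) (F : ℂ → ℂ) :
    (∑ᶠ (w : ℂ) (_ : w ^ m = Complex.exp (-t)), F w) =
      ∑ z ∈ nthRootsFinset m (1:ℂ), F (z * Complex.exp (-(t / m))) := by
  have hm0 : (m:ℂ) ≠ 0 := by exact_mod_cast hm.ne'
  have hr : Complex.exp (-(t / m)) ^ m = Complex.exp (-t) := by
    rw [← Complex.exp_nat_mul]; congr 1; field_simp
  have hr0 := Complex.exp_ne_zero (-(t / m))
  rw [finsum_cond_eq_sum_of_cond_iff F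
    (t := (nthRootsFinset m (1:ℂ)).image (fun z => z * Complex.exp (-(t / m)))), sum_image]
  · intro x _ y _ h
    exact mul_right_cancel₀ hr0 h
  · intro w _
    simp only [mem_image, Polynomial.mem_nthRootsFinset hm]
    constructor
    · intro hw
      refine ⟨w / Complex.exp (-(t / m)), ?_, by field_simp⟩
      rw [div_pow, hr, hw, div_self (Complex.exp_ne_zero _)]
    · rintro ⟨z, hz, rfl⟩
      rw [mul_pow, hz, hr, one_mul]

lemma phi_eq (n : ℕ) (a : Fin n → ℕ) (hpos : ∀ i, 0 < a i) (t : ℂ) :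
    (1 - Complex.exp (-t)) ^ (2 * n - 2) *
        ∑ i, ∑ᶠ (w : ℂ) (_ : w ^ a i = Complex.exp (-t)),
          1 / ((a i : ℂ) *
            ∏ j ∈ Finset.univ.erase i,
              ((1 - Complex.exp (-t) * w ^ a j) * (1 - Complex.exp (-t) * (w ^ a j)⁻¹))) =
    ∑ i, (a i : ℂ)⁻¹ * ∑ z ∈ nthRootsFinset (a i) (1:ℂ),
      ∏ j ∈ univ.erase i, ffac (z ^ a j) (bb a i j) t := by
  rw [mul_sum]
  refine sum_congr rfl fun i _ => ?_
  rw [finsum_roots (hpos i), mul_sum, mul_sum]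
  refine sum_congr rfl fun z hz => ?_
  rw [Polynomial.mem_nthRootsFinset (hpos i)] at hz
  have hz0 : z ≠ 0 := by
    rintro rfl; rw [zero_pow (hpos i).ne'] at hz; exact zero_ne_one hz
  have hcard : (1 - Complex.exp (-t)) ^ (2 * n - 2) =
      ∏ j ∈ univ.erase i, (1 - Complex.exp (-t)) ^ 2 := by
    rw [prod_const, card_erase_of_mem (mem_univ i), card_univ, Fintype.card_fin, ← pow_mul]
    congr 1
    omega
  rw [hcard, one_div, mul_inv, mul_left_comm, ← div_eq_mul_inv, ← prod_div_distrib]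
  congr 1
  refine prod_congr rfl fun j _ => ?_
  have hw : (z * Complex.exp (-(t / a i))) ^ a j = z ^ a j * Complex.exp (-(bb a i j * t)) := by
    rw [mul_pow, ← Complex.exp_nat_mul]
    congr 2
    unfold bb
    ring
  rw [hw, summand_eq _ _ _ (Complex.exp_ne_zero _) (pow_ne_zero _ hz0) (Complex.exp_ne_zero _)]
  unfold ffac
  rw [← Complex.exp_neg, ← Complex.exp_neg, neg_neg, neg_neg]

lemma prod_ratio {n : ℕ} (a : Fin n → ℕ) (hpos : ∀ i, 0 < a i) (i : Fin n) (s : Finset (Fin n)) :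
    ∏ j ∈ s, (1 - bb a i j ^ 2)⁻¹ =
      ((a i : ℂ) ^ 2) ^ s.card / ∏ j ∈ s, ((a i : ℂ) ^ 2 - (a j : ℂ) ^ 2) := by
  have hi : (a i : ℂ) ≠ 0 := by exact_mod_cast (hpos i).ne'
  rw [← prod_const, ← prod_div_distrib]
  refine prod_congr rfl fun j _ => ?_
  rw [← inv_div]
  congr 1
  unfold bb
  field_simp

theorem on_shell_hilbert_series_gamma2_gamma3 (n : ℕ) (hn : 2 ≤ n)
    (a : Fin n → ℕ) (hpos : ∀ i, 0 < a i) (hdist : Function.Injective a)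
    (hgcd : Finset.univ.gcd a = 1)
    (H : ℂ → ℂ) (N : Set ℂ) (hN : N ∈ 𝓝 (1 : ℂ)) (hH : AnalyticOnNhd ℂ H N)
    (hHeq : ∀ x ∈ N, ‖x‖ < 1 →
      H x = (1 - x) ^ (2 * n - 2) *
        ∑ i, ∑ᶠ (w : ℂ) (_ : w ^ a i = x),
          1 / ((a i : ℂ) *
            ∏ j ∈ Finset.univ.erase i,
              ((1 - x * w ^ a j) * (1 - x * (w ^ a j)⁻¹)))) :
    iteratedDeriv 2 H 1 / 2 = -(iteratedDeriv 3 H 1) / 6 ∧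
    iteratedDeriv 2 H 1 / 2 =
      -(1 / 12) * (∑ i,
          ((a i : ℂ) ^ (2 * (n : ℤ) - 5) /
              ∏ j ∈ Finset.univ.erase i, ((a i : ℂ) ^ 2 - (a j : ℂ) ^ 2)) *
            ∑ j ∈ Finset.univ.erase i, (a j : ℂ) ^ 2)
      + (1 / 12) * ∑ j, ∑ i ∈ Finset.univ.erase j,
          (a i : ℂ) ^ (2 * (n : ℤ) - 5) *
            ((((Finset.univ.erase j).gcd a : ℕ) : ℂ) ^ 2 - 1) /
            ∏ k ∈ (Finset.univ.erase j).erase i,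
              ((a i : ℂ) ^ 2 - (a k : ℂ) ^ 2) := by
  -- the approach filter
  let l : Filter ℂ := 𝓝[{t : ℂ | 0 < t.re}] 0
  have hlne : NeBot l := by
    rw [← mem_closure_iff_nhdsWithin_neBot, Complex.closure_setOfPred_lt_re]
    simp
  have hl : l ≤ 𝓝[≠] 0 := nhdsWithin_mono _ (by
    intro t ht h
    have h : t = 0 := h
    have ht : 0 < t.re := ht
    simp [h] at ht)
  -- expansions of all summands
  have hloc : ∀ i, ∀ z ∈ nthRootsFinset (a i) (1:ℂ), _ := fun i z hz =>
    local_expand a hpos hdist hgcd i z ((Polynomial.mem_nthRootsFinset (hpos i) _).mp hz)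
  have hsum := IsBigO.fun_sum (s := univ) (fun i _ =>
    (IsBigO.fun_sum (s := nthRootsFinset (a i) (1:ℂ)) (fun z hz => hloc i z hz)).const_mul_left
      ((a i : ℂ)⁻¹))
  have hexp := (H_expand (hH 1 (mem_of_mem_nhds hN))).mono hl
  have hev : ∀ᶠ t in l, H (Complex.exp (-t)) = ∑ i, (a i : ℂ)⁻¹ *
      ∑ z ∈ nthRootsFinset (a i) (1:ℂ), ∏ j ∈ univ.erase i, ffac (z ^ a j) (bb a i j) t := by
    have hc : Tendsto (fun t : ℂ => Complex.exp (-t)) l (𝓝 1) := by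
      have : Continuous (fun t : ℂ => Complex.exp (-t)) := by fun_prop
      simpa using (this.tendsto 0).mono_left (nhdsWithin_le_nhds (s := {t : ℂ | 0 < t.re}))
    filter_upwards [hc hN, self_mem_nhdsWithin] with t h1 h2
    rw [hHeq _ h1 (by
      have h2 : 0 < t.re := h2
      rw [Complex.norm_exp]; simpa using h2), phi_eq n a hpos t]
  have hgpos : ∀ i j : Fin n, j ≠ i → 0 < gg a j ∧ gg a j ∣ a i := by
    intro i j hji
    have : gg a j ∣ a i := Finset.gcd_dvd (by simp [hji.symm])
    exact ⟨Nat.pos_of_dvd_of_pos this (hpos i), this⟩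
  have hcop : ∀ j, Nat.gcd (gg a j) (a j) = 1 := by
    intro j
    rw [← hgcd, ← insert_erase (mem_univ j), Finset.gcd_insert, Nat.gcd_comm]
    simp [gg]
    rfl
  have hone : ∀ i, (1:ℂ) ∈ nthRootsFinset (a i) (1:ℂ) := fun i => by
    rw [Polynomial.mem_nthRootsFinset (hpos i)]; simp
  -- coefficients
  set C0 : ℂ := ∑ i, (a i : ℂ)⁻¹ * ∏ j ∈ univ.erase i, (1 - bb a i j ^ 2)⁻¹ with hC0
  set C2 : ℂ := ∑ i, (a i : ℂ)⁻¹ * ((∏ j ∈ univ.erase i, (1 - bb a i j ^ 2)⁻¹) *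
              (-(∑ j ∈ univ.erase i, bb a i j ^ 2) / 12) +
      ∑ j ∈ univ.erase i, (∏ k ∈ (univ.erase i).erase j, (1 - bb a i k ^ 2)⁻¹) *
        (((gg a j : ℂ) ^ 2 - 1) / 12)) with hC2
  have hcoef : ∀ t : ℂ, ∑ i, (a i : ℂ)⁻¹ * ∑ z ∈ nthRootsFinset (a i) (1:ℂ),
      ((if z = 1 then ∏ j ∈ univ.erase i, (1 - bb a i j ^ 2)⁻¹ else 0)
       + ((if z = 1 then (∏ j ∈ univ.erase i, (1 - bb a i j ^ 2)⁻¹) *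
              (-(∑ j ∈ univ.erase i, bb a i j ^ 2) / 12) else 0)
          + ∑ j ∈ univ.erase i, if z ≠ 1 ∧ z ^ gg a j = 1 then
              (∏ k ∈ (univ.erase i).erase j, (1 - bb a i k ^ 2)⁻¹) *
                (2 - z ^ a j - (z ^ a j)⁻¹)⁻¹ else 0) * t ^ 2
       + (∑ j ∈ univ.erase i, if z ≠ 1 ∧ z ^ gg a j = 1 then
              (∏ k ∈ (univ.erase i).erase j, (1 - bb a i k ^ 2)⁻¹) * -bb a i j *
                ((z ^ a j - (z ^ a j)⁻¹) / (2 - z ^ a j - (z ^ a j)⁻¹) ^ 2) else 0) * t ^ 3) =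
      C0 + C2 * t ^ 2 := by
    intro t
    rw [hC0, hC2, sum_mul, ← sum_add_distrib]
    refine sum_congr rfl fun i _ => ?_
    have e1 : ∑ z ∈ nthRootsFinset (a i) (1:ℂ), ∑ j ∈ univ.erase i,
        (if z ≠ 1 ∧ z ^ gg a j = 1 then
              (∏ k ∈ (univ.erase i).erase j, (1 - bb a i k ^ 2)⁻¹) *
                (2 - z ^ a j - (z ^ a j)⁻¹)⁻¹ else 0) =
        ∑ j ∈ univ.erase i, (∏ k ∈ (univ.erase i).erase j, (1 - bb a i k ^ 2)⁻¹) *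
        (((gg a j : ℂ) ^ 2 - 1) / 12) := by
      rw [sum_comm]
      refine sum_congr rfl fun j hj => ?_
      obtain ⟨h1, h2⟩ := hgpos i j (ne_of_mem_erase hj)
      rw [sum_filter_roots h1 (hpos i) h2, ← mul_sum,
        sum_coprime h1 (hcop j) (fun z => (2 - z - z⁻¹)⁻¹), sum_csc h1]
    have e2 : ∑ z ∈ nthRootsFinset (a i) (1:ℂ), ∑ j ∈ univ.erase i,
        (if z ≠ 1 ∧ z ^ gg a j = 1 then
              (∏ k ∈ (univ.erase i).erase j, (1 - bb a i k ^ 2)⁻¹) * -bb a i j *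
                ((z ^ a j - (z ^ a j)⁻¹) / (2 - z ^ a j - (z ^ a j)⁻¹) ^ 2) else 0) = 0 := by
      rw [sum_comm]
      refine sum_eq_zero fun j hj => ?_
      obtain ⟨h1, h2⟩ := hgpos i j (ne_of_mem_erase hj)
      rw [sum_filter_roots h1 (hpos i) h2, ← mul_sum,
        sum_coprime h1 (hcop j) (fun z => (z - z⁻¹) / (2 - z - z⁻¹) ^ 2), sum_odd h1, mul_zero]
      intro z
      rw [inv_inv, ← neg_div]
      congr 1
      · ring
      · ring
    rw [sum_add_distrib, sum_add_distrib, ← sum_mul, ← sum_mul, sum_add_distrib, e1, e2,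
      sum_ite_eq', sum_ite_eq', if_pos (hone i), if_pos (hone i)]
    ring
  have hfin : (fun t : ℂ => (H 1 - C0) + (-(iteratedDeriv 1 H 1)) * t
      + (iteratedDeriv 1 H 1 / 2 + iteratedDeriv 2 H 1 / 2 - C2) * t^2
      + (- iteratedDeriv 1 H 1 / 6 - iteratedDeriv 2 H 1 / 2 - iteratedDeriv 3 H 1 / 6) * t^3)
      =O[l] (fun t => t^4) := by
    refine ((hsum.mono hl).sub hexp).congr' ?_ EventuallyEq.rfl
    filter_upwards [hev] with t ht
    rw [ht]
    simp only [sum_sub_distrib, mul_sub]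
    rw [hcoef t]
    ring
  obtain ⟨h0, h1, h2, h3⟩ := peel4 hl hfin
  have hC : iteratedDeriv 2 H 1 / 2 = C2 := by linear_combination h2 + h1 / 2
  refine ⟨by linear_combination -h3 + h1 / 6, ?_⟩
  rw [hC, hC2]
  have hcomm : ∑ j, ∑ i ∈ Finset.univ.erase j,
          (a i : ℂ) ^ (2 * (n : ℤ) - 5) *
            ((((Finset.univ.erase j).gcd a : ℕ) : ℂ) ^ 2 - 1) /
            ∏ k ∈ (Finset.univ.erase j).erase i,
              ((a i : ℂ) ^ 2 - (a k : ℂ) ^ 2) =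
      ∑ i, ∑ j ∈ Finset.univ.erase i,
          (a i : ℂ) ^ (2 * (n : ℤ) - 5) *
            ((((Finset.univ.erase j).gcd a : ℕ) : ℂ) ^ 2 - 1) /
            ∏ k ∈ (Finset.univ.erase i).erase j,
              ((a i : ℂ) ^ 2 - (a k : ℂ) ^ 2) := by
    rw [sum_comm' (t' := univ) (s' := fun i => univ.erase i)]
    · refine sum_congr rfl fun i _ => sum_congr rfl fun j _ => ?_
      rw [erase_right_comm]
    · intro x y
      simp [eq_comm]
  rw [hcomm, mul_sum, mul_sum, ← sum_add_distrib]
  refine sum_congr rfl fun i _ => ?_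
  have hi : (a i : ℂ) ≠ 0 := by exact_mod_cast (hpos i).ne'
  obtain ⟨m, rfl⟩ := Nat.exists_eq_add_of_le' hn
  have hzp : (a i : ℂ) ^ (2 * ((m + 2 : ℕ) : ℤ) - 5) = (a i : ℂ)⁻¹ * ((a i : ℂ) ^ 2) ^ m := by
    rw [← pow_mul, ← zpow_natCast, ← zpow_neg_one, ← zpow_add₀ hi]
    congr 1
    push_cast
    ring
  rw [mul_add]
  congr 1
  · rw [prod_ratio a hpos, card_erase_of_mem (mem_univ i), card_univ, Fintype.card_fin, hzp]
    have : ∑ j ∈ univ.erase i, bb a i j ^ 2 = (∑ j ∈ univ.erase i, (a j : ℂ) ^ 2) / (a i : ℂ) ^ 2 := by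
      rw [sum_div]
      exact sum_congr rfl fun j _ => by rw [bb, div_pow]
    rw [this, show m + 2 - 1 = m + 1 by omega, pow_succ]
    field_simp
  · rw [mul_sum, mul_sum]
    refine sum_congr rfl fun j hj => ?_
    rw [prod_ratio a hpos, card_erase_of_mem hj, card_erase_of_mem (mem_univ i), card_univ,
      Fintype.card_fin, hzp, show m + 2 - 1 - 1 = m by omega]
    unfold gg
    ring
end

section
/- Let n ≥ 2 and let a_1, …, a_n be positive integers (repetitions allowed) with gcd(a_1, …, a_n) = 1. Then there exists a function H, analytic on a neighborhood N of 1 in ℂ, such that H(x) = (1 − x)^{2n−2} (1 − x²) P_A(x) for all x ∈ N with 0 < |x| < 1, and moreover H(1) > 0, H′(1) = 0, H″(1) > 0, and H″(1)/2 = −H‴(1)/6. (Equivalently: the on-shell Hilbert series (1 − x²)P_A(x) of the symplectic circle quotient has a pole of order at most 2n−2 at x = 1, and its Laurent coefficients satisfy γ_0 > 0, γ_1 = 0, and γ_2 = γ_3 > 0, even when the weight vector is degenerate.) -/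
open Filter Topology Finset


noncomputable def dnP (T : Multiset ℂ) (z : ℂ) : ℂ := (T.map (fun r => z - r)).prod

noncomputable def cI (R : ℝ) (m : ℕ) (T : Multiset ℂ) : ℂ := ∮ z in C(0, R), z ^ m / dnP T z

lemma dnP_cons (P : ℂ) (T : Multiset ℂ) (z : ℂ) : dnP (P ::ₘ T) z = (z - P) * dnP T z := by
  simp [dnP]

lemma dnP_add (S T : Multiset ℂ) (z : ℂ) : dnP (S + T) z = dnP S z * dnP T z := by
  simp [dnP]

lemma dnP_replicate (P : ℂ) (k : ℕ) (z : ℂ) : dnP (Multiset.replicate k P) z = (z - P) ^ k := by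
  simp [dnP]

lemma dnP_ne_zero {T : Multiset ℂ} {z : ℂ} (h : ∀ r ∈ T, z ≠ r) : dnP T z ≠ 0 := by
  unfold dnP
  rw [Ne, Multiset.prod_eq_zero_iff]
  simp only [Multiset.mem_map, not_exists, not_and]
  intro r hr h0
  exact h r hr (sub_eq_zero.mp h0)

lemma dnP_differentiable (T : Multiset ℂ) : Differentiable ℂ (dnP T) := by
  induction T using Multiset.induction_on with
  | empty => 
    have : dnP 0 = fun _ => 1 := by funext z; simp [dnP]
    rw [this]; exact differentiable_const _
  | cons P T ih =>
    have : dnP (P ::ₘ T) = fun z => (z - P) * dnP T z := by funext z; exact dnP_cons P T z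
    rw [this]
    exact (differentiable_id.sub_const P).mul ih

lemma cI_integrable {R : ℝ} (hR : 0 < R) (m : ℕ) {T : Multiset ℂ} (hT : ∀ r ∈ T, ‖r‖ ≠ R) :
    CircleIntegrable (fun z => z ^ m / dnP T z) 0 R := by
  apply ContinuousOn.circleIntegrable hR.le
  apply ContinuousOn.div
  · fun_prop
  · exact (dnP_differentiable T).continuous.continuousOn
  · intro z hz
    apply dnP_ne_zero
    rintro r hr rfl
    apply hT z hr
    simpa using hz

lemma cI_split {R : ℝ} (hR : 0 < R) (m : ℕ) {T : Multiset ℂ} (hT : ∀ r ∈ T, ‖r‖ ≠ R) {P Q : ℂ}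
    (hP : ‖P‖ ≠ R) (hQ : ‖Q‖ ≠ R) (hPQ : P ≠ Q) :
    cI R m (P ::ₘ Q ::ₘ T) = (P - Q)⁻¹ * (cI R m (P ::ₘ T) - cI R m (Q ::ₘ T)) := by
  have h1 : CircleIntegrable (fun z => z ^ m / dnP (P ::ₘ T) z) 0 R :=
    cI_integrable hR m (by
      intro r hr
      rcases Multiset.mem_cons.mp hr with rfl | h
      · exact hP
      · exact hT r h)
  have h2 : CircleIntegrable (fun z => z ^ m / dnP (Q ::ₘ T) z) 0 R :=
    cI_integrable hR m (by
      intro r hr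
      rcases Multiset.mem_cons.mp hr with rfl | h
      · exact hQ
      · exact hT r h)
  unfold cI
  rw [← circleIntegral.integral_sub h1 h2, ← circleIntegral.integral_const_mul]
  apply circleIntegral.integral_congr hR.le
  intro z hz
  have hz' : ‖z‖ = R := by simpa using hz
  have a1 : z - P ≠ 0 := by
    intro h; apply hP; rw [← sub_eq_zero.mp h]; exact hz'
  have a2 : z - Q ≠ 0 := by
    intro h; apply hQ; rw [← sub_eq_zero.mp h]; exact hz'
  have a3 : dnP T z ≠ 0 := dnP_ne_zero (by
    rintro r hr rfl
    exact hT z hr hz')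
  have a4 : P - Q ≠ 0 := sub_ne_zero.mpr hPQ
  simp only [dnP_cons]
  field_simp
  ring

lemma cI_shift {R : ℝ} (hR : 0 < R) (m : ℕ) {T : Multiset ℂ} (hT : ∀ r ∈ T, ‖r‖ ≠ R) {P : ℂ}
    (hP : ‖P‖ ≠ R) :
    cI R (m + 1) (P ::ₘ T) = cI R m T + P * cI R m (P ::ₘ T) := by
  have h1 : CircleIntegrable (fun z => z ^ m / dnP (P ::ₘ T) z) 0 R :=
    cI_integrable hR m (by
      intro r hr
      rcases Multiset.mem_cons.mp hr with rfl | h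
      · exact hP
      · exact hT r h)
  have h2 : CircleIntegrable (fun z => z ^ m / dnP T z) 0 R := cI_integrable hR m hT
  have h3 : CircleIntegrable (fun z => P * (z ^ m / dnP (P ::ₘ T) z)) 0 R := h1.const_mul P
  unfold cI
  rw [← circleIntegral.integral_const_mul, ← circleIntegral.integral_add h2 h3]
  apply circleIntegral.integral_congr hR.le
  intro z hz
  have hz' : ‖z‖ = R := by simpa using hz
  have a1 : z - P ≠ 0 := by
    intro h; apply hP; rw [← sub_eq_zero.mp h]; exact hz'
  have a3 : dnP T z ≠ 0 := dnP_ne_zero (by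
    rintro r hr rfl
    exact hT z hr hz')
  simp only [dnP_cons]
  field_simp
  ring

lemma cI_out {R : ℝ} (hR : 0 < R) (m : ℕ) {T : Multiset ℂ} (hT : ∀ r ∈ T, R < ‖r‖) :
    cI R m T = 0 := by
  have hne : ∀ z ∈ Metric.closedBall (0:ℂ) R, dnP T z ≠ 0 := by
    intro z hz
    apply dnP_ne_zero
    rintro r hr rfl
    have := hT z hr
    have : ‖z‖ ≤ R := by simpa using hz
    linarith
  apply Complex.circleIntegral_eq_zero_of_differentiable_on_off_countable hR.le Set.countable_empty
  · apply ContinuousOn.div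
    · fun_prop
    · exact (dnP_differentiable T).continuous.continuousOn
    · exact hne
  · intro z hz
    apply DifferentiableAt.div
    · fun_prop
    · exact (dnP_differentiable T) z
    · exact hne z (Metric.ball_subset_closedBall hz.1)

lemma cI_zero_one {R : ℝ} {P : ℂ} (hP : ‖P‖ < R) :
    cI R 0 (Multiset.replicate 1 P) = 2 * Real.pi * Complex.I := by
  unfold cI
  simp only [dnP_replicate]
  rw [← circleIntegral.integral_sub_inv_of_mem_ball (c := 0) (w := P) (R := R) (by simpa using hP)]
  congr 1
  funext z
  simp

lemma cI_zero_ge_two {R : ℝ} {P : ℂ} (k : ℕ) :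
    cI R 0 (Multiset.replicate (k + 2) P) = 0 := by
  unfold cI
  simp only [dnP_replicate]
  refine Eq.trans ?_ (circleIntegral.integral_sub_zpow_of_ne (n := -((k:ℤ) + 2)) (by omega) 0 P R)
  congr 1
  funext z
  rw [zpow_neg]
  norm_cast
  simp

lemma cI_replicate (m : ℕ) : ∀ k : ℕ, ∃ V : Polynomial ℂ, ∀ (R : ℝ) (P : ℂ), 0 < R → ‖P‖ < R →
    cI R m (Multiset.replicate k P) = V.eval P := by
  induction m with
  | zero =>
    intro k
    rcases k with _ | _ | k
    · refine ⟨0, fun R P hR hP => ?_⟩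
      rw [cI_out hR]
      · simp
      · simp
    · refine ⟨Polynomial.C (2 * Real.pi * Complex.I), fun R P hR hP => ?_⟩
      rw [cI_zero_one hP]; simp
    · refine ⟨0, fun R P hR hP => ?_⟩
      rw [cI_zero_ge_two]; simp
  | succ m ih =>
    intro k
    rcases k with _ | k
    · refine ⟨0, fun R P hR hP => ?_⟩
      rw [cI_out hR]
      · simp
      · simp
    · obtain ⟨V1, h1⟩ := ih k
      obtain ⟨V2, h2⟩ := ih (k + 1)
      refine ⟨V1 + Polynomial.X * V2, fun R P hR hP => ?_⟩
      rw [Multiset.replicate_succ, cI_shift hR, ← Multiset.replicate_succ, h1 R P hR hP,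
        h2 R P hR hP]
      · simp
      · intro r hr
        rw [Multiset.eq_of_mem_replicate hr]
        exact hP.ne
      · exact hP.ne

lemma multiset_dichotomy {α : Type*} (T : Multiset α) :
    (∃ k P, T = Multiset.replicate k P) ∨ T = 0 ∨ ∃ P Q T', P ≠ Q ∧ T = P ::ₘ Q ::ₘ T' := by
  classical
  induction T using Multiset.induction_on with
  | empty => right; left; rfl
  | cons P T _ =>
    by_cases h : ∀ b ∈ T, b = P
    · left
      refine ⟨T.card + 1, P, ?_⟩
      rw [Multiset.eq_replicate]
      simpa using h
    · right; right
      push Not at h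
      obtain ⟨Q, hQ, hne⟩ := h
      obtain ⟨T', rfl⟩ := Multiset.exists_cons_of_mem hQ
      exact ⟨P, Q, T', hne.symm, rfl⟩

lemma cI_zero_single {R : ℝ} (hR : 0 < R) : ∀ (k : ℕ) (T : Multiset ℂ), T.card = k →
    (∀ r ∈ T, ‖r‖ < R) → 2 ≤ k → cI R 0 T = 0 := by
  intro k
  induction k with
  | zero => intro T _ _ h; omega
  | succ k ih =>
    intro T hc hT hk
    rcases multiset_dichotomy T with ⟨j, P, rfl⟩ | rfl | ⟨P, Q, T', hPQ, rfl⟩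
    · simp at hc
      obtain ⟨i, rfl⟩ : ∃ i, j = i + 2 := ⟨j - 2, by omega⟩
      exact cI_zero_ge_two i
    · simp at hc
    · simp only [Multiset.mem_cons, forall_eq_or_imp] at hT
      obtain ⟨hP, hQ, hT⟩ := hT
      rw [cI_split hR 0 (fun r hr => (hT r hr).ne) hP.ne hQ.ne hPQ]
      simp at hc
      rcases Nat.lt_or_ge k 2 with h2 | h2
      · have : T' = 0 := by
          rw [← Multiset.card_eq_zero]; omega
        subst this
        have e1 := cI_zero_one hP
        have e2 := cI_zero_one hQ
        simp only [Multiset.replicate_one, ← Multiset.cons_zero] at e1 e2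
        rw [e1, e2]; simp
      · rw [ih (P ::ₘ T') (by simp; omega) _ h2, ih (Q ::ₘ T') (by simp; omega) _ h2]
        · simp
        · simpa using ⟨hQ, hT⟩
        · simpa using ⟨hP, hT⟩

lemma cI_total {R : ℝ} (hR : 0 < R) (m : ℕ) : ∀ (T : Multiset ℂ), 
    (∀ r ∈ T, ‖r‖ < R) → m + 2 ≤ T.card → cI R m T = 0 := by
  induction m with
  | zero => intro T hT h; exact cI_zero_single hR _ T rfl hT (by omega)
  | succ m ih =>
    intro T hT h
    obtain ⟨P, hP⟩ : ∃ P, P ∈ T := by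
      apply Multiset.card_pos_iff_exists_mem.mp; omega
    obtain ⟨T', rfl⟩ := Multiset.exists_cons_of_mem hP
    have hT2 := hT
    simp only [Multiset.mem_cons, forall_eq_or_imp] at hT
    simp at h
    rw [cI_shift hR m (fun r hr => (hT.2 r hr).ne) hT.1.ne, ih T' hT.2 (by omega),
      ih _ hT2 (by simp; omega)]
    simp

/-- moving poles -/
noncomputable def pol (s : ℂ) (p : ℂ × ℝ) : ℂ := p.1 * Complex.exp (p.2 * s)

lemma norm_pol {p : ℂ × ℝ} (hp : ‖p.1‖ = 1) (s : ℂ) : ‖pol s p‖ = Real.exp (p.2 * s.re) := by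
  unfold pol
  rw [norm_mul, hp, Complex.norm_exp]
  simp

lemma pol_analytic (p : ℂ × ℝ) (s : ℂ) : AnalyticAt ℂ (fun s => pol s p) s := by
  unfold pol
  fun_prop

lemma pol_lt_two {p : ℂ × ℝ} (hp : ‖p.1‖ = 1) : ∀ᶠ s in 𝓝 (0:ℂ), ‖pol s p‖ < 2 := by
  have hc : ContinuousAt (fun s => ‖pol s p‖) 0 := (pol_analytic p 0).continuousAt.norm
  apply hc.eventually_lt continuousAt_const
  simp [norm_pol hp]

lemma pol_ne {p q : ℂ × ℝ} (hp : ‖p.1‖ = 1) (hq : ‖q.1‖ = 1) (hpq : p ≠ q) :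
    ∀ᶠ s in 𝓝 (0:ℂ), s.re ≠ 0 → pol s p ≠ pol s q := by
  by_cases h : p.1 = q.1
  · have h2 : p.2 ≠ q.2 := fun h2 => hpq (Prod.ext h h2)
    refine Eventually.of_forall fun s hs he => ?_
    have := congrArg norm he
    rw [norm_pol hp, norm_pol hq, Real.exp_eq_exp] at this
    exact h2 (mul_right_cancel₀ hs this)
  · have : ∀ᶠ s in 𝓝 (0:ℂ), pol s p ≠ pol s q := by
      have hc := (pol_analytic p 0).continuousAt.sub (pol_analytic q 0).continuousAt
      have := hc.eventually_ne (y := 0) (by simpa [pol, sub_eq_zero] using h)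
      filter_upwards [this] with s hs h0
      exact hs (sub_eq_zero.mpr h0)
    filter_upwards [this] with s hs _ using hs

lemma pol_all_lt_two (T : Multiset (ℂ × ℝ)) (hT : ∀ p ∈ T, ‖p.1‖ = 1 ∧ p.2 ≠ 0) :
    ∀ᶠ s in 𝓝 (0:ℂ), ∀ r ∈ T.map (pol s), ‖r‖ < 2 := by
  have : ∀ᶠ s in 𝓝 (0:ℂ), ∀ p ∈ T.toFinset, ‖pol s p‖ < 2 := by
    rw [Filter.eventually_all_finset]
    intro p hp
    exact pol_lt_two (hT p (by simpa using hp)).1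
  filter_upwards [this] with s hs r hr
  obtain ⟨p, hp, rfl⟩ := Multiset.mem_map.mp hr
  exact hs p (by simpa using hp)

lemma pol_ne_one (T : Multiset (ℂ × ℝ)) (hT : ∀ p ∈ T, ‖p.1‖ = 1 ∧ p.2 ≠ 0) {s : ℂ}
    (hs : s.re ≠ 0) : ∀ r ∈ T.map (pol s), ‖r‖ ≠ 1 := by
  intro r hr
  obtain ⟨p, hp, rfl⟩ := Multiset.mem_map.mp hr
  rw [norm_pol (hT p hp).1, Ne, Real.exp_eq_one_iff]
  exact mul_ne_zero (hT p hp).2 hs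

lemma residue_sum (m : ℕ) : ∀ (k : ℕ) (T : Multiset (ℂ × ℝ)), T.card = k →
    (∀ p ∈ T, ‖p.1‖ = 1 ∧ p.2 ≠ 0) →
    ∃ M : ℂ → ℂ, MeromorphicAt M 0 ∧ ∀ᶠ s in 𝓝 (0:ℂ),
      (s.re < 0 → cI 1 m (T.map (pol s)) = M s) ∧
      (0 < s.re → cI 1 m (T.map (pol s)) = cI 2 m (T.map (pol s)) - M s) := by
  intro k
  induction k with
  | zero =>
    intro T hc hT
    obtain rfl := Multiset.card_eq_zero.mp hc
    refine ⟨fun _ => 0, MeromorphicAt.const _ _, Eventually.of_forall fun s => ?_⟩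
    rw [cI_out one_pos m (by simp), cI_out two_pos m (by simp)]
    simp
  | succ k ih =>
    intro T hc hT
    have hlt := pol_all_lt_two T hT
    rcases multiset_dichotomy T with ⟨j, p, rfl⟩ | rfl | ⟨p, q, T', hpq, rfl⟩
    · simp at hc
      subst hc
      have hp := hT p (by simp)
      obtain ⟨V, hV⟩ := cI_replicate m (k + 1)
      rcases lt_or_gt_of_ne hp.2 with he | he
      · refine ⟨fun _ => 0, MeromorphicAt.const _ _, ?_⟩
        filter_upwards [hlt] with s hs
        simp only [Multiset.map_replicate] at hs ⊢
        constructor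
        · intro hre
          apply cI_out one_pos
          intro r hr
          rw [Multiset.eq_of_mem_replicate hr, norm_pol hp.1]
          exact Real.one_lt_exp_iff.mpr (by nlinarith)
        · intro hre
          rw [hV 1 _ one_pos, hV 2 _ two_pos]
          · simp
          · exact hs _ (by simp)
          · rw [norm_pol hp.1]
            exact Real.exp_lt_one_iff.mpr (by nlinarith)
      · refine ⟨fun s => V.eval (pol s p), ?_, ?_⟩
        · apply AnalyticAt.meromorphicAt
          exact AnalyticAt.aeval_polynomial (pol_analytic p 0) V
        filter_upwards [hlt] with s hs
        simp only [Multiset.map_replicate] at hs ⊢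
        constructor
        · intro hre
          rw [hV 1 _ one_pos]
          rw [norm_pol hp.1]
          exact Real.exp_lt_one_iff.mpr (by nlinarith)
        · intro hre
          rw [hV 2 _ two_pos, cI_out one_pos]
          · simp
          · intro r hr
            rw [Multiset.eq_of_mem_replicate hr, norm_pol hp.1]
            exact Real.one_lt_exp_iff.mpr (by nlinarith)
          · exact hs _ (by simp)
    · simp at hc
    · have hT0 := hT
      simp only [Multiset.mem_cons, forall_eq_or_imp] at hT
      obtain ⟨hp, hq, hT⟩ := hT
      simp at hc
      obtain ⟨M1, hM1, h1⟩ := ih (p ::ₘ T') (by simp; omega) (by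
        simp only [Multiset.mem_cons, forall_eq_or_imp]; exact ⟨hp, hT⟩)
      obtain ⟨M2, hM2, h2⟩ := ih (q ::ₘ T') (by simp; omega) (by
        simp only [Multiset.mem_cons, forall_eq_or_imp]; exact ⟨hq, hT⟩)
      refine ⟨fun s => (pol s p - pol s q)⁻¹ * (M1 s - M2 s), ?_, ?_⟩
      · exact (((pol_analytic p 0).meromorphicAt.sub (pol_analytic q 0).meromorphicAt).inv).mul
          (hM1.sub hM2)
      filter_upwards [hlt, h1, h2, pol_ne hp.1 hq.1 hpq] with s hs e1 e2 hne
      have hN1 : s.re ≠ 0 → _ := fun h => pol_ne_one _ hT0 h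
      simp only [Multiset.map_cons, Multiset.mem_cons, forall_eq_or_imp] at hs e1 e2 hN1 ⊢
      constructor
      · intro hre
        have hN := hN1 hre.ne
        rw [cI_split one_pos m hN.2.2 hN.1 hN.2.1 (hne hre.ne), e1.1 hre, e2.1 hre]
      · intro hre
        have hN := hN1 hre.ne'
        rw [cI_split one_pos m hN.2.2 hN.1 hN.2.1 (hne hre.ne'), e1.2 hre, e2.2 hre,
          cI_split two_pos m (fun r hr => (hs.2.2 r hr).ne) hs.1.ne hs.2.1.ne (hne hre.ne')]
        ring


noncomputable def molTarget {n : ℕ} (a : Fin n → ℕ) (x : ℂ) : ℂ :=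
  (1 - x) ^ (2 * n - 2) * ((1 - x ^ 2) *
          ((2 * Real.pi * Complex.I)⁻¹ *
            (∮ z in C(0, 1),
              1 / (z * ∏ j, ((1 - x * z ^ a j) * (1 - x * (z ^ a j)⁻¹))))))

noncomputable def polesOne (k : ℕ) : Multiset (ℂ × ℝ) :=
  (Polynomial.nthRootsFinset k (1:ℂ)).val.map (fun ζ => (ζ, (k:ℝ)⁻¹)) +
  (Polynomial.nthRootsFinset k (1:ℂ)).val.map (fun ζ => (ζ, -(k:ℝ)⁻¹))

noncomputable def polesAll {n : ℕ} (a : Fin n → ℕ) : Multiset (ℂ × ℝ) := ∑ j, polesOne (a j)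

lemma polesOne_spec {k : ℕ} (hk : 0 < k) : ∀ p ∈ polesOne k, ‖p.1‖ = 1 ∧ p.2 ≠ 0 := by
  have hk' : (k:ℝ)⁻¹ ≠ 0 := by positivity
  have key : ∀ ζ ∈ Polynomial.nthRootsFinset k (1:ℂ), ‖ζ‖ = 1 := by
    intro ζ hζ
    rw [Polynomial.mem_nthRootsFinset hk] at hζ
    exact Complex.norm_eq_one_of_pow_eq_one hζ hk.ne'
  intro p hp
  simp only [polesOne, Multiset.mem_add, Multiset.mem_map, Finset.mem_val] at hp
  rcases hp with ⟨ζ, h, rfl⟩ | ⟨ζ, h, rfl⟩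
  · exact ⟨key ζ h, hk'⟩
  · exact ⟨key ζ h, neg_ne_zero.mpr hk'⟩

lemma polesOne_card {k : ℕ} (hk : 0 < k) : (polesOne k).card = 2 * k := by
  have := (Complex.isPrimitiveRoot_exp k hk.ne').card_nthRootsFinset
  simp only [polesOne, Multiset.card_add, Multiset.card_map, Finset.card_val, this]
  ring

lemma polesOne_dnP {k : ℕ} (hk : 0 < k) (s z : ℂ) :
    dnP ((polesOne k).map (pol s)) z = (z ^ k - Complex.exp s) * (z ^ k - Complex.exp (-s)) := by
  have hprim := Complex.isPrimitiveRoot_exp k hk.ne'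
  have hk0 : (k:ℂ) ≠ 0 := by exact_mod_cast hk.ne'
  have e1 : Complex.exp s = Complex.exp ((k:ℂ)⁻¹ * s) ^ k := by
    rw [← Complex.exp_nat_mul]; congr 1; field_simp
  have e2 : Complex.exp (-s) = Complex.exp (-(k:ℂ)⁻¹ * s) ^ k := by
    rw [← Complex.exp_nat_mul]; congr 1; field_simp
  rw [e1, e2, hprim.pow_sub_pow_eq_prod_sub_mul _ _ hk, hprim.pow_sub_pow_eq_prod_sub_mul _ _ hk]
  simp only [polesOne, Multiset.map_add, dnP_add]
  congr 1
  · simp only [dnP, Multiset.map_map, Finset.prod]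
    congr 1
    apply Multiset.map_congr rfl
    intro ζ _
    simp [pol]
  · simp only [dnP, Multiset.map_map, Finset.prod]
    congr 1
    apply Multiset.map_congr rfl
    intro ζ _
    simp [pol]

lemma polesAll_dnP {n : ℕ} (a : Fin n → ℕ) (hpos : ∀ i, 0 < a i) (s z : ℂ) :
    dnP ((polesAll a).map (pol s)) z =
      ∏ j, ((z ^ a j - Complex.exp s) * (z ^ a j - Complex.exp (-s))) := by
  have : ∀ S : Finset (Fin n), dnP ((∑ j ∈ S, polesOne (a j)).map (pol s)) z =
      ∏ j ∈ S, ((z ^ a j - Complex.exp s) * (z ^ a j - Complex.exp (-s))) := by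
    intro S
    induction S using Finset.induction_on with
    | empty => simp [dnP]
    | insert j S hj ih =>
      rw [Finset.sum_insert hj, Finset.prod_insert hj, Multiset.map_add, dnP_add, ih,
        polesOne_dnP (hpos j)]
  exact this _

noncomputable def Jmol {n : ℕ} (a : Fin n → ℕ) (s : ℂ) : ℂ :=
  ∮ z in C(0, 1), z ^ (∑ j, a j - 1) /
      ∏ j, ((z ^ a j - Complex.exp s) * (z ^ a j - Complex.exp (-s)))

lemma Jmol_even {n : ℕ} (a : Fin n → ℕ) (s : ℂ) : Jmol a (-s) = Jmol a s := by
  unfold Jmol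
  congr 1
  funext z
  congr 1
  apply Finset.prod_congr rfl
  intro j _
  rw [neg_neg]; ring

lemma Jmol_germ {n : ℕ} (hn : 2 ≤ n) (a : Fin n → ℕ) (hpos : ∀ i, 0 < a i) :
    ∃ M : ℂ → ℂ, MeromorphicAt M 0 ∧ ∀ᶠ s in 𝓝 (0:ℂ),
      (s.re < 0 → M s = Jmol a s) ∧ (0 < s.re → M s = - Jmol a s) := by
  have hspec : ∀ p ∈ polesAll a, ‖p.1‖ = 1 ∧ p.2 ≠ 0 := by
    intro p hp
    unfold polesAll at hp
    obtain ⟨j, _, hj⟩ := Multiset.mem_sum.mp hp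
    exact polesOne_spec (hpos j) p hj
  have hA : 1 ≤ ∑ j, a j := by
    have := Finset.single_le_sum (f := a) (fun i _ => Nat.zero_le _) (Finset.mem_univ ⟨0, by omega⟩)
    have := hpos ⟨0, by omega⟩
    omega
  have hcard : (polesAll a).card = 2 * ∑ j, a j := by
    unfold polesAll
    rw [Multiset.card_sum, Finset.mul_sum]
    exact Finset.sum_congr rfl fun j _ => polesOne_card (hpos j)
  obtain ⟨M, hM, h⟩ := residue_sum (∑ j, a j - 1) _ (polesAll a) rfl hspec
  refine ⟨M, hM, ?_⟩
  have hJ : ∀ s, cI 1 (∑ j, a j - 1) ((polesAll a).map (pol s)) = Jmol a s := by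
    intro s
    unfold cI Jmol
    simp only [polesAll_dnP a hpos]
  filter_upwards [h, pol_all_lt_two _ hspec] with s hs hlt
  rw [hJ, cI_total two_pos _ _ hlt (by rw [Multiset.card_map, hcard]; omega)] at hs
  refine ⟨fun h => (hs.1 h).symm, fun h => ?_⟩
  rw [hs.2 h]; ring

lemma molTarget_eq {n : ℕ} (hn : 2 ≤ n) (a : Fin n → ℕ) (hpos : ∀ i, 0 < a i) (s : ℂ) :
    molTarget a (Complex.exp s) = (1 - Complex.exp s) ^ (2 * n - 2) * ((1 - Complex.exp s ^ 2) *
      ((2 * Real.pi * Complex.I)⁻¹ * (((-Complex.exp s) ^ n)⁻¹ * Jmol a s))) := by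
  have hA : 1 ≤ ∑ j, a j := by
    have := Finset.single_le_sum (f := a) (fun i _ => Nat.zero_le _) (Finset.mem_univ ⟨0, by omega⟩)
    have := hpos ⟨0, by omega⟩
    omega
  unfold molTarget Jmol
  congr 3
  rw [← circleIntegral.integral_const_mul]
  apply circleIntegral.integral_congr zero_le_one
  intro z hz
  have hz0 : z ≠ 0 := by
    rintro rfl
    simp at hz
  have hE : Complex.exp s ≠ 0 := Complex.exp_ne_zero s
  have h1 : ∀ j, (1 - Complex.exp s * z ^ a j) * (1 - Complex.exp s * (z ^ a j)⁻¹) =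
      (-Complex.exp s) * (z ^ a j)⁻¹ *
        ((z ^ a j - Complex.exp s) * (z ^ a j - Complex.exp (-s))) := by
    intro j
    have : z ^ a j ≠ 0 := pow_ne_zero _ hz0
    rw [Complex.exp_neg]
    field_simp
    ring
  simp only [h1]
  rw [Finset.prod_mul_distrib, Finset.prod_mul_distrib, Finset.prod_const, Finset.card_univ,
    Fintype.card_fin, Finset.prod_inv_distrib, Finset.prod_pow_eq_pow_sum]
  obtain ⟨A, hA'⟩ : ∃ A, ∑ j, a j = A + 1 := ⟨_, (Nat.sub_add_cancel hA).symm⟩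
  rw [hA', Nat.add_sub_cancel]
  generalize (∏ j, ((z ^ a j - Complex.exp s) * (z ^ a j - Complex.exp (-s)))) = D
  by_cases hD : D = 0
  · simp [hD]
  have : (-Complex.exp s) ^ n ≠ 0 := pow_ne_zero _ (neg_ne_zero.mpr hE)
  field_simp
  ring

lemma target_germ {n : ℕ} (hn : 2 ≤ n) (a : Fin n → ℕ) (hpos : ∀ i, 0 < a i) :
    ∃ H : ℂ → ℂ, MeromorphicAt H 0 ∧ ∀ᶠ s in 𝓝 (0:ℂ),
      (s.re < 0 → H s = molTarget a (Complex.exp s)) ∧ (0 < s.re → H (-s) = H s) := by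
  obtain ⟨M, hM, h⟩ := Jmol_germ hn a hpos
  refine ⟨fun s => (1 - Complex.exp s) ^ (2 * n - 2) * ((1 - Complex.exp s ^ 2) *
      ((2 * Real.pi * Complex.I)⁻¹ * (((-Complex.exp s) ^ n)⁻¹ * M s))), ?_, ?_⟩
  · have h1 : AnalyticAt ℂ (fun s => (1 - Complex.exp s) ^ (2 * n - 2)) 0 := by fun_prop
    have h2 : AnalyticAt ℂ (fun s => (1 - Complex.exp s ^ 2)) 0 := by fun_prop
    have h3 : AnalyticAt ℂ (fun s => (-Complex.exp s) ^ n) 0 := by fun_prop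
    exact h1.meromorphicAt.mul (h2.meromorphicAt.mul ((MeromorphicAt.const _ _).mul
      (h3.meromorphicAt.inv.mul hM)))
  · have hneg : Tendsto (fun s : ℂ => -s) (𝓝 0) (𝓝 0) := by
      have := (continuous_neg (G := ℂ)).tendsto 0
      simpa using this
    filter_upwards [h, hneg.eventually h] with s hs hs'
    constructor
    · intro hre
      rw [molTarget_eq hn a hpos, hs.1 hre]
    · intro hre
      have e1 := hs.2 hre
      have e2 := hs'.1 (by simpa using hre)
      rw [Jmol_even] at e2
      rw [e1, e2, Complex.exp_neg]
      have hE : Complex.exp s ≠ 0 := Complex.exp_ne_zero s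
      generalize Complex.exp s = E at *
      obtain ⟨k, rfl⟩ : ∃ k, n = k + 1 := ⟨n - 1, by omega⟩
      have a1 : (1 - E⁻¹) ^ (2 * (k + 1) - 2) = (E ^ (2 * k))⁻¹ * (1 - E) ^ (2 * (k + 1) - 2) := by
        have : 2 * (k + 1) - 2 = 2 * k := by omega
        rw [this, pow_mul, pow_mul, pow_mul, ← inv_pow, ← mul_pow]
        congr 1
        field_simp
        ring
      have a2 : (-E⁻¹) ^ (k + 1) = (E ^ (2 * (k+1)))⁻¹ * (-E) ^ (k+1) := by
        rw [pow_mul, ← inv_pow, ← mul_pow]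
        congr 1
        field_simp
      have a3 : 1 - E⁻¹ ^ 2 = - (E ^ 2)⁻¹ * (1 - E ^ 2) := by
        field_simp
        ring
      rw [a1, a2, a3]
      have : (-E) ^ (k+1) ≠ 0 := pow_ne_zero _ (neg_ne_zero.mpr hE)
      generalize (-E) ^ (k+1) = W at *
      generalize (1 - E) ^ (2 * (k + 1) - 2) = U
      have hpi : (Real.pi : ℂ) ≠ 0 := by exact_mod_cast Real.pi_ne_zero
      field_simp
      ring


noncomputable def hR {n : ℕ} (a : Fin n → ℕ) (t : ℝ) : ℝ := (∏ i, (1 + ((a i : ℝ) * t) ^ 2))⁻¹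

noncomputable def kR {n : ℕ} (a : Fin n → ℕ) (q : ℝ) : ℝ :=
  q ^ (2 * n - 1) * ∫ θ in (-Real.pi)..Real.pi,
    (∏ i, (q ^ 2 + 4 * Real.sin ((a i : ℝ) * θ / 2) ^ 2))⁻¹

noncomputable def GR {n : ℕ} (a : Fin n → ℕ) : ℝ := ∫ t, hR a t

section
variable {n : ℕ} (a : Fin n → ℕ)

lemma hR_pos (t : ℝ) : 0 < hR a t := by
  unfold hR
  have : 0 < ∏ i, (1 + ((a i : ℝ) * t) ^ 2) := Finset.prod_pos fun i _ => by positivity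
  positivity

lemma hR_cont : Continuous (hR a) := by
  unfold hR
  apply Continuous.inv₀
  · fun_prop
  · intro t
    have : 0 < ∏ i, (1 + ((a i : ℝ) * t) ^ 2) := Finset.prod_pos fun i _ => by positivity
    exact this.ne'

lemma hR_le (hn : 2 ≤ n) (hpos : ∀ i, 0 < a i) (t : ℝ) : hR a t ≤ (1 + t ^ 2)⁻¹ := by
  unfold hR
  apply inv_anti₀ (by positivity)
  have h1 : ∀ i, 1 + t ^ 2 ≤ 1 + ((a i : ℝ) * t) ^ 2 := by
    intro i
    have : (1:ℝ) ≤ a i := by exact_mod_cast hpos i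
    have : (1:ℝ) ≤ (a i : ℝ) ^ 2 := by nlinarith
    rw [mul_pow]
    nlinarith [sq_nonneg t]
  calc 1 + t ^ 2 ≤ (1 + t ^ 2) ^ n := by
        apply le_self_pow₀ (by nlinarith [sq_nonneg t]) (by omega)
    _ = ∏ i : Fin n, (1 + t ^ 2) := by simp
    _ ≤ _ := Finset.prod_le_prod (fun i _ => by positivity) (fun i _ => h1 i)

lemma hR_int (hn : 2 ≤ n) (hpos : ∀ i, 0 < a i) : MeasureTheory.Integrable (hR a) := by
  apply integrable_inv_one_add_sq.mono' (hR_cont a).aestronglyMeasurable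
  refine Eventually.of_forall fun t => ?_
  rw [Real.norm_of_nonneg (hR_pos a t).le]
  exact hR_le a hn hpos t

lemma GR_pos (hn : 2 ≤ n) (hpos : ∀ i, 0 < a i) : 0 < GR a := by
  unfold GR
  rw [MeasureTheory.integral_pos_iff_support_of_nonneg (fun t => (hR_pos a t).le) (hR_int a hn hpos)]
  have : Function.support (hR a) = Set.univ := by
    ext t; simp [(hR_pos a t).ne']
  rw [this]; simp

lemma scaled_eq {b q : ℝ} (hq : 0 < q) (θ : ℝ) :
    (∏ i, (q ^ 2 + (b * ((a i : ℝ) * θ)) ^ 2))⁻¹ = (q ^ (2 * n))⁻¹ * hR a (b / q * θ) := by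
  unfold hR
  rw [← mul_inv]
  congr 1
  have : q ^ (2 * n) = ∏ i : Fin n, q ^ 2 := by simp [pow_mul]
  rw [this, ← Finset.prod_mul_distrib]
  apply Finset.prod_congr rfl
  intro i _
  field_simp

lemma scaled_int (hn : 2 ≤ n) (hpos : ∀ i, 0 < a i) {b q : ℝ} (hb : 0 < b) (hq : 0 < q) :
    MeasureTheory.Integrable (fun θ : ℝ => (∏ i, (q ^ 2 + (b * ((a i : ℝ) * θ)) ^ 2))⁻¹) := by
  simp only [scaled_eq a hq]
  exact ((hR_int a hn hpos).comp_mul_left' (by positivity)).const_mul _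

lemma scaled_integral (hn : 2 ≤ n) {b q : ℝ} (hb : 0 < b) (hq : 0 < q) :
    q ^ (2 * n - 1) * ∫ θ : ℝ, (∏ i, (q ^ 2 + (b * ((a i : ℝ) * θ)) ^ 2))⁻¹ = GR a / b := by
  simp only [scaled_eq a hq]
  rw [MeasureTheory.integral_const_mul, MeasureTheory.Measure.integral_comp_mul_left]
  rw [abs_of_pos (by positivity)]
  unfold GR
  obtain ⟨k, hk⟩ : ∃ k, 2 * n = k + 1 := ⟨2 * n - 1, by omega⟩
  rw [hk, Nat.add_sub_cancel]
  simp only [smul_eq_mul]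
  field_simp
  ring

lemma int_cont {q : ℝ} (hq : 0 < q) :
    Continuous fun θ : ℝ => (∏ i, (q ^ 2 + 4 * Real.sin ((a i : ℝ) * θ / 2) ^ 2))⁻¹ := by
  apply Continuous.inv₀
  · fun_prop
  · intro t
    have : 0 < ∏ i, (q ^ 2 + 4 * Real.sin ((a i : ℝ) * t / 2) ^ 2) :=
      Finset.prod_pos fun i _ => by positivity
    exact this.ne'

lemma kR_lower (hn : 2 ≤ n) (hpos : ∀ i, 0 < a i) {q : ℝ} (hq : 0 < q) (hq1 : q ≤ 1) :
    GR a - 2 ^ n * Real.pi * q ^ 3 ≤ kR a q := by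
  have hG := scaled_integral a hn one_pos hq
  have hI := scaled_int a hn hpos one_pos hq
  simp only [one_mul, div_one] at hG hI
  set f : ℝ → ℝ := fun θ => (∏ i, (q ^ 2 + ((a i : ℝ) * θ) ^ 2))⁻¹ with hf
  set S : Set ℝ := Set.Ioc (-Real.pi) Real.pi with hS
  have hpi := Real.pi_pos
  have hsplit : ∫ θ in S, f θ + 0 = ∫ θ in S, f θ := by simp
  have hadd := MeasureTheory.integral_add_compl (s := S) (f := f) measurableSet_Ioc hI
  have hcompl : ∫ θ in Sᶜ, f θ ≤ 2 ^ n * Real.pi := by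
    calc ∫ θ in Sᶜ, f θ ≤ ∫ θ in Sᶜ, 2 ^ n * (1 + θ ^ 2)⁻¹ := by
          apply MeasureTheory.setIntegral_mono_on hI.integrableOn
            (integrable_inv_one_add_sq.const_mul _).integrableOn measurableSet_Ioc.compl
          intro θ hθ
          have h1 : 1 ≤ θ ^ 2 := by
            by_contra hc
            push Not at hc
            have : |θ| < 1 := by
              rw [← sq_lt_one_iff_abs_lt_one]; exact hc
            rw [abs_lt] at this
            apply hθ
            have := Real.pi_gt_three
            constructor <;> linarith
          have h2 : ∀ i, (1 + θ ^ 2) / 2 ≤ q ^ 2 + ((a i : ℝ) * θ) ^ 2 := by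
            intro i
            have : (1:ℝ) ≤ a i := by exact_mod_cast hpos i
            have : (1:ℝ) ≤ (a i : ℝ) ^ 2 := by nlinarith
            rw [mul_pow]
            nlinarith [sq_nonneg q]
          have h3 : (1 + θ ^ 2) / 2 ^ n ≤ ∏ i, (q ^ 2 + ((a i : ℝ) * θ) ^ 2) := by
            calc (1 + θ ^ 2) / 2 ^ n ≤ (1 + θ ^ 2) ^ n / 2 ^ n := by
                  gcongr
                  apply le_self_pow₀ (by nlinarith [sq_nonneg θ]) (by omega)
              _ = ∏ i : Fin n, ((1 + θ ^ 2) / 2) := by simp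
              _ ≤ _ := Finset.prod_le_prod (fun i _ => by positivity) (fun i _ => h2 i)
          calc f θ ≤ ((1 + θ ^ 2) / 2 ^ n)⁻¹ := inv_anti₀ (by positivity) h3
            _ = _ := by field_simp
      _ ≤ ∫ θ, 2 ^ n * (1 + θ ^ 2)⁻¹ := by
          apply MeasureTheory.setIntegral_le_integral (integrable_inv_one_add_sq.const_mul _)
          exact Eventually.of_forall fun θ => by positivity
      _ = 2 ^ n * Real.pi := by
          rw [MeasureTheory.integral_const_mul, integral_univ_inv_one_add_sq]
  have hle : ∫ θ in S, f θ ≤ ∫ θ in (-Real.pi)..Real.pi,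
    (∏ i, (q ^ 2 + 4 * Real.sin ((a i : ℝ) * θ / 2) ^ 2))⁻¹ := by
    rw [intervalIntegral.integral_of_le (by linarith)]
    apply MeasureTheory.setIntegral_mono_on hI.integrableOn _ measurableSet_Ioc
    · intro θ _
      apply inv_anti₀ (Finset.prod_pos fun i _ => by positivity)
      apply Finset.prod_le_prod (fun i _ => by positivity)
      intro i _
      have : Real.sin ((a i : ℝ) * θ / 2) ^ 2 ≤ ((a i : ℝ) * θ / 2) ^ 2 := by
        rw [sq_le_sq]; exact Real.abs_sin_le_abs
      nlinarith
    · exact ((int_cont a hq).intervalIntegrable _ _).1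
  have hqp : 0 ≤ q ^ (2 * n - 1) := by positivity
  have hq3 : q ^ (2 * n - 1) ≤ q ^ 3 := pow_le_pow_of_le_one hq.le hq1 (by omega)
  have e1 : GR a = q ^ (2 * n - 1) * (∫ θ in S, f θ) + q ^ (2 * n - 1) * ∫ θ in Sᶜ, f θ := by
    rw [← hG, ← hadd]; ring
  have e2 : q ^ (2 * n - 1) * ∫ θ in Sᶜ, f θ ≤ 2 ^ n * Real.pi * q ^ 3 := by
    calc q ^ (2 * n - 1) * ∫ θ in Sᶜ, f θ ≤ q ^ (2 * n - 1) * (2 ^ n * Real.pi) := by gcongr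
      _ ≤ q ^ 3 * (2 ^ n * Real.pi) := by gcongr
      _ = _ := by ring
  have e3 : q ^ (2 * n - 1) * (∫ θ in S, f θ) ≤ kR a q := by
    unfold kR
    gcongr
  linarith

lemma zero_of_sin (hgcd : Finset.univ.gcd a = 1) {θ : ℝ} (h1 : -Real.pi ≤ θ) (h2 : θ ≤ Real.pi)
    (h : ∀ i, Real.sin ((a i : ℝ) * θ / 2) = 0) : θ = 0 := by
  have hz : (θ : Real.Angle) = 0 := by
    have hd : ∀ i ∈ Finset.univ, addOrderOf (θ : Real.Angle) ∣ a i := by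
      intro i _
      rw [addOrderOf_dvd_iff_nsmul_eq_zero]
      obtain ⟨k, hk⟩ := Real.sin_eq_zero_iff.mp (h i)
      rw [← Real.Angle.natCast_mul_eq_nsmul, ← Real.Angle.coe_zero,
        Real.Angle.angle_eq_iff_two_pi_dvd_sub]
      exact ⟨k, by linarith⟩
    have := Finset.dvd_gcd hd
    rw [hgcd, Nat.dvd_one, AddMonoid.addOrderOf_eq_one_iff] at this
    exact this
  rw [← Real.Angle.coe_zero, Real.Angle.angle_eq_iff_two_pi_dvd_sub] at hz
  obtain ⟨k, hk⟩ := hz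
  have hpi := Real.pi_pos
  have hk1 : (k:ℝ) < 1 := by nlinarith
  have hk2 : (-1:ℝ) < k := by nlinarith
  have : k = 0 := by
    have a1 : k < 1 := by exact_mod_cast hk1
    have a2 : -1 < k := by exact_mod_cast hk2
    omega
  subst this
  simpa using hk

lemma away_bound (hn : 2 ≤ n) (hgcd : Finset.univ.gcd a = 1) {ε : ℝ} (hε : 0 < ε) :
    ∃ c > 0, ∀ θ ∈ Set.Icc (-Real.pi) Real.pi, ε ≤ |θ| → ∀ q : ℝ, 0 < q →
      c * (q ^ 2) ^ (n - 1) ≤ ∏ i, (q ^ 2 + 4 * Real.sin ((a i : ℝ) * θ / 2) ^ 2) := by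
  have hK : IsCompact (Set.Icc (-Real.pi) Real.pi ∩ {θ : ℝ | ε ≤ |θ|}) :=
    isCompact_Icc.inter_right (isClosed_le continuous_const continuous_abs)
  have hcont : Continuous fun θ : ℝ => ∑ i, 4 * Real.sin ((a i : ℝ) * θ / 2) ^ 2 := by fun_prop
  obtain ⟨c, hc, hmin⟩ := hK.exists_forall_le' hcont.continuousOn (a := 0) (by
    rintro θ ⟨⟨h1, h2⟩, h3⟩
    have hnn : 0 ≤ ∑ i, 4 * Real.sin ((a i : ℝ) * θ / 2) ^ 2 :=
      Finset.sum_nonneg fun i _ => by positivity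
    refine lt_of_le_of_ne hnn fun h0 => ?_
    have h0' := (Finset.sum_eq_zero_iff_of_nonneg (fun i _ => by positivity)).mp h0.symm
    have : θ = 0 := zero_of_sin a hgcd h1 h2 fun i => by
      have := h0' i (Finset.mem_univ i)
      simpa using this
    rw [this] at h3
    simp at h3
    linarith)
  have hnpos : (0:ℝ) < n := by exact_mod_cast (by omega : 0 < n)
  refine ⟨c / n, by positivity, fun θ hθ hε' q hq => ?_⟩
  have hsum := hmin θ ⟨hθ, hε'⟩
  have : ∑ i : Fin n, c / n ≤ ∑ i, 4 * Real.sin ((a i : ℝ) * θ / 2) ^ 2 := by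
    rw [Finset.sum_const, Finset.card_univ, Fintype.card_fin, nsmul_eq_mul]
    rw [mul_div_cancel₀ _ hnpos.ne']
    exact hsum
  have hne : (Finset.univ : Finset (Fin n)).Nonempty := ⟨⟨0, by omega⟩, Finset.mem_univ _⟩
  obtain ⟨i, _, hi⟩ := Finset.exists_le_of_sum_le hne this
  rw [← Finset.mul_prod_erase _ _ (Finset.mem_univ i)]
  have hcard : (Finset.univ.erase i).card = n - 1 := by
    rw [Finset.card_erase_of_mem (Finset.mem_univ i)]; simp
  have hp : (q ^ 2) ^ (n - 1) ≤ ∏ x ∈ Finset.univ.erase i,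
      (q ^ 2 + 4 * Real.sin ((a x : ℝ) * θ / 2) ^ 2) := by
    rw [← hcard, ← Finset.prod_const]
    apply Finset.prod_le_prod (fun i _ => by positivity)
    intro j _
    nlinarith [sq_nonneg (Real.sin ((a j : ℝ) * θ / 2))]
  apply mul_le_mul _ hp (by positivity) (by positivity)
  nlinarith

lemma near_bound {η : ℝ} (hη : 0 < η) (hη1 : η < 1) : ∃ ε > 0, ∀ θ : ℝ, |θ| ≤ ε → ∀ i,
    ((1 - η) * ((a i : ℝ) * θ)) ^ 2 ≤ 4 * Real.sin ((a i : ℝ) * θ / 2) ^ 2 := by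
  have key : ∀ y : ℝ, |y| ≤ η → ((1 - η) * y) ^ 2 ≤ Real.sin y ^ 2 := by
    have pos : ∀ y : ℝ, 0 < y → y ≤ η → ((1 - η) * y) ^ 2 ≤ Real.sin y ^ 2 := by
      intro y hy hyη
      have := Real.sin_gt_sub_cube hy
      have h2 : (1 - η) * y ≤ Real.sin y := by
        have : y ^ 2 ≤ η := by nlinarith
        nlinarith
      have h3 : 0 ≤ (1 - η) * y := by
        apply mul_nonneg <;> linarith
      nlinarith
    intro y hy
    rcases lt_trichotomy y 0 with h | h | h
    · have := pos (-y) (by linarith) (by rw [abs_of_neg h] at hy; exact hy)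
      simpa using this
    · simp [h]
    · exact pos y h (by rw [abs_of_pos h] at hy; exact hy)
  have hA : (0:ℝ) < 1 + ∑ i, (a i : ℝ) := by positivity
  refine ⟨η / (1 + ∑ i, (a i : ℝ)), by positivity, fun θ hθ i => ?_⟩
  have hai : (a i : ℝ) ≤ 1 + ∑ i, (a i : ℝ) := by
    have := Finset.single_le_sum (f := fun i => (a i : ℝ)) (fun i _ => by positivity)
      (Finset.mem_univ i)
    linarith
  have := key ((a i : ℝ) * θ / 2) (by
    rw [abs_div, abs_mul, abs_of_nonneg (by positivity : (0:ℝ) ≤ a i)]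
    rw [le_div_iff₀ hA] at hθ
    have : (a i : ℝ) * |θ| ≤ η := by
      nlinarith [abs_nonneg θ]
    rw [abs_of_pos (by norm_num : (0:ℝ) < 2)]
    linarith)
  nlinarith

lemma kR_upper (hn : 2 ≤ n) (hpos : ∀ i, 0 < a i) (hgcd : Finset.univ.gcd a = 1)
    {η : ℝ} (hη : 0 < η) (hη1 : η < 1) :
    ∃ C, ∀ q : ℝ, 0 < q → kR a q ≤ GR a / (1 - η) + C * q := by
  obtain ⟨ε, hε, hnear⟩ := near_bound a hη hη1
  obtain ⟨c, hc, haway⟩ := away_bound a hn hgcd hε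
  refine ⟨2 * Real.pi * c⁻¹, fun q hq => ?_⟩
  have hb : 0 < 1 - η := by linarith
  have hI := scaled_int a hn hpos hb hq
  have hG := scaled_integral a hn hb hq
  set f : ℝ → ℝ := fun θ => (∏ i, (q ^ 2 + ((1 - η) * ((a i : ℝ) * θ)) ^ 2))⁻¹ with hf
  have hf0 : ∀ θ, 0 ≤ f θ := fun θ => inv_nonneg.mpr (Finset.prod_nonneg fun i _ => by positivity)
  have hpi := Real.pi_pos
  have hle : ∫ θ in (-Real.pi)..Real.pi,
      (∏ i, (q ^ 2 + 4 * Real.sin ((a i : ℝ) * θ / 2) ^ 2))⁻¹ ≤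
      ∫ θ in (-Real.pi)..Real.pi, (f θ + (c * (q ^ 2) ^ (n - 1))⁻¹) := by
    apply intervalIntegral.integral_mono_on (by linarith)
    · exact (int_cont a hq).intervalIntegrable _ _
    · exact (hI.intervalIntegrable).add intervalIntegrable_const
    · intro θ hθ
      rcases le_total ε |θ| with h | h
      · have := inv_anti₀ (by positivity) (haway θ hθ h q hq)
        linarith [hf0 θ]
      · have h1 : (∏ i, (q ^ 2 + 4 * Real.sin ((a i : ℝ) * θ / 2) ^ 2))⁻¹ ≤ f θ := by
          apply inv_anti₀ (Finset.prod_pos fun i _ => by positivity)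
          apply Finset.prod_le_prod (fun i _ => by positivity)
          intro i _
          linarith [hnear θ h i]
        have : 0 < (c * (q ^ 2) ^ (n - 1))⁻¹ := by positivity
        linarith
  have hle2 : ∫ θ in (-Real.pi)..Real.pi, (f θ + (c * (q ^ 2) ^ (n - 1))⁻¹) ≤
      (∫ θ, f θ) + 2 * Real.pi * (c * (q ^ 2) ^ (n - 1))⁻¹ := by
    rw [intervalIntegral.integral_add hI.intervalIntegrable intervalIntegrable_const,
      intervalIntegral.integral_const, intervalIntegral.integral_of_le (by linarith)]
    have := MeasureTheory.setIntegral_le_integral (s := Set.Ioc (-Real.pi) Real.pi) hI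
      (Eventually.of_forall hf0)
    simp only [smul_eq_mul]
    linarith
  have hq2 : q ^ (2 * n - 1) * (c * (q ^ 2) ^ (n - 1))⁻¹ = c⁻¹ * q := by
    obtain ⟨k, rfl⟩ : ∃ k, n = k + 1 := ⟨n - 1, by omega⟩
    have : 2 * (k + 1) - 1 = 2 * k + 1 := by omega
    rw [this, Nat.add_sub_cancel, ← pow_mul]
    field_simp
    ring
  calc kR a q ≤ q ^ (2 * n - 1) * ((∫ θ, f θ) + 2 * Real.pi * (c * (q ^ 2) ^ (n - 1))⁻¹) := by
        unfold kR
        gcongr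
        exact hle.trans hle2
    _ = q ^ (2 * n - 1) * (∫ θ, f θ) +
        2 * Real.pi * (q ^ (2 * n - 1) * (c * (q ^ 2) ^ (n - 1))⁻¹) := by ring
    _ = _ := by rw [hG, hq2]; ring

lemma kR_tendsto (hn : 2 ≤ n) (hpos : ∀ i, 0 < a i) (hgcd : Finset.univ.gcd a = 1) :
    Tendsto (kR a) (𝓝[>] 0) (𝓝 (GR a)) := by
  have hid : Tendsto (fun q : ℝ => q) (𝓝[>] 0) (𝓝 0) := tendsto_nhdsWithin_of_tendsto_nhds tendsto_id
  rw [tendsto_order]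
  constructor
  · intro b hb
    have h1 : Tendsto (fun q : ℝ => GR a - 2 ^ n * Real.pi * q ^ 3) (𝓝[>] 0) (𝓝 (GR a)) := by
      have := ((hid.pow 3).const_mul (2 ^ n * Real.pi)).const_sub (GR a)
      simpa using this
    filter_upwards [h1.eventually_const_lt hb, self_mem_nhdsWithin,
      hid.eventually_lt_const one_pos] with q h2 h3 h4
    exact h2.trans_le (kR_lower a hn hpos h3 h4.le)
  · intro b hb
    have hlim : Tendsto (fun η : ℝ => GR a / (1 - η)) (𝓝[>] 0) (𝓝 (GR a)) := by
      have h0 : Tendsto (fun η : ℝ => 1 - η) (𝓝[>] 0) (𝓝 (1 - 0)) := hid.const_sub 1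
      have h1 : Tendsto (fun η : ℝ => GR a / (1 - η)) (𝓝[>] 0) (𝓝 (GR a / (1 - 0))) :=
        Tendsto.div tendsto_const_nhds h0 (by norm_num)
      simpa using h1
    have hmem : ∀ᶠ η : ℝ in 𝓝[>] 0, 0 < η := self_mem_nhdsWithin
    obtain ⟨η, h1, h2, h3⟩ := ((hlim.eventually_lt_const hb).and
      (hmem.and (hid.eventually_lt_const one_pos))).exists
    obtain ⟨C, hC⟩ := kR_upper a hn hpos hgcd h2 h3
    have h4 : Tendsto (fun q : ℝ => GR a / (1 - η) + C * q) (𝓝[>] 0) (𝓝 (GR a / (1 - η))) := by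
      have := (hid.const_mul C).const_add (GR a / (1 - η))
      simpa using this
    filter_upwards [h4.eventually_lt_const h1, self_mem_nhdsWithin] with q h5 h6
    exact (hC q h6).trans_lt h5
end


lemma factor_real (x c θ : ℝ) (k : ℕ) (hx : x * c = (1 - x) ^ 2) :
    ((1 - (x:ℂ) * (circleMap 0 1 θ) ^ k) * (1 - (x:ℂ) * ((circleMap 0 1 θ) ^ k)⁻¹)) =
      ((x * (c + 4 * Real.sin ((k : ℝ) * θ / 2) ^ 2) : ℝ) : ℂ) := by
  have h1 : (circleMap 0 1 θ) ^ k = Complex.exp (((k * θ : ℝ) : ℂ) * Complex.I) := by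
    simp only [circleMap, zero_add, Complex.ofReal_one, one_mul]
    rw [← Complex.exp_nat_mul]
    congr 1
    push_cast
    ring
  have h2 : 4 * Real.sin ((k : ℝ) * θ / 2) ^ 2 = 2 - 2 * Real.cos (k * θ) := by
    have := Real.cos_two_mul ((k : ℝ) * θ / 2)
    rw [mul_div_cancel₀ _ (by norm_num : (2:ℝ) ≠ 0)] at this
    have := Real.sin_sq_add_cos_sq ((k : ℝ) * θ / 2)
    linarith
  rw [h2, h1, ← Complex.exp_neg]
  have h3 : Complex.exp (((k * θ : ℝ) : ℂ) * Complex.I) *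
      Complex.exp (-(((k * θ : ℝ) : ℂ) * Complex.I)) = 1 := by
    rw [← Complex.exp_add]; simp
  have h4 : Complex.exp (((k * θ : ℝ) : ℂ) * Complex.I) +
      Complex.exp (-(((k * θ : ℝ) : ℂ) * Complex.I)) = 2 * ((Real.cos (k * θ) : ℝ) : ℂ) := by
    rw [Complex.ofReal_cos, Complex.two_cos]
    congr 2
    ring
  have hx' : (x:ℂ) * c = (1 - x) ^ 2 := by exact_mod_cast hx
  push_cast at *
  linear_combination (x:ℂ)^2 * h3 - (x:ℂ) * h4 - hx'

lemma molien_real {n : ℕ} (a : Fin n → ℕ) (x c : ℝ) (hx : x * c = (1 - x) ^ 2) :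
    (∮ z in C(0, 1),
      1 / (z * ∏ j, ((1 - (x:ℂ) * z ^ a j) * (1 - (x:ℂ) * (z ^ a j)⁻¹)))) =
    Complex.I * (((x ^ n)⁻¹ * ∫ θ in (-Real.pi)..Real.pi,
      (∏ i, (c + 4 * Real.sin ((a i : ℝ) * θ / 2) ^ 2))⁻¹ : ℝ) : ℂ) := by
  have hper : Function.Periodic (fun θ : ℝ =>
      (∏ i, (c + 4 * Real.sin ((a i : ℝ) * θ / 2) ^ 2))⁻¹) (2 * Real.pi) := by
    intro θ
    simp only
    congr 1
    apply Finset.prod_congr rfl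
    intro i _
    have : (a i : ℝ) * (θ + 2 * Real.pi) / 2 = (a i : ℝ) * θ / 2 + (a i) * Real.pi := by ring
    rw [this, Real.sin_add_nat_mul_pi, mul_pow, ← pow_mul, mul_comm (a i) 2, pow_mul]
    simp
  have hI := hper.intervalIntegral_add_eq (-Real.pi) 0
  have e : -Real.pi + 2 * Real.pi = Real.pi := by ring
  rw [e, zero_add] at hI
  rw [hI, ← intervalIntegral.integral_const_mul, ← intervalIntegral.integral_ofReal,
    ← intervalIntegral.integral_const_mul]
  unfold circleIntegral
  apply intervalIntegral.integral_congr
  intro θ _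
  simp only [factor_real x c θ _ hx, deriv_circleMap, smul_eq_mul]
  rw [← Complex.ofReal_prod, Finset.prod_mul_distrib, Finset.prod_const, Finset.card_univ,
    Fintype.card_fin]
  have hz : circleMap 0 1 θ ≠ 0 := circleMap_ne_center one_ne_zero
  rw [Complex.ofReal_mul, Complex.ofReal_mul, Complex.ofReal_inv, Complex.ofReal_inv, one_div,
    mul_inv, mul_inv]
  generalize (∏ i, (c + 4 * Real.sin ((a i : ℝ) * θ / 2) ^ 2)) = D
  field_simp

lemma molTarget_real {n : ℕ} (hn : 2 ≤ n) (a : Fin n → ℕ) (σ : ℝ) :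
    molTarget a (Complex.exp ((-σ : ℝ) : ℂ)) =
      ((Real.cosh (σ / 2) / Real.pi * kR a (2 * Real.sinh (σ / 2)) : ℝ) : ℂ) := by
  rw [← Complex.ofReal_exp]
  set y := Real.exp (-(σ / 2)) with hy
  have hy0 : y ≠ 0 := (Real.exp_pos _).ne'
  have hx : Real.exp (-σ) = y ^ 2 := by
    rw [hy, ← Real.exp_nat_mul]; congr 1; push_cast; ring
  have hyi : Real.exp (σ / 2) = y⁻¹ := by rw [hy, Real.exp_neg, inv_inv]
  have hs : 2 * Real.sinh (σ / 2) = y⁻¹ - y := by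
    rw [Real.sinh_eq, hyi, ← hy]; ring
  have hc : Real.cosh (σ / 2) = (y⁻¹ + y) / 2 := by
    rw [Real.cosh_eq, hyi, ← hy]
  unfold molTarget kR
  rw [hx, hs, hc]
  rw [molien_real a (y ^ 2) ((y⁻¹ - y) ^ 2) (by field_simp)]
  generalize (∫ θ in (-Real.pi)..Real.pi,
      (∏ i, ((y⁻¹ - y) ^ 2 + 4 * Real.sin ((a i : ℝ) * θ / 2) ^ 2))⁻¹) = W
  have hpi : (Real.pi : ℂ) ≠ 0 := by exact_mod_cast Real.pi_ne_zero
  have key : (1 - y ^ 2) ^ (2 * n - 2) * ((1 - (y ^ 2) ^ 2) * ((2 * Real.pi)⁻¹ *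
      (((y ^ 2) ^ n)⁻¹ * W))) =
      (y⁻¹ + y) / 2 / Real.pi * ((y⁻¹ - y) ^ (2 * n - 1) * W) := by
    obtain ⟨k, rfl⟩ : ∃ k, n = k + 1 := ⟨n - 1, by omega⟩
    have e1 : 2 * (k + 1) - 2 = 2 * k := by omega
    have e2 : 2 * (k + 1) - 1 = 2 * k + 1 := by omega
    have e3 : 1 - y ^ 2 = y * (y⁻¹ - y) := by field_simp
    have e4 : 1 - (y ^ 2) ^ 2 = y ^ 2 * (y⁻¹ - y) * (y⁻¹ + y) := by field_simp; ring
    rw [e1, e2, e3, e4, mul_pow, ← pow_mul]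
    generalize y⁻¹ - y = q
    generalize y⁻¹ + y = r
    have := Real.pi_ne_zero
    field_simp
    ring
  rw [← key]
  push_cast
  field_simp

lemma q_tendsto : Tendsto (fun σ : ℝ => 2 * Real.sinh (σ / 2)) (𝓝[>] 0) (𝓝[>] 0) := by
  apply tendsto_nhdsWithin_of_tendsto_nhds_of_eventually_within
  · have : Continuous fun σ : ℝ => 2 * Real.sinh (σ / 2) := by fun_prop
    have := this.tendsto 0
    simp at this
    exact tendsto_nhdsWithin_of_tendsto_nhds this
  · filter_upwards [self_mem_nhdsWithin] with σ hσ
    have : 0 < σ := hσ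
    have : 0 < Real.sinh (σ / 2) := Real.sinh_pos_iff.mpr (by linarith)
    simpa using this

lemma cosh_tendsto : Tendsto (fun σ : ℝ => Real.cosh (σ / 2)) (𝓝[>] 0) (𝓝 1) := by
  have : Continuous fun σ : ℝ => Real.cosh (σ / 2) := by fun_prop
  have := this.tendsto 0
  simp at this
  exact tendsto_nhdsWithin_of_tendsto_nhds this

lemma real_lower {n : ℕ} (hn : 2 ≤ n) (a : Fin n → ℕ) (hpos : ∀ i, 0 < a i) :
    ∀ᶠ σ : ℝ in 𝓝[>] 0, GR a / (8 * Real.pi) - 2 ^ n * 16 * σ ≤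
      (Real.cosh (σ / 2) / Real.pi * kR a (2 * Real.sinh (σ / 2)) - GR a / Real.pi) / σ ^ 2 := by
  have hid : Tendsto (fun q : ℝ => q) (𝓝[>] 0) (𝓝 0) :=
    tendsto_nhdsWithin_of_tendsto_nhds tendsto_id
  have hq1 : ∀ᶠ q : ℝ in 𝓝[>] 0, q < 1 := hid.eventually_lt_const one_pos
  filter_upwards [self_mem_nhdsWithin, cosh_tendsto.eventually_lt_const one_lt_two,
    q_tendsto.eventually hq1, hq1] with σ hσ hc hq hσ1
  have hσ : 0 < σ := hσ
  have hpi := Real.pi_pos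
  have hG := GR_pos a hn hpos
  have hs0 : 0 < Real.sinh (σ / 2) := Real.sinh_pos_iff.mpr (by linarith)
  have hk := kR_lower a hn hpos (q := 2 * Real.sinh (σ / 2)) (by linarith) hq.le
  have hs1 : 2 * Real.sinh (σ / 2) ≤ 2 * σ := by
    rw [Real.sinh_eq]
    have h1 := Real.abs_exp_sub_one_le (x := σ / 2) (by rw [abs_of_pos] <;> linarith)
    have h2 := Real.abs_exp_sub_one_le (x := -(σ / 2)) (by rw [abs_neg, abs_of_pos] <;> linarith)
    rw [abs_neg] at h2
    rw [abs_of_pos (by linarith : 0 < σ / 2)] at h1 h2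
    have h1' := (abs_le.mp h1).2
    have h2' := (abs_le.mp h2).1
    linarith
  have hch : 1 + σ ^ 2 / 8 ≤ Real.cosh (σ / 2) := by
    have e1 := Real.cosh_two_mul (σ / 4)
    have e2 := Real.cosh_sq' (σ / 4)
    have e3 : σ / 4 ≤ Real.sinh (σ / 4) := Real.self_le_sinh_iff.mpr (by linarith)
    have e4 : 2 * (σ / 4) = σ / 2 := by ring
    rw [e4] at e1
    nlinarith
  set q := 2 * Real.sinh (σ / 2)
  have hq3 : q ^ 3 ≤ (2 * σ) ^ 3 := by gcongr
  have hcp := Real.cosh_pos (σ / 2)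
  set c := Real.cosh (σ / 2)
  have h2n : (0:ℝ) < 2 ^ n := by positivity
  rw [le_div_iff₀ (by positivity)]
  have m1 : c * (GR a - 2 ^ n * Real.pi * q ^ 3) ≤ c * kR a q := by gcongr
  have m2 : (1 + σ ^ 2 / 8) * GR a ≤ c * GR a := by gcongr
  have m3 : c * (2 ^ n * Real.pi * q ^ 3) ≤ 2 * (2 ^ n * Real.pi * (2 * σ) ^ 3) := by gcongr
  have m4 : σ ^ 2 / 8 * GR a - 2 ^ n * Real.pi * 16 * σ ^ 3 ≤ c * kR a q - GR a := by
    nlinarith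
  calc (GR a / (8 * Real.pi) - 2 ^ n * 16 * σ) * σ ^ 2
      = (σ ^ 2 / 8 * GR a - 2 ^ n * Real.pi * 16 * σ ^ 3) / Real.pi := by
        field_simp
    _ ≤ (c * kR a q - GR a) / Real.pi := by gcongr
    _ = _ := by ring

/-- the chain rule at `x = 1` for `f ∘ log` -/
lemma log_derivs (f : ℂ → ℂ) (hf : AnalyticAt ℂ f 0) :
    deriv (fun x => f (Complex.log x)) 1 = deriv f 0 ∧
    iteratedDeriv 2 (fun x => f (Complex.log x)) 1 = iteratedDeriv 2 f 0 - deriv f 0 ∧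
    iteratedDeriv 3 (fun x => f (Complex.log x)) 1 =
      iteratedDeriv 3 f 0 - 3 * iteratedDeriv 2 f 0 + 2 * deriv f 0 := by
  have hlog : Tendsto Complex.log (𝓝 1) (𝓝 0) := by
    have := (continuousAt_clog (x := 1) (by simp)).tendsto
    simpa using this
  have hsl : ∀ᶠ x : ℂ in 𝓝 1, x ∈ Complex.slitPlane :=
    Complex.isOpen_slitPlane.mem_nhds (by simp)
  have step : ∀ g : ℂ → ℂ, AnalyticAt ℂ g 0 → ∀ᶠ x in 𝓝 (1:ℂ),
      HasDerivAt (fun x => g (Complex.log x)) (deriv g (Complex.log x) * x⁻¹) x := by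
    intro g hg
    filter_upwards [hlog.eventually hg.eventually_analyticAt, hsl] with x hx hx'
    exact hx.differentiableAt.hasDerivAt.comp x (Complex.hasDerivAt_log hx')
  have s0 := step f hf
  have s1 := step _ hf.deriv
  have s2 := step _ hf.deriv.deriv
  have d1 : deriv (fun x => f (Complex.log x)) =ᶠ[𝓝 1]
      fun x => deriv f (Complex.log x) * x⁻¹ := by
    filter_upwards [s0] with x hx using hx.deriv
  have d2 : deriv (deriv (fun x => f (Complex.log x))) =ᶠ[𝓝 1]
      fun x => (deriv (deriv f) (Complex.log x) - deriv f (Complex.log x)) * (x⁻¹ * x⁻¹) := by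
    filter_upwards [d1.eventuallyEq_nhds, s1, hsl] with x hx h1 hx'
    rw [hx.deriv_eq]
    have hx0 : x ≠ 0 := Complex.slitPlane_ne_zero hx'
    rw [(h1.fun_mul (hasDerivAt_inv hx0)).deriv]
    field_simp
    ring
  have d3 : deriv (deriv (deriv (fun x => f (Complex.log x)))) 1 =
      deriv (deriv (deriv f)) 0 - 3 * deriv (deriv f) 0 + 2 * deriv f 0 := by
    rw [d2.deriv_eq]
    have hi := hasDerivAt_inv (one_ne_zero (α := ℂ))
    rw [((s2.self_of_nhds.fun_sub s1.self_of_nhds).fun_mul (hi.fun_mul hi)).deriv]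
    simp
    ring
  refine ⟨?_, ?_, ?_⟩
  · rw [d1.self_of_nhds]; simp
  · simp only [iteratedDeriv_succ, iteratedDeriv_zero]
    rw [d2.self_of_nhds]; simp
  · simp only [iteratedDeriv_succ, iteratedDeriv_zero]
    exact d3

lemma second_deriv (f g : ℂ → ℂ) (hg : AnalyticAt ℂ g 0) (c : ℂ)
    (h : ∀ᶠ s in 𝓝 (0:ℂ), f s - c = s ^ 2 * g s) : iteratedDeriv 2 f 0 = 2 * g 0 := by
  have h' : f =ᶠ[𝓝 0] fun s => c + s ^ 2 * g s := by
    filter_upwards [h] with s hs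
    rw [← hs]; ring
  rw [h'.iteratedDeriv_eq]
  simp only [iteratedDeriv_succ, iteratedDeriv_zero]
  have d1 : deriv (fun s => c + s ^ 2 * g s) =ᶠ[𝓝 0] fun s => 2 * s * g s + s ^ 2 * deriv g s := by
    filter_upwards [hg.eventually_analyticAt] with s hs
    have := (((hasDerivAt_pow 2 s).mul hs.differentiableAt.hasDerivAt).const_add c).deriv
    simpa using this
  rw [d1.deriv_eq]
  have a1 := (((hasDerivAt_id (0:ℂ)).const_mul 2).mul hg.differentiableAt.hasDerivAt).add
    ((hasDerivAt_pow 2 (0:ℂ)).mul hg.deriv.differentiableAt.hasDerivAt)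
  have a2 := a1.deriv
  simp at a2
  exact a2


/-- Theorem on the Laurent expansion, including degenerate weights: for a
weight vector of positive integers (repetitions allowed) with gcd 1, there is an analytic
extension `H` near `x = 1` of `(1-x)^{2n-2}(1-x²)P_A(x)` (where `P_A` is the Molien
integral, so `(1-x²)P_A(x)` is the on-shell Hilbert series) with `H(1) = γ₀ > 0`,
`H′(1) = 0` (`γ₁ = 0`), and `H″(1)/2 = γ₂ > 0` with `γ₂ = γ₃ = -H‴(1)/6`. -/
theorem on_shell_hilbert_series_laurent_coefficients_degenerate (n : ℕ) (hn : 2 ≤ n)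
    (a : Fin n → ℕ) (hpos : ∀ i, 0 < a i) (hgcd : Finset.univ.gcd a = 1) :
    ∃ (H : ℂ → ℂ) (N : Set ℂ), N ∈ 𝓝 (1 : ℂ) ∧ AnalyticOnNhd ℂ H N ∧
      (∀ x ∈ N, 0 < ‖x‖ → ‖x‖ < 1 →
        H x = (1 - x) ^ (2 * n - 2) * ((1 - x ^ 2) *
          ((2 * Real.pi * Complex.I)⁻¹ *
            (∮ z in C(0, 1),
              1 / (z * ∏ j, ((1 - x * z ^ a j) * (1 - x * (z ^ a j)⁻¹))))))) ∧
      (∃ γ₀ γ₂ : ℝ, 0 < γ₀ ∧ 0 < γ₂ ∧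
        H 1 = γ₀ ∧
        deriv H 1 = 0 ∧
        iteratedDeriv 2 H 1 / 2 = γ₂ ∧
        iteratedDeriv 2 H 1 / 2 = -(iteratedDeriv 3 H 1) / 6) := by
  obtain ⟨H₀, hmer, hH₀⟩ := target_germ hn a hpos
  have hG := GR_pos a hn hpos
  have hpi := Real.pi_pos
  -- the real function
  set R : ℝ → ℝ := fun σ => Real.cosh (σ / 2) / Real.pi * kR a (2 * Real.sinh (σ / 2)) with hR
  have hRlim : Tendsto R (𝓝[>] 0) (𝓝 (GR a / Real.pi)) := by
    have h1 := (kR_tendsto a hn hpos hgcd).comp q_tendsto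
    have h2 := (cosh_tendsto.div_const Real.pi).mul h1
    have e : 1 / Real.pi * GR a = GR a / Real.pi := by ring
    rw [e] at h2
    exact h2
  have hmap : ∀ c : ℝ, c ≠ 0 →
      Tendsto (fun σ : ℝ => ((c * σ : ℝ) : ℂ)) (𝓝[>] 0) (𝓝[≠] 0) := by
    intro c hc
    apply tendsto_nhdsWithin_of_tendsto_nhds_of_eventually_within
    · have : Continuous fun σ : ℝ => ((c * σ : ℝ) : ℂ) := by fun_prop
      have := this.tendsto 0
      simp only [mul_zero, Complex.ofReal_zero] at this
      exact tendsto_nhdsWithin_of_tendsto_nhds this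
    · filter_upwards [self_mem_nhdsWithin] with σ hσ
      have hσ : 0 < σ := hσ
      have : c * σ ≠ 0 := mul_ne_zero hc hσ.ne'
      simpa using this
  have hneg : Tendsto (fun σ : ℝ => ((-σ : ℝ) : ℂ)) (𝓝[>] 0) (𝓝[≠] 0) := by
    simpa using hmap (-1) (by norm_num)
  have hplus : Tendsto (fun σ : ℝ => ((σ : ℝ) : ℂ)) (𝓝[>] 0) (𝓝[≠] 0) := by
    simpa using hmap 1 (by norm_num)
  have hle : (𝓝[≠] (0:ℂ)) ≤ 𝓝 0 := nhdsWithin_le_nhds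
  have hval : ∀ᶠ σ : ℝ in 𝓝[>] 0, H₀ ((-σ : ℝ) : ℂ) = ((R σ : ℝ) : ℂ) := by
    filter_upwards [(hneg.mono_right hle).eventually hH₀, self_mem_nhdsWithin] with σ h1 hσ
    have hσ : 0 < σ := hσ
    rw [h1.1 (by rw [Complex.ofReal_re]; linarith), molTarget_real hn]
  have hlim : Tendsto (fun σ : ℝ => H₀ ((-σ : ℝ) : ℂ)) (𝓝[>] 0)
      (𝓝 ((GR a / Real.pi : ℝ) : ℂ)) := by
    refine Tendsto.congr' (hval.mono fun σ h => h.symm) ?_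
    exact (Complex.continuous_ofReal.tendsto _).comp hRlim
  have hord : 0 ≤ meromorphicOrderAt H₀ 0 := by
    by_contra hcon
    have h1 := (tendsto_cobounded_iff_meromorphicOrderAt_neg hmer).mpr (not_le.mp hcon)
    have h2 := tendsto_norm_atTop_iff_cobounded.mpr (h1.comp hneg)
    exact not_tendsto_nhds_of_tendsto_atTop h2 _ hlim.norm
  have hK := hmer.meromorphicOrderAt_nonneg_iff_analyticAt_toMeromorphicNFAt.mp hord
  have hKeq := hmer.eq_nhdsNE_toMeromorphicNFAt
  set K := toMeromorphicNFAt H₀ 0 with hKdef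
  have hKval : ∀ᶠ σ : ℝ in 𝓝[>] 0, K ((-σ : ℝ) : ℂ) = ((R σ : ℝ) : ℂ) := by
    filter_upwards [hval, hneg.eventually hKeq] with σ h1 h2
    rw [← h2, h1]
  have hK0 : K 0 = ((GR a / Real.pi : ℝ) : ℂ) := by
    have h1 : Tendsto (fun σ : ℝ => K ((-σ : ℝ) : ℂ)) (𝓝[>] 0) (𝓝 (K 0)) :=
      hK.continuousAt.tendsto.comp (hneg.mono_right hle)
    have h2 : Tendsto (fun σ : ℝ => K ((-σ : ℝ) : ℂ)) (𝓝[>] 0)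
        (𝓝 ((GR a / Real.pi : ℝ) : ℂ)) :=
      Tendsto.congr' (hKval.mono fun σ h => h.symm)
        ((Complex.continuous_ofReal.tendsto _).comp hRlim)
    exact tendsto_nhds_unique h1 h2
  have heven : (fun s => K (-s)) =ᶠ[𝓝 0] K := by
    have hKn : AnalyticAt ℂ (fun s => K (-s)) 0 := by
      apply AnalyticAt.fun_comp (g := K) (f := fun s => -s)
      · simpa using hK
      · fun_prop
    refine (hKn.frequently_eq_iff_eventually_eq hK).mp ?_
    refine hplus.frequently (Eventually.frequently ?_)
    filter_upwards [hneg.eventually hKeq, hplus.eventually hKeq,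
      (hplus.mono_right hle).eventually hH₀, self_mem_nhdsWithin] with σ h1 h2 h3 hσ
    have hσ : 0 < σ := hσ
    rw [Complex.ofReal_neg] at h1
    rw [← h1, ← h2]
    exact h3.2 (by simpa using hσ)
  have hodd : ∀ k : ℕ, Odd k → iteratedDeriv k K 0 = 0 := by
    intro k hk
    have h1 := heven.iteratedDeriv_eq k
    rw [iteratedDeriv_comp_neg, hk.neg_one_pow, neg_zero, neg_smul, one_smul] at h1
    have h2 : (2:ℂ) * iteratedDeriv k K 0 = 0 := by linear_combination -h1
    simpa using h2
  have hd1 : deriv K 0 = 0 := by simpa using hodd 1 (by decide)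
  have hd3 : iteratedDeriv 3 K 0 = 0 := hodd 3 (by decide)
  obtain ⟨g, hg, hgeq⟩ : ∃ g : ℂ → ℂ, AnalyticAt ℂ g 0 ∧
      ∀ᶠ s in 𝓝 (0:ℂ), K s - K 0 = s ^ 2 * g s := by
    have hA : AnalyticAt ℂ (fun s => K s - K 0) 0 := hK.sub analyticAt_const
    have h2 : ((2 : ℕ) : ℕ∞) ≤ analyticOrderAt (fun s => K s - K 0) 0 := by
      rw [natCast_le_analyticOrderAt_iff_iteratedDeriv_eq_zero hA]
      intro i hi
      interval_cases i
      · simp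
      · rw [iteratedDeriv_one, deriv_sub_const, hd1]
    obtain ⟨g, hg, h⟩ := (natCast_le_analyticOrderAt hA).mp h2
    exact ⟨g, hg, h.mono fun s hs => by simpa using hs⟩
  have hd2 := second_deriv K g hg (K 0) hgeq
  have hglim : Tendsto (fun σ : ℝ => (((R σ - GR a / Real.pi) / σ ^ 2 : ℝ) : ℂ)) (𝓝[>] 0)
      (𝓝 (g 0)) := by
    have h1 : Tendsto (fun σ : ℝ => g ((-σ : ℝ) : ℂ)) (𝓝[>] 0) (𝓝 (g 0)) :=
      hg.continuousAt.tendsto.comp (hneg.mono_right hle)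
    refine h1.congr' ?_
    filter_upwards [hKval, (hneg.mono_right hle).eventually hgeq, self_mem_nhdsWithin]
      with σ h2 h3 hσ
    have hσ : 0 < σ := hσ
    have hσ' : (σ : ℂ) ≠ 0 := by exact_mod_cast hσ.ne'
    rw [h2, hK0] at h3
    push_cast at h3 ⊢
    rw [h3]
    field_simp
  have hre : Tendsto (fun σ : ℝ => (R σ - GR a / Real.pi) / σ ^ 2) (𝓝[>] 0)
      (𝓝 (g 0).re) := by
    have := (Complex.continuous_re.tendsto _).comp hglim
    exact this.congr fun σ => Complex.ofReal_re _
  have him : (g 0).im = 0 := by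
    have h1 := (Complex.continuous_im.tendsto _).comp hglim
    have h2 : Tendsto (fun _ : ℝ => (0:ℝ)) (𝓝[>] 0) (𝓝 (g 0).im) :=
      h1.congr fun σ => Complex.ofReal_im _
    exact tendsto_nhds_unique h2 tendsto_const_nhds |>.symm ▸ rfl
  have hg0 : g 0 = (((g 0).re : ℝ) : ℂ) := by
    apply Complex.ext <;> simp [him]
  have hgpos : 0 < (g 0).re := by
    have h1 : Tendsto (fun σ : ℝ => GR a / (8 * Real.pi) - 2 ^ n * 16 * σ) (𝓝[>] 0)
        (𝓝 (GR a / (8 * Real.pi))) := by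
      have : Continuous fun σ : ℝ => GR a / (8 * Real.pi) - 2 ^ n * 16 * σ := by fun_prop
      have := this.tendsto 0
      rw [mul_zero, sub_zero] at this
      exact tendsto_nhdsWithin_of_tendsto_nhds this
    have h2 := le_of_tendsto_of_tendsto h1 hre (real_lower hn a hpos)
    have h3 : 0 < GR a / (8 * Real.pi) := by positivity
    linarith
  -- the function near `x = 1`
  have hlog : Tendsto Complex.log (𝓝 1) (𝓝 0) := by
    have := (continuousAt_clog (x := 1) (by simp)).tendsto
    simpa using this
  obtain ⟨l1, l2, l3⟩ := log_derivs K hK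
  have hFan : AnalyticAt ℂ (fun x => K (Complex.log x)) 1 := by
    apply AnalyticAt.fun_comp (g := K) (f := Complex.log)
    · simpa using hK
    · exact analyticAt_clog (by simp)
  have hKeq' : ∀ᶠ s in 𝓝 (0:ℂ), s ≠ 0 → H₀ s = K s := eventually_nhdsWithin_iff.mp hKeq
  refine ⟨fun x => K (Complex.log x), {x | AnalyticAt ℂ (fun x => K (Complex.log x)) x ∧
    (0 < ‖x‖ → ‖x‖ < 1 → K (Complex.log x) = molTarget a x)}, ?_, fun x hx => hx.1,
    fun x hx h0 h1 => hx.2 h0 h1, GR a / Real.pi, (g 0).re, by positivity, hgpos, ?_, ?_, ?_, ?_⟩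
  · filter_upwards [hFan.eventually_analyticAt, hlog.eventually hKeq', hlog.eventually hH₀]
      with x h1 h2 h3
    refine ⟨h1, fun hx0 hx1 => ?_⟩
    have hneg : (Complex.log x).re < 0 := by
      rw [Complex.log_re]; exact Real.log_neg hx0 hx1
    have hne : Complex.log x ≠ 0 := by
      intro h; rw [h] at hneg; simp at hneg
    rw [← h2 hne, h3.1 hneg, Complex.exp_log (norm_pos_iff.mp hx0)]
  · simpa using hK0
  · rw [l1, hd1]
  · rw [l2, hd1, hd2, ← hg0]; ring
  · rw [l3, l2, hd1, hd2, hd3]; ring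
end

section
/- Let n ≥ 1, let Γ be a finite subgroup of the unitary group U_n(ℂ), and let {g_1, …, g_r} be a set of primitive pseudoreflections of Γ. Let G be a function analytic on a neighborhood N of 1 in ℂ with G(x) = (1 − x)^{2n}·M_Γ(x) for all x ∈ N with |x| < 1. Then G″(1)/2 = −G‴(1)/6 = (1/(12|Γ|)) Σ_{i=1}^r ( ord(g_i)² − 1 ), where ord(g_i) denotes the order of g_i in Γ. (Equivalently: the Laurent coefficients of the Hilbert series of the real invariants of Γ satisfy γ_2 = γ_3 = (1/(12|Γ|)) Σ_{i=1}^r (|g_i|² − 1).) -/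
open Filter Topology Finset Polynomial

lemma aux_squarefree {n m : ℕ} (hm : 0 < m) (A : Matrix (Fin n) (Fin n) ℂ) (hA : A ^ m = 1) :
    Squarefree (minpoly ℂ A) := by
  have h1 : minpoly ℂ A ∣ (X ^ m - 1 : ℂ[X]) := by
    apply minpoly.dvd
    simp [hA]
  have h2 : (X ^ m - 1 : ℂ[X]).Separable := by
    have := Polynomial.separable_X_pow_sub_C (F := ℂ) (n := m) 1
      (by exact_mod_cast hm.ne') one_ne_zero
    simpa using this
  exact h2.squarefree.squarefree_of_dvd h1

lemma aux_eq_one {n m : ℕ} (hn : 1 ≤ n) (hm : 0 < m) (A : Matrix (Fin n) (Fin n) ℂ)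
    (hA : A ^ m = 1) (hc : A.charpoly = (X - 1) ^ n) : A = 1 := by
  have h1 : minpoly ℂ A ∣ (X - 1) ^ n := hc ▸ Matrix.minpoly_dvd_charpoly A
  have h2 := ((aux_squarefree hm A hA).dvd_pow_iff_dvd (by omega)).1 h1
  have h3 := (minpoly.dvd_iff).1 h2
  simpa [sub_eq_zero] using h3

lemma aux_quad {n m : ℕ} (hn : 1 ≤ n) (hm : 0 < m) (A : Matrix (Fin n) (Fin n) ℂ)
    (hA : A ^ m = 1) (lam : ℂ) (hc : A.charpoly = (X - 1) ^ (n - 1) * (X - C lam)) :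
    A * (A - 1) = lam • (A - 1) := by
  have h1 : minpoly ℂ A ∣ ((X - 1) * (X - C lam)) ^ n := by
    refine (hc ▸ Matrix.minpoly_dvd_charpoly A).trans ?_
    rw [mul_pow]
    exact mul_dvd_mul (pow_dvd_pow _ (by omega)) (dvd_pow_self _ (by omega))
  have h2 := ((aux_squarefree hm A hA).dvd_pow_iff_dvd (by omega)).1 h1
  have h3 := (minpoly.dvd_iff).1 h2
  rw [mul_comm] at h3
  simp only [map_mul, map_sub, aeval_X, aeval_C, map_one, Algebra.algebraMap_eq_smul_one] at h3
  rw [sub_mul, sub_eq_zero] at h3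
  rw [h3]; simp

lemma aux_pow {n : ℕ} (A : Matrix (Fin n) (Fin n) ℂ) (lam : ℂ) (hl : lam ≠ 1)
    (h : A * (A - 1) = lam • (A - 1)) (k : ℕ) :
    A ^ k = 1 + ((lam ^ k - 1) / (lam - 1)) • (A - 1) := by
  have hl' : lam - 1 ≠ 0 := sub_ne_zero.2 hl
  induction k with
  | zero => simp
  | succ k ih =>
    rw [pow_succ', ih, mul_add, Matrix.mul_smul, h, mul_one, smul_smul]
    have : A = 1 + (1:ℂ) • (A - 1) := by simp
    nth_rewrite 1 [this]
    rw [add_assoc, ← add_smul]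
    congr 2
    field_simp
    ring

lemma aux_charpoly {n : ℕ} (hn : 1 ≤ n) (A : Matrix (Fin n) (Fin n) ℂ) (lam c : ℂ)
    (hc0 : c ≠ 0) (hc : A.charpoly = (X - 1) ^ (n - 1) * (X - C lam)) :
    (1 + c • (A - 1)).charpoly = (X - 1) ^ (n - 1) * (X - C (1 + c * (lam - 1))) := by
  apply Polynomial.funext
  intro t
  rw [Matrix.eval_charpoly]
  have : Matrix.scalar (Fin n) t - (1 + c • (A - 1)) =
      c • (Matrix.scalar (Fin n) (1 + (t - 1) / c) - A) := by
    have e : ∀ s : ℂ, Matrix.scalar (Fin n) s = s • (1 : Matrix (Fin n) (Fin n) ℂ) := by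
      intro s; ext i j; simp [Matrix.scalar_apply, Matrix.smul_apply, Matrix.one_apply, Matrix.diagonal_apply]
    rw [e, e, smul_sub c _ A, smul_smul, mul_add, mul_div_cancel₀ _ hc0]
    module
  rw [this, Matrix.det_smul, ← Matrix.eval_charpoly, hc]
  obtain ⟨k, rfl⟩ := Nat.exists_eq_add_of_le' hn
  simp only [Fintype.card_fin, eval_mul, eval_pow, eval_sub, eval_X, eval_one, eval_C,
    Nat.add_sub_cancel]
  rw [add_sub_cancel_left, div_pow, pow_succ]
  field_simp
  ring

lemma aux_det {n : ℕ} (hn : 1 ≤ n) (A : Matrix (Fin n) (Fin n) ℂ) (lam : ℂ)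
    (hc : A.charpoly = (X - 1) ^ (n - 1) * (X - C lam)) : A.det = lam := by
  rw [Matrix.det_eq_sign_charpoly_coeff, hc, Polynomial.coeff_zero_eq_eval_zero]
  obtain ⟨k, rfl⟩ := Nat.exists_eq_add_of_le' hn
  simp [pow_succ]
  rw [← mul_assoc, ← mul_pow]; simp

lemma aux_closed (m : ℂ) (z : ℂ) (N : ℕ) :
    (1 - z) ^ 2 * ∑ j ∈ range N, (j : ℂ) * (m - j) * z ^ j =
      -2 * ∑ j ∈ range N, z ^ j + 2 + (m + 1) * z + z ^ N * (-2 - N * (m - N))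
        + z ^ (N + 1) * ((N - 1) * (m - (N - 1))) := by
  induction N with
  | zero => simp; ring
  | succ N ih =>
    rw [sum_range_succ, sum_range_succ, mul_add, ih]
    push_cast
    ring

lemma aux_w (m : ℕ) (hm : 0 < m) (z : ℂ) (hz1 : z ≠ 1) (hz : z ^ m = 1) :
    ((1 - z) * (1 - z⁻¹))⁻¹ = -(1 / (2 * m)) * ∑ j ∈ range m, (j : ℂ) * (m - j) * z ^ j := by
  have h := aux_closed m z m
  have h0 : ∑ j ∈ range m, z ^ j = 0 := by
    rw [geom_sum_eq hz1, hz]; simp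
  rw [h0, pow_succ z m, hz] at h
  have hz0 : z ≠ 0 := by
    rintro rfl
    rw [zero_pow hm.ne'] at hz
    exact zero_ne_one hz
  have h1 : 1 - z ≠ 0 := sub_ne_zero.2 hz1.symm
  have h2 : 1 - z⁻¹ ≠ 0 := sub_ne_zero.2 (fun h => hz1 (by rw [← inv_inv z, ← h, inv_one]))
  have hm' : (m : ℂ) ≠ 0 := by exact_mod_cast hm.ne'
  have h3 : ∑ j ∈ range m, (j : ℂ) * (m - j) * z ^ j = 2 * m * z / (1 - z) ^ 2 := by
    rw [eq_div_iff (pow_ne_zero 2 h1), mul_comm, h]; ring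
  rw [h3]
  have h4 : 1 - z⁻¹ = -(1 - z) / z := by field_simp; ring
  rw [h4]
  field_simp

lemma aux_poly (m : ℂ) (N : ℕ) :
    ∑ j ∈ range N, (j : ℂ) * (m - j) = m * (N * (N - 1) / 2) - N * (N - 1) * (2 * N - 1) / 6 := by
  induction N with
  | zero => simp
  | succ N ih => rw [sum_range_succ, ih]; push_cast; ring

lemma aux_rootsum (m : ℕ) (hm : 0 < m) (z : ℂ) (hz : IsPrimitiveRoot z m) :
    ∑ k ∈ Ico 1 m, ((1 - z ^ k) * (1 - (z ^ k)⁻¹))⁻¹ = ((m : ℂ) ^ 2 - 1) / 12 := by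
  have hm' : (m : ℂ) ≠ 0 := by exact_mod_cast hm.ne'
  have h1 : ∑ k ∈ Ico 1 m, ((1 - z ^ k) * (1 - (z ^ k)⁻¹))⁻¹ =
      ∑ k ∈ Ico 1 m, -(1 / (2 * m)) * ∑ j ∈ range m, (j : ℂ) * (m - j) * (z ^ k) ^ j := by
    refine sum_congr rfl fun k hk => ?_
    rw [mem_Ico] at hk
    refine aux_w m hm _ (hz.pow_ne_one_of_pos_of_lt (by omega) hk.2) ?_
    rw [← pow_mul, mul_comm, pow_mul, hz.pow_eq_one, one_pow]
  have h2 : ∑ k ∈ range m, ∑ j ∈ range m, (j : ℂ) * (m - j) * (z ^ k) ^ j = 0 := by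
    rw [sum_comm]
    refine sum_eq_zero fun j hj => ?_
    rcases Nat.eq_zero_or_pos j with rfl | hj0
    · simp
    · rw [← mul_sum]
      have : ∀ k, (z ^ k) ^ j = (z ^ j) ^ k := fun k => by
        rw [← pow_mul, mul_comm, pow_mul]
      simp_rw [this]
      rw [geom_sum_eq (hz.pow_ne_one_of_pos_of_lt (by omega) (mem_range.1 hj)), ← this,
        hz.pow_eq_one]
      simp
  rw [range_eq_Ico, sum_eq_sum_Ico_succ_bot hm] at h2
  rw [h1, ← mul_sum]
  have h3 : ∑ j ∈ Ico 0 m, (j : ℂ) * (m - j) * (z ^ 0) ^ j =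
     m * (m * (m - 1) / 2) - m * (m - 1) * (2 * m - 1) / 6 := by
    rw [← aux_poly, range_eq_Ico]; simp
  rw [h3] at h2
  rw [range_eq_Ico, eq_neg_of_add_eq_zero_right h2]
  field_simp
  ring

def HasT (F : ℂ → ℂ) (c : ℂ) : Prop :=
  AnalyticAt ℂ F 1 ∧ iteratedDeriv 2 F 1 = 2 * c ∧ iteratedDeriv 3 F 1 = -6 * c

lemma hasT_sq (E : ℂ → ℂ) (hE : AnalyticAt ℂ E 1) (hd : deriv E 1 = - E 1) :
    HasT (fun x => (1 - x) ^ 2 * E x) (E 1) := by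
  have d0 : deriv (fun x : ℂ => (1 - x) ^ 2) = fun x => -2 * (1 - x) := by
    ext x
    have := ((hasDerivAt_id' x).const_sub 1).fun_pow 2
    rw [this.deriv]; simp
  refine ⟨by fun_prop, ?_, ?_⟩
  · rw [iteratedDeriv_fun_mul (by fun_prop) (hE.contDiffAt)]
    simp [Finset.sum_range_succ, iteratedDeriv_succ', d0]
  · rw [iteratedDeriv_fun_mul (by fun_prop) (hE.contDiffAt)]
    simp [Finset.sum_range_succ, iteratedDeriv_succ', d0, hd, Nat.choose]
    ring_nf
    simp

lemma hasT_one : HasT (fun _ => 1) 0 := by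
  refine ⟨by fun_prop, ?_, ?_⟩ <;> simp [iteratedDeriv_const]

lemma hasT_four (E : ℂ → ℂ) (hE : AnalyticAt ℂ E 1) :
    HasT (fun x => (1 - x) ^ 4 * E x) 0 := by
  have := hasT_sq (fun x => (1 - x) ^ 2 * E x) (by fun_prop) (by
    have : HasDerivAt (fun x : ℂ => (1 - x) ^ 2 * E x) 0 1 := by
      have := (((hasDerivAt_id' (1:ℂ)).const_sub 1).fun_pow 2).fun_mul hE.differentiableAt.hasDerivAt
      exact this.congr_deriv (by simp)
    rw [this.deriv]; simp)
  convert this using 1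
  · ext x; ring
  · simp

lemma hasT_sum {ι : Type*} (s : Finset ι) (F : ι → ℂ → ℂ) (c : ι → ℂ)
    (h : ∀ i ∈ s, HasT (F i) (c i)) (a : ℂ) :
    HasT (fun x => a * ∑ i ∈ s, F i x) (a * ∑ i ∈ s, c i) := by
  have han : AnalyticAt ℂ (fun x => ∑ i ∈ s, F i x) 1 := 
    Finset.analyticAt_fun_sum s fun i hi => (h i hi).1
  refine ⟨by fun_prop, ?_, ?_⟩
  · rw [iteratedDeriv_const_mul _ han.contDiffAt, 
      iteratedDeriv_fun_sum fun i hi => (h i hi).1.contDiffAt,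
      sum_congr rfl fun i hi => (h i hi).2.1, ← mul_sum]
    ring
  · rw [iteratedDeriv_const_mul _ han.contDiffAt, 
      iteratedDeriv_fun_sum fun i hi => (h i hi).1.contDiffAt,
      sum_congr rfl fun i hi => (h i hi).2.2, ← mul_sum]
    ring

lemma hasT_unique (F G : ℂ → ℂ) (c : ℂ) (hF : HasT F c) (hG : AnalyticAt ℂ G 1)
    (h : ∀ᶠ x in 𝓝 (1 : ℂ), ‖x‖ < 1 → G x = F x) : HasT G c := by
  have hfr : ∃ᶠ x in 𝓝[≠] (1 : ℂ), ‖x‖ < 1 := by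
    have ht : Tendsto (fun k : ℕ => (1 - 1 / ((k : ℂ) + 1))) atTop (𝓝[≠] 1) := by
      rw [tendsto_nhdsWithin_iff]
      constructor
      · have := (tendsto_one_div_add_atTop_nhds_zero_nat (𝕜 := ℂ)).const_sub 1
        simpa using this
      · filter_upwards with k
        have : (k : ℂ) + 1 ≠ 0 := by exact_mod_cast k.succ_ne_zero
        simp [this]
    refine ht.frequently (Eventually.frequently ?_)
    filter_upwards with k
    have e : (1 - 1 / ((k : ℂ) + 1)) = ((1 - 1 / ((k : ℝ) + 1) : ℝ) : ℂ) := by push_cast; rfl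
    rw [e, Complex.norm_real, Real.norm_eq_abs, abs_lt]
    have : 0 < 1 / ((k : ℝ) + 1) := by positivity
    have : 1 / ((k : ℝ) + 1) ≤ 1 := by rw [div_le_one (by positivity)]; simp
    constructor <;> linarith
  have he : G =ᶠ[𝓝 1] F := by
    refine (hG.frequently_eq_iff_eventually_eq hF.1).1 ?_
    exact (hfr.and_eventually (h.filter_mono nhdsWithin_le_nhds)).mono fun x hx => hx.2 hx.1
  exact ⟨hG, by rw [he.iteratedDeriv_eq, hF.2.1], by rw [he.iteratedDeriv_eq, hF.2.2]⟩

lemma aux_factor {n : ℕ} (A B : Matrix (Fin n) (Fin n) ℂ) (hAB : B * A = 1) (a : ℕ)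
    (ha : a ≤ n) (q : ℂ[X]) (hq : A.charpoly = (X - 1) ^ a * q) (x : ℂ) (hx0 : x ≠ 0)
    (hx1 : x ≠ 1) :
    (1 - x) ^ (2 * n) * (Matrix.det (1 - x • A) * Matrix.det (1 - x • B))⁻¹ =
      (1 - x) ^ (2 * (n - a)) *
        (x ^ (n - a) * q.eval x⁻¹ * (B.det * (-1) ^ (n - a) * q.eval x))⁻¹ := by
  obtain ⟨b, rfl⟩ := Nat.exists_eq_add_of_le ha
  have e : ∀ s : ℂ, Matrix.scalar (Fin (a + b)) s = s • (1 : Matrix _ _ ℂ) := by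
    intro s; ext i j
    simp [Matrix.scalar_apply, Matrix.smul_apply, Matrix.one_apply, Matrix.diagonal_apply]
  have h1 : Matrix.det (1 - x • A) = (1 - x) ^ a * (x ^ b * q.eval x⁻¹) := by
    have : 1 - x • A = x • (Matrix.scalar _ x⁻¹ - A) := by
      rw [e, smul_sub, smul_smul, mul_inv_cancel₀ hx0, one_smul]
    rw [this, Matrix.det_smul, ← Matrix.eval_charpoly, hq]
    simp only [Fintype.card_fin, eval_mul, eval_pow, eval_sub, eval_X, eval_one]
    have : 1 - x = x * (x⁻¹ - 1) := by field_simp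
    rw [this, mul_pow, pow_add]; ring
  have h2 : Matrix.det (1 - x • B) = (1 - x) ^ a * (B.det * (-1) ^ b * q.eval x) := by
    have : 1 - x • B = B * ((-1 : ℂ) • (Matrix.scalar _ x - A)) := by
      rw [e, Matrix.mul_smul, mul_sub, hAB]; simp
    rw [this, Matrix.det_mul, Matrix.det_smul, ← Matrix.eval_charpoly, hq]
    simp only [Fintype.card_fin, eval_mul, eval_pow, eval_sub, eval_X, eval_one]
    have : 1 - x = (-1) * (x - 1) := by ring
    rw [this, mul_pow, pow_add]; ring
  rw [h1, h2, Nat.add_sub_cancel_left]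
  have hx : 1 - x ≠ 0 := sub_ne_zero.2 hx1.symm
  have e1 : (1 - x) ^ (2 * (a + b)) = (1 - x) ^ (2 * b) * ((1 - x) ^ a * (1 - x) ^ a) := by ring
  rw [e1, mul_mul_mul_comm ((1 - x) ^ a), mul_inv, mul_assoc,
    mul_inv_cancel_left₀ (mul_ne_zero (pow_ne_zero _ hx) (pow_ne_zero _ hx))]

def IsPR {n : ℕ} (A : Matrix (Fin n) (Fin n) ℂ) : Prop :=
  ∃ lam : ℂ, lam ≠ 1 ∧ A.charpoly = (X - 1) ^ (n - 1) * (X - C lam)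

lemma aux_term_pr {n : ℕ} (hn : 1 ≤ n) (A B : Matrix (Fin n) (Fin n) ℂ) (hAB : B * A = 1)
    (h : IsPR A) :
    ∃ F, HasT F ((1 - A.det) * (1 - A.det⁻¹))⁻¹ ∧ ∀ᶠ x in 𝓝 (1 : ℂ), x ≠ 1 →
      (1 - x) ^ (2 * n) * (Matrix.det (1 - x • A) * Matrix.det (1 - x • B))⁻¹ = F x := by
  obtain ⟨lam, hl, hc⟩ := h
  have hd := aux_det hn A lam hc
  have hdB : B.det * lam = 1 := by rw [← hd, ← Matrix.det_mul, hAB, Matrix.det_one]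
  have hl0 : lam ≠ 0 := right_ne_zero_of_mul_eq_one hdB
  have hdB' : B.det = lam⁻¹ := eq_inv_of_mul_eq_one_left hdB
  rw [hd]
  have h1 : 1 - lam ≠ 0 := sub_ne_zero.2 hl.symm
  have h2 : 1 - lam⁻¹ ≠ 0 :=
    sub_ne_zero.2 (fun h => hl (by rw [← inv_inv lam, ← h, inv_one]))
  have hder : HasDerivAt (fun x : ℂ => (1 - lam * x) * (1 - lam⁻¹ * x))
      ((1 - lam) * (1 - lam⁻¹)) 1 := by
    have := ((((hasDerivAt_id' (1:ℂ)).const_mul lam).const_sub 1).fun_mul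
      (((hasDerivAt_id' (1:ℂ)).const_mul lam⁻¹).const_sub 1))
    refine this.congr_deriv ?_
    field_simp
    ring
  have hT := hasT_sq (fun x => ((1 - lam * x) * (1 - lam⁻¹ * x))⁻¹) (by
      refine AnalyticAt.fun_inv (by fun_prop) ?_
      simpa using ⟨h1, h2⟩) (by
      rw [(hder.fun_inv (by simpa using ⟨h1, h2⟩)).deriv]
      simp only [mul_one]
      field_simp)
  simp only [mul_one] at hT
  refine ⟨_, hT, ?_⟩
  filter_upwards [isOpen_ne.mem_nhds (one_ne_zero : (1 : ℂ) ≠ 0)] with x hx0 hx1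
  rw [aux_factor A B hAB (n - 1) (by omega) _ hc x hx0 hx1, hdB']
  have : n - (n - 1) = 1 := by omega
  rw [this]
  simp only [mul_one, pow_one, eval_sub, eval_X, eval_C]
  have hx0' : x ≠ 0 := hx0
  congr 2
  field_simp
  ring

lemma aux_term_other {n m : ℕ} (hn : 1 ≤ n) (hm : 0 < m) (A B : Matrix (Fin n) (Fin n) ℂ)
    (hA : A ^ m = 1) (hAB : B * A = 1) (h : ¬ IsPR A) :
    ∃ F, HasT F 0 ∧ ∀ᶠ x in 𝓝 (1 : ℂ), x ≠ 1 →
      (1 - x) ^ (2 * n) * (Matrix.det (1 - x • A) * Matrix.det (1 - x • B))⁻¹ = F x := by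
  have hmon := A.charpoly_monic
  have hdeg : A.charpoly.natDegree = n := by simp [Matrix.charpoly_natDegree_eq_dim]
  obtain ⟨q, hq, hq1⟩ := Polynomial.exists_eq_pow_rootMultiplicity_mul_and_not_dvd
    A.charpoly hmon.ne_zero 1
  set a := A.charpoly.rootMultiplicity 1
  rw [Polynomial.dvd_iff_isRoot, Polynomial.IsRoot.def] at hq1
  rw [C_1] at hq
  have hmX : ((X - 1 : ℂ[X]) ^ a).Monic := by
    have := (monic_X_sub_C (1:ℂ)).pow a
    rwa [C_1] at this
  have hqm : q.Monic := hmX.of_mul_monic_left (hq ▸ hmon)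
  have hdq : a + q.natDegree = n := by
    rw [← hdeg, hq, hmX.natDegree_mul hqm]
    congr 1
    rw [← C_1, natDegree_pow, natDegree_X_sub_C, mul_one]
  have hbig : a + 2 ≤ n ∨ a + 1 = n ∨ a = n := by omega
  have hdB : B.det ≠ 0 := by
    have : B.det * A.det = 1 := by rw [← Matrix.det_mul, hAB, Matrix.det_one]
    exact left_ne_zero_of_mul_eq_one this
  rcases hbig with hb | hb | hb
  · obtain ⟨b, hb'⟩ := Nat.exists_eq_add_of_le hb
    refine ⟨_, hasT_four (fun x => (1 - x) ^ (2 * b) *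
      (x ^ (n - a) * q.eval x⁻¹ * (B.det * (-1) ^ (n - a) * q.eval x))⁻¹) ?_, ?_⟩
    · refine AnalyticAt.fun_mul (by fun_prop) (AnalyticAt.fun_inv ?_ ?_)
      · have i1 : AnalyticAt ℂ (fun x : ℂ => x⁻¹) 1 := analyticAt_inv one_ne_zero
        have i2 : ∀ y, AnalyticAt ℂ (fun x : ℂ => q.eval x) y := fun y =>
          (AnalyticOnNhd.eval_polynomial q) y trivial
        have i3 : AnalyticAt ℂ (fun x : ℂ => q.eval x⁻¹) 1 :=
          AnalyticAt.fun_comp (i2 _) i1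
        have i4 := i2 1
        fun_prop
      · simp [hq1, hdB]
    · filter_upwards [isOpen_ne.mem_nhds (one_ne_zero : (1 : ℂ) ≠ 0)] with x hx0 hx1
      rw [aux_factor A B hAB a (by omega) _ hq x hx0 hx1, ← mul_assoc ((1 - x) ^ 4), ← pow_add]
      congr 2
      omega
  · exfalso
    have : q.natDegree = 1 := by omega
    have hqe := hqm.eq_X_add_C this
    refine h ⟨-q.coeff 0, ?_, ?_⟩
    · intro h'
      apply hq1
      rw [hqe]
      simp [← h']
    · rw [hq]
      nth_rewrite 1 [hqe]
      have : n - 1 = a := by omega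
      rw [this]; simp
  · have : q = 1 := by
      apply hqm.natDegree_eq_zero.1; omega
    have hA1 : A = 1 := aux_eq_one hn hm A hA (by rw [hq, this, hb, mul_one])
    have hB1 : B = 1 := by rw [hA1, mul_one] at hAB; exact hAB
    refine ⟨_, hasT_one, ?_⟩
    filter_upwards with x hx1
    have hx : 1 - x ≠ 0 := sub_ne_zero.2 hx1.symm
    have e : (1 : Matrix (Fin n) (Fin n) ℂ) - x • 1 = (1 - x) • 1 := by rw [sub_smul, one_smul]
    rw [hA1, hB1, e, Matrix.det_smul, Matrix.det_one, Fintype.card_fin]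
    rw [mul_one, ← pow_add, ← two_mul]
    exact mul_inv_cancel₀ (pow_ne_zero _ hx)


lemma aux_main {n : ℕ} (hn : 1 ≤ n) {Γ : Type*} [Group Γ] [Fintype Γ]
    (M : Γ →* Matrix (Fin n) (Fin n) ℂ) (hM : Function.Injective M)
    (r : ℕ) (g : Fin r → Γ) (hpr : ∀ i, IsPR (M (g i)))
    (hcover : ∀ h : Γ, IsPR (M h) → ∃ (i : Fin r) (k : ℤ), h = g i ^ k)
    (hprim : ∀ (i j : Fin r) (k l : ℤ), g i ^ k = g j ^ l → g i ^ k ≠ 1 →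
      i = j ∧ k ≡ l [ZMOD (orderOf (g i))])
    (G : ℂ → ℂ) (N : Set ℂ) (hN : N ∈ 𝓝 (1 : ℂ)) (hG : AnalyticOnNhd ℂ G N)
    (hGeq : ∀ x ∈ N, ‖x‖ < 1 →
      G x = (1 - x) ^ (2 * n) * ((Fintype.card Γ : ℂ)⁻¹ * ∑ h : Γ,
          (Matrix.det (1 - x • M h) * Matrix.det (1 - x • M h⁻¹))⁻¹)) :
    iteratedDeriv 2 G 1 / 2 = -(iteratedDeriv 3 G 1) / 6 ∧
    iteratedDeriv 2 G 1 / 2 =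
      (12 * (Fintype.card Γ : ℂ))⁻¹ * ∑ i : Fin r, ((orderOf (g i) : ℂ) ^ 2 - 1) := by
  classical
  have hinv : ∀ h, M h⁻¹ * M h = 1 := fun h => by rw [← map_mul, inv_mul_cancel, map_one]
  have hfin : ∀ h, M h ^ (Fintype.card Γ) = 1 := fun h => by
    rw [← map_pow, pow_card_eq_one, map_one]
  let w : ℂ → ℂ := fun z => ((1 - z) * (1 - z⁻¹))⁻¹
  let c : Γ → ℂ := fun h => if IsPR (M h) then w (M h).det else 0
  have hF : ∀ h : Γ, ∃ F, HasT F (c h) ∧ ∀ᶠ x in 𝓝 (1 : ℂ), x ≠ 1 →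
      (1 - x) ^ (2 * n) * (Matrix.det (1 - x • M h) * Matrix.det (1 - x • M h⁻¹))⁻¹ = F x := by
    intro h
    by_cases hp : IsPR (M h)
    · simp only [c, if_pos hp]
      exact aux_term_pr hn _ _ (hinv h) hp
    · simp only [c, if_neg hp]
      exact aux_term_other hn Fintype.card_pos _ _ (hfin h) (hinv h) hp
  choose F hFT hFe using hF
  have hT : HasT G ((Fintype.card Γ : ℂ)⁻¹ * ∑ h : Γ, c h) := by
    refine hasT_unique _ _ _ (hasT_sum univ F c (fun h _ => hFT h) _)
      (hG 1 (mem_of_mem_nhds hN)) ?_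
    filter_upwards [hN, eventually_all.2 hFe] with x hxN hx hx1
    have hne : x ≠ 1 := by rintro rfl; simp at hx1
    rw [hGeq x hxN hx1, mul_left_comm, mul_sum]
    congr 1
    exact sum_congr rfl fun h _ => hx h hne
  -- facts about the powers
  have hpow : ∀ i : Fin r, IsPrimitiveRoot (M (g i)).det (orderOf (g i)) ∧
      ∀ k : ℕ, g i ^ k ≠ 1 → IsPR (M (g i ^ k)) := by
    intro i
    obtain ⟨lam, hl, hc⟩ := hpr i
    have hd := aux_det hn _ _ hc
    have hq := aux_quad hn Fintype.card_pos _ (hfin (g i)) lam hc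
    have hp := aux_pow _ lam hl hq
    have hl' : lam - 1 ≠ 0 := sub_ne_zero.2 hl
    have hone : ∀ k : ℕ, lam ^ k = 1 → g i ^ k = 1 := by
      intro k hk
      apply hM
      rw [map_pow, hp k, hk]; simp
    constructor
    · rw [hd]
      constructor
      · rw [← hd, ← Matrix.det_pow, ← map_pow, pow_orderOf_eq_one, map_one, Matrix.det_one]
      · intro k hk
        exact orderOf_dvd_of_pow_eq_one (hone k hk)
    · intro k hk
      have hk' : lam ^ k - 1 ≠ 0 := sub_ne_zero.2 fun h => hk (hone k h)
      refine ⟨lam ^ k, sub_ne_zero.1 hk', ?_⟩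
      have := aux_charpoly hn _ lam _ (div_ne_zero hk' hl') hc
      rw [map_pow, hp k, this, div_mul_cancel₀ _ hl', add_sub_cancel]
  have hsum : ∑ h : Γ, c h = ∑ i : Fin r, ((orderOf (g i) : ℂ) ^ 2 - 1) / 12 := by
    have h1 : ∀ i : Fin r, ((orderOf (g i) : ℂ) ^ 2 - 1) / 12 =
        ∑ k ∈ Ico 1 (orderOf (g i)), w ((M (g i)).det ^ k) := fun i =>
      (aux_rootsum _ (orderOf_pos _) _ (hpow i).1).symm
    simp_rw [h1]
    have hne : ∀ i, ∀ k ∈ Ico 1 (orderOf (g i)), g i ^ k ≠ 1 := by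
      intro i k hk
      rw [mem_Ico] at hk
      exact pow_ne_one_of_lt_orderOf (by omega) hk.2
    rw [← sum_filter, sum_sigma']
    symm
    refine sum_bij (fun (p : Σ _ : Fin r, ℕ) _ => g p.1 ^ p.2) ?_ ?_ ?_ ?_
    · rintro ⟨i, k⟩ hik
      rw [mem_sigma] at hik
      exact mem_filter.2 ⟨mem_univ _, (hpow i).2 k (hne i k hik.2)⟩
    · rintro ⟨i, k⟩ hik ⟨j, l⟩ hjl heq
      rw [mem_sigma] at hik hjl
      have h2 := hne i k hik.2
      simp only at heq hik hjl
      obtain ⟨rfl, hkl⟩ := hprim i j k l (by simpa using heq) (by simpa using h2)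
      rw [Int.natCast_modEq_iff] at hkl
      have hk := mem_Ico.1 hik.2
      have hl := mem_Ico.1 hjl.2
      rw [hkl.eq_of_lt_of_lt hk.2 hl.2]
    · intro h hh
      have hh' := (mem_filter.1 hh).2
      obtain ⟨i, k, rfl⟩ := hcover h hh'
      have hpos := orderOf_pos (g i)
      obtain ⟨l, hl⟩ := Int.eq_ofNat_of_zero_le
        (Int.emod_nonneg k (b := (orderOf (g i) : ℤ)) (by omega))
      have hlt : (l : ℤ) < orderOf (g i) := hl ▸ Int.emod_lt_of_pos k (by omega)
      have hkl : g i ^ l = g i ^ k := by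
        rw [← zpow_natCast, ← hl, zpow_mod_orderOf]
      refine ⟨⟨i, l⟩, mem_sigma.2 ⟨mem_univ _, mem_Ico.2 ⟨?_, by exact_mod_cast hlt⟩⟩, hkl⟩
      rw [Nat.one_le_iff_ne_zero]
      rintro rfl
      rw [← hkl, pow_zero, map_one] at hh'
      obtain ⟨lam, hl1, hc⟩ := hh'
      exact hl1 (by rw [← aux_det hn _ lam hc, Matrix.det_one])
    · rintro ⟨i, k⟩ hik
      simp only [map_pow, Matrix.det_pow]
  rw [hT.2.1, hT.2.2, hsum, ← sum_div]
  constructor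
  · ring
  · rw [mul_inv]; ring

/-- for a finite subgroup `Γ ≤ U_n(ℂ)` with a set of primitive
pseudoreflections `g_1, …, g_r` (each `g_i` a pseudoreflection, every pseudoreflection of
`Γ` a power of some `g_i`, and `g_i^k = g_j^ℓ ≠ e ⟹ i = j ∧ k ≡ ℓ mod ord(g_i)`), and
`G` an analytic extension of `(1-x)^{2n} M_Γ(x)` near `x = 1`, the Laurent coefficients
satisfy `γ₂ = H″(1)/2 = -H‴(1)/6 = γ₃ = (1/(12|Γ|)) Σ_i (ord(g_i)² - 1)`. -/
theorem molien_series_real_invariants_gamma2_gamma3 (n : ℕ) (hn : 1 ≤ n)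
    (Γ : Subgroup (Matrix.unitaryGroup (Fin n) ℂ)) [Fintype Γ]
    (r : ℕ) (g : Fin r → Γ)
    (hpr : ∀ i : Fin r, ∃ lam : ℂ, lam ≠ 1 ∧
      Matrix.charpoly (((g i : Matrix.unitaryGroup (Fin n) ℂ) :
          Matrix (Fin n) (Fin n) ℂ))
        = (X - 1) ^ (n - 1) * (X - C lam))
    (hcover : ∀ h : Γ,
      (∃ lam : ℂ, lam ≠ 1 ∧
        Matrix.charpoly (((h : Matrix.unitaryGroup (Fin n) ℂ) :
            Matrix (Fin n) (Fin n) ℂ))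
          = (X - 1) ^ (n - 1) * (X - C lam)) →
      ∃ (i : Fin r) (k : ℤ), h = g i ^ k)
    (hprim : ∀ (i j : Fin r) (k l : ℤ), g i ^ k = g j ^ l → g i ^ k ≠ 1 →
      i = j ∧ k ≡ l [ZMOD (orderOf (g i))])
    (G : ℂ → ℂ) (N : Set ℂ) (hN : N ∈ 𝓝 (1 : ℂ)) (hG : AnalyticOnNhd ℂ G N)
    (hGeq : ∀ x ∈ N, ‖x‖ < 1 →
      G x = (1 - x) ^ (2 * n) *
        ((Fintype.card Γ : ℂ)⁻¹ * ∑ h : Γ,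
          (Matrix.det (1 - x • ((h : Matrix.unitaryGroup (Fin n) ℂ) :
              Matrix (Fin n) (Fin n) ℂ)) *
            Matrix.det (1 - x • (((h⁻¹ : Γ) : Matrix.unitaryGroup (Fin n) ℂ) :
              Matrix (Fin n) (Fin n) ℂ)))⁻¹)) :
    iteratedDeriv 2 G 1 / 2 = -(iteratedDeriv 3 G 1) / 6 ∧
    iteratedDeriv 2 G 1 / 2 =
      (12 * (Fintype.card Γ : ℂ))⁻¹ * ∑ i : Fin r, ((orderOf (g i) : ℂ) ^ 2 - 1) := by
  let M : Γ →* Matrix (Fin n) (Fin n) ℂ :=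
    (Submonoid.subtype (Matrix.unitaryGroup (Fin n) ℂ)).comp Γ.subtype
  exact aux_main hn M (fun a b h => Subtype.ext (Subtype.ext h)) r g hpr hcover hprim G N hN hG hGeq
end
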